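/- arXiv:2407.04012 — 16 statements merged into one kernel-verified Lean document; each statement's English description precedes it below -/
import Mathlib

section
/- Let q : C ⥤ D and t : D ⥤ C be functors between abelian categories with q left adjoint to t. If both q and t are exact functors (they preserve short exact sequences), then for every n ≥ 1 and all objects X of C and Y of D there is an isomorphism of abelian groups Ext^n_D(q(X), Y) ≅ Ext^n_C(X, t(Y)), natural in both X and Y. -/
open CategoryTheory Limits

universe w v u v' u'

/-- The functor `q` sends the short exact sequence `0 ⟶ A ⟶ B ⟶ X ⟶ 0` (given by the
composable pair `f`, `g`) to a short exact sequence `0 ⟶ q A ⟶ q B ⟶ q X ⟶ 0`. -/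
def MapsToShortExact {C : Type u} {D : Type u'} [Category.{v} C] [Category.{v'} D]
    [Abelian C] [Abelian D] (q : C ⥤ D) {A B X : C} (f : A ⟶ B) (g : B ⟶ X) : Prop :=
  ∃ w : q.map f ≫ q.map g = 0,
    (ShortComplex.mk (q.map f) (q.map g) w).ShortExact

/-- A functor between abelian categories is exact if it sends every short exact sequence
to a short exact sequence. -/
def IsExactFunctor {C : Type u} {D : Type u'} [Category.{v} C] [Category.{v'} D]
    [Abelian C] [Abelian D] (q : C ⥤ D) : Prop :=
  ∀ ⦃A B X : C⦄ (f : A ⟶ B) (g : B ⟶ X) (w : f ≫ g = 0),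
    (ShortComplex.mk f g w).ShortExact → MapsToShortExact q f g

universe w' w'' v'' u''

namespace CategoryTheory

open Abelian

section

variable {C : Type u} [Category.{v} C] [Abelian C]

open _root_.DerivedCategory in
attribute [local instance] HasDerivedCategory.standard in
/-- Ext-classes of positive degree are effaceable in the first variable. -/
lemma Abelian.Ext.exists_epi_mk₀_comp_eq_zero [HasExt.{w} C] {X Y : C} {n : ℕ}
    (α : Ext X Y (n + 1)) :
    ∃ (Z : C) (p : Z ⟶ X), Epi p ∧ (mk₀ p).comp α (zero_add (n + 1)) = 0 := by
  let SX := (CochainComplex.singleFunctor C 0).obj X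
  let SY := (CochainComplex.singleFunctor C 0).obj Y
  let φ : Q.obj SX ⟶ Q.obj (SY⟦((n + 1 : ℕ) : ℤ)⟧) :=
    α.hom ≫ (Q.commShiftIso ((n + 1 : ℕ) : ℤ)).inv.app SY
  obtain ⟨K, hK, s, hs, g, hg⟩ := right_fac_of_isStrictlyLE φ 0
  let i : (CochainComplex.singleFunctor C 0).obj (K.X 0) ⟶ K :=
    HomologicalComplex.mkHomFromSingle (𝟙 _)
      (fun k hk ↦ (K.isZero_of_isStrictlyLE 0 k (by simp at hk; lia)).eq_of_tgt _ _)
  have hi : i.f 0 = (HomologicalComplex.singleObjXSelf (ComplexShape.up ℤ) 0 (K.X 0)).hom :=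
    (HomologicalComplex.mkHomFromSingle_f _ _).trans (Category.comp_id _)
  obtain ⟨p, hp⟩ := (CochainComplex.singleFunctor C 0).map_surjective (i ≫ s)
  have hig : i ≫ g = 0 :=
    HomologicalComplex.from_single_hom_ext
      ((SY.isZero_of_isStrictlyLE 0 (0 + ((n + 1 : ℕ) : ℤ)) (by lia)).eq_of_tgt _ _)
  refine ⟨K.X 0, p, Preadditive.epi_of_cancel_zero _ fun {Z} f hf ↦ ?_, ?_⟩
  · have h₁ : i ≫ s ≫ (CochainComplex.singleFunctor C 0).map f = 0 := by
      rw [← Category.assoc, ← hp, ← Functor.map_comp, hf, Functor.map_zero]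
    have h₂ : s ≫ (CochainComplex.singleFunctor C 0).map f = 0 := by
      apply HomologicalComplex.to_single_hom_ext
      have h := HomologicalComplex.congr_hom h₁ 0
      rw [HomologicalComplex.comp_f, hi, HomologicalComplex.zero_f] at h
      exact (cancel_epi (HomologicalComplex.singleObjXSelf (ComplexShape.up ℤ) 0 (K.X 0)).hom).1
        (h.trans Limits.comp_zero.symm)
    have h₃ : Q.map ((CochainComplex.singleFunctor C 0).map f) = 0 := by
      rw [← cancel_epi (Q.map s), ← Functor.map_comp, h₂, Functor.map_zero, Limits.comp_zero]
    exact (singleFunctor C 0).map_injective (h₃.trans ((singleFunctor C 0).map_zero X Z).symm)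
  · ext
    rw [comp_hom, mk₀_hom, ShiftedHom.mk₀_comp, zero_hom]
    refine (cancel_mono ((Q.commShiftIso ((n + 1 : ℕ) : ℤ)).inv.app SY)).1 ?_
    have h : Q.map ((CochainComplex.singleFunctor C 0).map p) ≫ φ = 0 := by
      rw [hg, hp, Functor.map_comp, Category.assoc, IsIso.hom_inv_id_assoc, ← Functor.map_comp,
        hig, Functor.map_zero]
    exact (Category.assoc _ _ _).trans (h.trans Limits.zero_comp.symm)

/-- Ext-groups are generated under composition by morphisms and classes of short exact
sequences. -/
lemma Abelian.Ext.induction_extClass [HasExt.{w} C]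
    {P : ∀ {X Y : C} {n : ℕ}, Ext X Y n → Prop}
    (mk₀ : ∀ {X Y : C} (f : X ⟶ Y), P (Ext.mk₀ f))
    (extClass_comp : ∀ {S : ShortComplex C} (hS : S.ShortExact) {Y : C} {n : ℕ}
      (α : Ext S.X₁ Y n), P α → P (hS.extClass.comp α (add_comm 1 n)))
    {X Y : C} {n : ℕ} (α : Ext X Y n) : P α := by
  induction n generalizing X with
  | zero =>
    obtain ⟨f, rfl⟩ := (mk₀_bijective X Y).2 α
    exact mk₀ f
  | succ n ih =>
    obtain ⟨Z, p, _, hp⟩ := α.exists_epi_mk₀_comp_eq_zero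
    have hS : (ShortComplex.mk (kernel.ι p) p (by simp)).ShortExact :=
      { exact := ShortComplex.exact_kernel p }
    obtain ⟨β, rfl⟩ := contravariant_sequence_exact₃ hS Y α hp (add_comm 1 n)
    exact extClass_comp hS β (ih β)

end

section

variable {C : Type u} {D : Type u'} [Category.{v} C] [Category.{v'} D] [Abelian C] [Abelian D]
  [HasExt.{w} C] [HasExt.{w'} D]

lemma Abelian.Ext.mapExactFunctor_naturality {F G : C ⥤ D}
    [F.Additive] [PreservesFiniteLimits F] [PreservesFiniteColimits F]
    [G.Additive] [PreservesFiniteLimits G] [PreservesFiniteColimits G]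
    (τ : F ⟶ G) {X Y : C} {n : ℕ} (α : Ext X Y n) :
    (α.mapExactFunctor F).comp (mk₀ (τ.app Y)) (add_zero n) =
      (mk₀ (τ.app X)).comp (α.mapExactFunctor G) (zero_add n) := by
  induction α using Ext.induction_extClass with
  | mk₀ f => simp [mapExactFunctor_mk₀]
  | @extClass_comp S hS Y n α ih =>
    have h : (hS.extClass.mapExactFunctor F).comp (mk₀ (τ.app S.X₁)) (add_zero 1) =
        (mk₀ (τ.app S.X₃)).comp (hS.extClass.mapExactFunctor G) (zero_add 1) := by
      rw [mapExactFunctor_extClass, mapExactFunctor_extClass]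
      exact ShortComplex.ShortExact.extClass_naturality (hS.map_of_exact F) (hS.map_of_exact G)
        (S.mapNatTrans τ)
    rw [mapExactFunctor_comp, mapExactFunctor_comp, comp_assoc_of_third_deg_zero, ih,
      ← comp_assoc_of_second_deg_zero, h, comp_assoc _ _ _ (zero_add 1) (add_comm 1 n) (by lia)]

@[simp]
lemma Abelian.Ext.mapExactFunctor_id {X Y : C} {n : ℕ} (α : Ext X Y n) :
    α.mapExactFunctor (𝟭 C) = α := by
  induction α using Ext.induction_extClass with
  | mk₀ f => exact mapExactFunctor_mk₀ (𝟭 C) f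
  | extClass_comp hS α ih =>
    rw [mapExactFunctor_comp, mapExactFunctor_extClass, ih]
    rfl

lemma Abelian.Ext.mapExactFunctor_mapExactFunctor {E : Type u''} [Category.{v''} E] [Abelian E]
    [HasExt.{w''} E] (F : C ⥤ D) (G : D ⥤ E)
    [F.Additive] [PreservesFiniteLimits F] [PreservesFiniteColimits F]
    [G.Additive] [PreservesFiniteLimits G] [PreservesFiniteColimits G]
    [PreservesFiniteLimits (F ⋙ G)] [PreservesFiniteColimits (F ⋙ G)]
    {X Y : C} {n : ℕ} (α : Ext X Y n) :
    (α.mapExactFunctor F).mapExactFunctor G = α.mapExactFunctor (F ⋙ G) := by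
  induction α using Ext.induction_extClass with
  | mk₀ f => simp only [mapExactFunctor_mk₀, Functor.comp_map]
  | extClass_comp hS α ih =>
    have h : (hS.extClass.mapExactFunctor F).mapExactFunctor G =
        hS.extClass.mapExactFunctor (F ⋙ G) := by
      rw [mapExactFunctor_extClass, mapExactFunctor_extClass]
      exact mapExactFunctor_extClass G (hS.map_of_exact F)
    rw [mapExactFunctor_comp, mapExactFunctor_comp, mapExactFunctor_comp, ih, h]

/-- The isomorphism on Ext-groups induced by an adjunction between exact functors. -/
noncomputable def Adjunction.extAddEquiv {F : C ⥤ D} {G : D ⥤ C} (adj : F ⊣ G)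
    [F.Additive] [PreservesFiniteLimits F] [PreservesFiniteColimits F]
    [G.Additive] [PreservesFiniteLimits G] [PreservesFiniteColimits G]
    (X : C) (Y : D) (n : ℕ) :
    Ext (F.obj X) Y n ≃+ Ext X (G.obj Y) n where
  toFun α := (Ext.mk₀ (adj.unit.app X)).comp (α.mapExactFunctor G) (zero_add n)
  invFun β := (β.mapExactFunctor F).comp (Ext.mk₀ (adj.counit.app Y)) (add_zero n)
  left_inv α := by
    have := comp_preservesFiniteLimits G F
    have := comp_preservesFiniteColimits G F
    have h := Ext.mapExactFunctor_naturality adj.counit α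
    dsimp at h ⊢
    rw [Ext.mapExactFunctor_comp, Ext.mapExactFunctor_mapExactFunctor,
      Ext.comp_assoc_of_third_deg_zero, h, Ext.mapExactFunctor_mk₀]
    simp
  right_inv β := by
    have := comp_preservesFiniteLimits F G
    have := comp_preservesFiniteColimits F G
    have h := Ext.mapExactFunctor_naturality adj.unit β
    dsimp at h ⊢
    rw [Ext.mapExactFunctor_comp, Ext.mapExactFunctor_mapExactFunctor,
      ← Ext.comp_assoc_of_third_deg_zero, ← h, Ext.mapExactFunctor_mk₀]
    simp
  map_add' α β := by simp

lemma Adjunction.extAddEquiv_apply {F : C ⥤ D} {G : D ⥤ C} (adj : F ⊣ G)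
    [F.Additive] [PreservesFiniteLimits F] [PreservesFiniteColimits F]
    [G.Additive] [PreservesFiniteLimits G] [PreservesFiniteColimits G]
    {X : C} {Y : D} {n : ℕ} (α : Ext (F.obj X) Y n) :
    adj.extAddEquiv X Y n α =
      (Ext.mk₀ (adj.unit.app X)).comp (α.mapExactFunctor G) (zero_add n) :=
  rfl

end

end CategoryTheory

lemma IsExactFunctor.preservesFiniteLimits_and_preservesFiniteColimits
    {C : Type u} {D : Type u'} [Category.{v} C] [Category.{v'} D] [Abelian C] [Abelian D]
    {F : C ⥤ D} [F.Additive] (hF : IsExactFunctor F) :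
    PreservesFiniteLimits F ∧ PreservesFiniteColimits F :=
  have h : ∀ S : ShortComplex C, S.ShortExact → (S.map F).ShortExact :=
    fun S hS ↦ (hF S.f S.g S.zero hS).2
  (F.exact_tfae.out 0 3).1 h

/-- If `q ⊣ t` is an adjunction between abelian categories with both `q` and `t` exact,
then for every `n ≥ 1` there is an isomorphism of abelian groups
`Ext^n (q X) Y ≃ Ext^n X (t Y)`, natural in both variables. -/
theorem statement0 {C : Type u} {D : Type u'} [Category.{v} C] [Category.{v'} D]
    [Abelian C] [Abelian D] [HasExt.{w} C] [HasExt.{w} D]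
    (q : C ⥤ D) (t : D ⥤ C) (adj : q ⊣ t)
    (hq : IsExactFunctor q) (ht : IsExactFunctor t)
    (n : ℕ) (hn : 1 ≤ n) :
    ∃ e : ∀ (X : C) (Y : D), Abelian.Ext (q.obj X) Y n ≃+ Abelian.Ext X (t.obj Y) n,
      (∀ (X : C) (Y Y' : D) (g : Y ⟶ Y') (α : Abelian.Ext (q.obj X) Y n),
        e X Y' (α.comp (Abelian.Ext.mk₀ g) (add_zero n)) =
          (e X Y α).comp (Abelian.Ext.mk₀ (t.map g)) (add_zero n)) ∧
      (∀ (X X' : C) (f : X ⟶ X') (Y : D) (α : Abelian.Ext (q.obj X') Y n),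
        e X Y ((Abelian.Ext.mk₀ (q.map f)).comp α (zero_add n)) =
          (Abelian.Ext.mk₀ f).comp (e X' Y α) (zero_add n)) := by
  have := adj.rightAdjoint_preservesLimits.{0, 0}
  have : t.Additive := Functor.additive_of_preserves_binary_products t
  have : q.Additive := adj.left_adjoint_additive
  obtain ⟨_, _⟩ := hq.preservesFiniteLimits_and_preservesFiniteColimits
  obtain ⟨_, _⟩ := ht.preservesFiniteLimits_and_preservesFiniteColimits
  refine ⟨fun X Y ↦ adj.extAddEquiv X Y n, fun X Y Y' g α ↦ ?_, fun X X' f Y α ↦ ?_⟩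
  · simp [Adjunction.extAddEquiv_apply, Abelian.Ext.mapExactFunctor_comp,
      Abelian.Ext.mapExactFunctor_mk₀]
  · simp [Adjunction.extAddEquiv_apply, Abelian.Ext.mapExactFunctor_comp,
      Abelian.Ext.mapExactFunctor_mk₀]
end

section
/- Let q : C ⥤ D be a functor between abelian categories with a right adjoint t : D ⥤ C, and let X be an object of C. Then the following are equivalent: (a) for every object Y of D and every short exact sequence 0 → t(Y) → B → X → 0 in C, the sequence 0 → q(t(Y)) → q(B) → q(X) → 0 is a short exact sequence in D; (b) X is q-flat. -/
open CategoryTheory Limits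

universe w v u v' u'

/-- `X` is `q`-flat: every short exact sequence ending at `X` remains short exact
after applying `q`. -/
def QFlat {C : Type u} {D : Type u'} [Category.{v} C] [Category.{v'} D]
    [Abelian C] [Abelian D] (q : C ⥤ D) (X : C) : Prop :=
  ∀ ⦃A B : C⦄ (f : A ⟶ B) (g : B ⟶ X) (w : f ≫ g = 0),
    (ShortComplex.mk f g w).ShortExact → MapsToShortExact q f g

/-- The pushout of a short exact sequence along a morphism out of its first term is short exact. -/
theorem CategoryTheory.ShortComplex.ShortExact.of_isPushout {C : Type u} [Category.{v} C]
    [Abelian C] {A A' B B' X : C} {f : A ⟶ B} {g : B ⟶ X} {w : f ≫ g = 0}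
    (h : (ShortComplex.mk f g w).ShortExact) {a : A ⟶ A'} {b : B ⟶ B'} {f' : A' ⟶ B'}
    (sq : IsPushout f a b f') {g' : B' ⟶ X} (hb : b ≫ g' = g) (w' : f' ≫ g' = 0) :
    (ShortComplex.mk f' g' w').ShortExact := by
  have : Mono f := h.mono_f
  have : Epi g := h.epi_g
  have hf' : Mono f' :=
    (MorphismProperty.monomorphisms C).of_isPushout sq.flip (.infer_property f)
  have hg' : Epi g' := epi_of_epi_fac hb
  refine { exact := ?_, mono_f := hf', epi_g := hg' }
  refine ShortComplex.exact_of_g_is_cokernel _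
    (CokernelCofork.IsColimit.ofπ' _ _ fun {Z} k hk => ?_)
  have hbk : f ≫ b ≫ k = 0 := by
    rw [← Category.assoc, sq.w, Category.assoc, hk, comp_zero]
  refine ⟨h.exact.desc (b ≫ k) hbk, sq.hom_ext ?_ ?_⟩
  · rw [← Category.assoc, hb]
    exact h.exact.g_desc (b ≫ k) hbk
  · rw [← Category.assoc, w', zero_comp, hk]

/-- A left adjoint preserves a short exact sequence as soon as it preserves its monomorphism. -/
theorem MapsToShortExact.of_mono {C : Type u} {D : Type u'} [Category.{v} C] [Category.{v'} D]
    [Abelian C] [Abelian D] (q : C ⥤ D) [q.IsLeftAdjoint] {A B X : C} {f : A ⟶ B} {g : B ⟶ X}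
    {w : f ≫ g = 0} (h : (ShortComplex.mk f g w).ShortExact) [Mono (q.map f)] :
    MapsToShortExact q f g := by
  have : Epi g := h.epi_g
  refine ⟨by rw [← q.map_comp, w, q.map_zero], ?_⟩
  exact
    { exact := ShortComplex.exact_of_g_is_cokernel _ (CokernelCofork.mapIsColimit _ h.gIsCokernel q)
      mono_f := ‹_›
      epi_g := inferInstanceAs (Epi (q.map g)) }

/-- Lemma 2.8(i): `q` preserves all short exact sequences of the form
`0 ⟶ t Y ⟶ B ⟶ X ⟶ 0` if and only if `X` is `q`-flat. -/
theorem statement1 {C : Type u} {D : Type u'} [Category.{v} C] [Category.{v'} D]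
    [Abelian C] [Abelian D] (q : C ⥤ D) (t : D ⥤ C) (adj : q ⊣ t) (X : C) :
    (∀ (Y : D) ⦃B : C⦄ (f : t.obj Y ⟶ B) (g : B ⟶ X) (w : f ≫ g = 0),
      (ShortComplex.mk f g w).ShortExact → MapsToShortExact q f g) ↔ QFlat q X := by
  refine ⟨fun H A B f g w h => ?_, fun H Y B f g w h => H f g w h⟩
  have : q.IsLeftAdjoint := adj.isLeftAdjoint
  let sq := IsPushout.of_hasPushout f (adj.unit.app A)
  have hw : f ≫ g = adj.unit.app A ≫ 0 := by rw [w, comp_zero]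
  obtain ⟨_, hq⟩ := H _ _ _ (sq.inr_desc g 0 hw)
    (h.of_isPushout sq (sq.inl_desc g 0 hw) (sq.inr_desc g 0 hw))
  have : Mono (q.map (pushout.inr f (adj.unit.app A))) := hq.mono_f
  have : Mono (q.map (adj.unit.app A)) :=
    (SplitMono.mk _ (adj.left_triangle_components A)).mono
  have fac : q.map f ≫ q.map (pushout.inl f (adj.unit.app A)) =
      q.map (adj.unit.app A) ≫ q.map (pushout.inr f (adj.unit.app A)) := by
    rw [← q.map_comp, sq.w, q.map_comp]
  have : Mono (q.map f) := mono_of_mono_fac fac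
  exact .of_mono q h
end

section
/- Let q : C ⥤ D be a functor between abelian categories with a right adjoint t : D ⥤ C, and let Y be an object of D. Then the following are equivalent: (a) for every object X of C and every short exact sequence 0 → Y → B → q(X) → 0 in D, the sequence 0 → t(Y) → t(B) → t(q(X)) → 0 is a short exact sequence in C; (b) Y is t-coflat. -/
open CategoryTheory Limits

universe w v u v' u'

/-- `Y` is `t`-coflat: every short exact sequence starting at `Y` remains short exact
after applying `t`. -/
def TCoflat {C : Type u} {D : Type u'} [Category.{v} C] [Category.{v'} D]
    [Abelian C] [Abelian D] (t : D ⥤ C) (Y : D) : Prop :=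
  ∀ ⦃B E : D⦄ (f : Y ⟶ B) (g : B ⟶ E) (w : f ≫ g = 0),
    (ShortComplex.mk f g w).ShortExact → MapsToShortExact t f g

/-- The pullback of a short exact sequence along a morphism to its right-hand term
is short exact, with the same left-hand term. -/
theorem CategoryTheory.ShortComplex.ShortExact.pullback_mk {D : Type u'} [Category.{v'} D]
    [Abelian D] {Y B E Z : D} {f : Y ⟶ B} {g : B ⟶ E} {w : f ≫ g = 0}
    (h : (ShortComplex.mk f g w).ShortExact) (e : Z ⟶ E) :
    (ShortComplex.mk (pullback.lift f (0 : Y ⟶ Z) (by simp [w]) : Y ⟶ pullback g e)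
      (pullback.snd g e) (pullback.lift_snd _ _ _)).ShortExact := by
  have : Mono f := h.mono_f
  have : Epi g := h.epi_g
  have : Mono (pullback.lift f (0 : Y ⟶ Z) (by simp [w]) : Y ⟶ pullback g e) :=
    mono_of_mono_fac (pullback.lift_fst f (0 : Y ⟶ Z) (by simp [w]))
  refine { exact := ?_, mono_f := this, epi_g := inferInstance }
  refine ShortComplex.exact_of_f_is_kernel _ (KernelFork.IsLimit.ofι' _ _ fun {A} k hk => ?_)
  have hk₀ : k ≫ pullback.snd g e = 0 := hk
  have hk' : (k ≫ pullback.fst g e) ≫ g = 0 := by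
    rw [Category.assoc, pullback.condition, ← Category.assoc, hk₀, zero_comp]
  let l : A ⟶ Y := h.exact.lift (k ≫ pullback.fst g e) hk'
  have hl : l ≫ f = k ≫ pullback.fst g e := h.exact.lift_f (k ≫ pullback.fst g e) hk'
  refine ⟨l, pullback.hom_ext ?_ ?_⟩
  · rw [Category.assoc, pullback.lift_fst, hl]
  · rw [Category.assoc, pullback.lift_snd, comp_zero, hk₀]

/-- A right adjoint sends a short exact sequence to a short exact sequence as soon as it
sends the second map to an epimorphism. -/
theorem mapsToShortExact_of_epi {C : Type u} {D : Type u'} [Category.{v} C] [Category.{v'} D]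
    [Abelian C] [Abelian D] (t : D ⥤ C) [t.IsRightAdjoint] {Y B E : D} {f : Y ⟶ B} {g : B ⟶ E}
    {w : f ≫ g = 0} (h : (ShortComplex.mk f g w).ShortExact) (hg : Epi (t.map g)) :
    MapsToShortExact t f g := by
  have : PreservesLimits t := (Adjunction.ofIsRightAdjoint t).rightAdjoint_preservesLimits
  have : Mono f := h.mono_f
  exact ⟨by rw [← t.map_comp, w, t.map_zero],
    { exact := h.exact.map_of_mono_of_preservesKernel t h.mono_f inferInstance
      mono_f := t.map_mono f
      epi_g := hg }⟩

/-- Lemma 2.8(ii): `t` preserves all short exact sequences of the form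
`0 ⟶ Y ⟶ B ⟶ q X ⟶ 0` if and only if `Y` is `t`-coflat. -/
theorem statement2 {C : Type u} {D : Type u'} [Category.{v} C] [Category.{v'} D]
    [Abelian C] [Abelian D] (q : C ⥤ D) (t : D ⥤ C) (adj : q ⊣ t) (Y : D) :
    (∀ (X : C) ⦃B : D⦄ (f : Y ⟶ B) (g : B ⟶ q.obj X) (w : f ≫ g = 0),
      (ShortComplex.mk f g w).ShortExact → MapsToShortExact t f g) ↔ TCoflat t Y := by
  refine ⟨fun h B E f g w hfg => ?_, fun h X B f g w hfg => h f g w hfg⟩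
  have : t.IsRightAdjoint := adj.isRightAdjoint
  refine mapsToShortExact_of_epi t hfg ?_
  obtain ⟨_, hS⟩ := h (t.obj E) _ _ _ (hfg.pullback_mk (adj.counit.app E))
  have : Epi (t.map (pullback.snd g (adj.counit.app E))) := hS.epi_g
  have : Epi (t.map (adj.counit.app E)) :=
    epi_of_epi_fac (adj.right_triangle_components E)
  have fac : t.map (pullback.fst g (adj.counit.app E)) ≫ t.map g =
      t.map (pullback.snd g (adj.counit.app E)) ≫ t.map (adj.counit.app E) := by
    rw [← t.map_comp, pullback.condition, t.map_comp]
  exact epi_of_epi_fac fac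
end

section
/- Let q : C ⥤ D be a functor between abelian categories with a right adjoint t : D ⥤ C, let G be a class of objects of D that is cogenerating (every object of D admits a monomorphism into some object of G), and let X be an object of C. If for every G₀ ∈ G and every short exact sequence 0 → t(G₀) → B → X → 0 in C the sequence 0 → q(t(G₀)) → q(B) → q(X) → 0 is short exact in D, then X is q-flat. -/
open CategoryTheory Limits

universe w v u v' u'

/-- The pushout of a short exact sequence along a morphism out of its first term is short exact. -/
lemma CategoryTheory.ShortComplex.ShortExact.pushout_inr_desc {C : Type u} [Category.{v} C] [Abelian C]
    {A A' B X : C} {f : A ⟶ B} {g : B ⟶ X} {w : f ≫ g = 0}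
    (hS : (ShortComplex.mk f g w).ShortExact) (a : A ⟶ A') :
    (ShortComplex.mk (pushout.inr f a) (pushout.desc g 0 (by simp [w]) : pushout f a ⟶ X)
      (pushout.inr_desc _ _ _)).ShortExact := by
  have : Mono f := hS.mono_f
  have : Epi g := hS.epi_g
  have hg : pushout.inl f a ≫ pushout.desc g 0 (by simp [w]) = g := pushout.inl_desc _ _ _
  have : Epi (pushout.desc g 0 (by simp [w]) : pushout f a ⟶ X) := epi_of_epi_fac hg
  refine ShortComplex.ShortExact.mk' ?_ inferInstance inferInstance
  refine ShortComplex.exact_of_g_is_cokernel _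
    (CokernelCofork.IsColimit.ofπ' _ _ fun k (hk : pushout.inr f a ≫ k = 0) => ?_)
  have hfk : f ≫ pushout.inl f a ≫ k = 0 := by
    rw [pushout.condition_assoc, hk, comp_zero]
  obtain ⟨l, hl⟩ := CokernelCofork.IsColimit.desc' hS.gIsCokernel _ hfk
  exact ⟨l, pushout.hom_ext ((pushout.inl_desc_assoc _ _ _ _).trans hl)
    ((pushout.inr_desc_assoc _ _ _ _).trans (zero_comp.trans hk.symm))⟩

/-- A left adjoint functor preserves a short exact sequence as soon as it sends the monomorphism
of this sequence to a monomorphism. -/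
lemma MapsToShortExact.of_mono_map {C : Type u} {D : Type u'} [Category.{v} C] [Category.{v'} D]
    [Abelian C] [Abelian D] (q : C ⥤ D) [q.IsLeftAdjoint] {A B X : C} {f : A ⟶ B} {g : B ⟶ X}
    {w : f ≫ g = 0} (hS : (ShortComplex.mk f g w).ShortExact) (hf : Mono (q.map f)) :
    MapsToShortExact q f g := by
  have : Epi g := hS.epi_g
  have := q.preservesZeroMorphisms_of_isLeftAdjoint
  have : PreservesColimitsOfSize.{0, 0} q :=
    (Adjunction.ofIsLeftAdjoint q).leftAdjoint_preservesColimits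
  exact ⟨by rw [← q.map_comp, w, q.map_zero],
    .mk' (hS.exact.map_of_epi_of_preservesCokernel q ‹_› inferInstance) hf
      (q.map_epi g)⟩

/-- Lemma 2.9(i): if `G` is a cogenerating class of `D` and `q` preserves all short exact
sequences `0 ⟶ t G₀ ⟶ B ⟶ X ⟶ 0` with `G₀ ∈ G`, then `X` is `q`-flat. -/
theorem statement3 {C : Type u} {D : Type u'} [Category.{v} C] [Category.{v'} D]
    [Abelian C] [Abelian D] (q : C ⥤ D) (t : D ⥤ C) (adj : q ⊣ t)
    (G : Set D) (hG : ∀ Y : D, ∃ G₀ ∈ G, ∃ ι : Y ⟶ G₀, Mono ι) (X : C)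
    (h : ∀ G₀ ∈ G, ∀ ⦃B : C⦄ (f : t.obj G₀ ⟶ B) (g : B ⟶ X) (w : f ≫ g = 0),
      (ShortComplex.mk f g w).ShortExact → MapsToShortExact q f g) :
    QFlat q X := by
  intro A B f g w hS
  have : q.IsLeftAdjoint := adj.isLeftAdjoint
  refine .of_mono_map q hS ?_
  obtain ⟨G₀, hG₀, ι, hι⟩ := hG (q.obj A)
  let a : A ⟶ t.obj G₀ := adj.homEquiv _ _ ι
  have ha : q.map a ≫ adj.counit.app G₀ = ι :=
    (adj.homEquiv_counit _ _ _).symm.trans ((adj.homEquiv _ _).symm_apply_apply ι)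
  have : Mono (q.map a) := mono_of_mono_fac ha
  obtain ⟨_, hq⟩ := h G₀ hG₀ _ _ _ (hS.pushout_inr_desc a)
  have : Mono (q.map (pushout.inr f a)) := hq.mono_f
  have hcomm : q.map f ≫ q.map (pushout.inl f a) = q.map a ≫ q.map (pushout.inr f a) := by
    rw [← q.map_comp, ← q.map_comp, pushout.condition]
  exact mono_of_mono_fac hcomm
end

section
/- Let q : C ⥤ D be a functor between abelian categories with a right adjoint t : D ⥤ C, let F be a class of objects of C that is generating (every object of C admits an epimorphism from some object of F), and let Y be an object of D. If for every F₀ ∈ F and every short exact sequence 0 → Y → B → q(F₀) → 0 in D the sequence 0 → t(Y) → t(B) → t(q(F₀)) → 0 is short exact in C, then Y is t-coflat. -/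
open CategoryTheory Limits

universe w v u v' u'

/-- The pullback of a short exact sequence along a morphism to its last term is short exact. -/
theorem shortExact_pullback {D : Type u'} [Category.{v'} D] [Abelian D] {Y B E X : D}
    {f : Y ⟶ B} {g : B ⟶ E} {w : f ≫ g = 0} (hS : (ShortComplex.mk f g w).ShortExact)
    (p : X ⟶ E) :
    (ShortComplex.mk (pullback.lift f (0 : Y ⟶ X) (by simp [w])) (pullback.snd g p)
      (pullback.lift_snd _ _ _)).ShortExact := by
  have : Mono f := hS.mono_f
  have : Epi g := hS.epi_g
  have hmono : Mono (pullback.lift f (0 : Y ⟶ X) (by simp [w] : f ≫ g = 0 ≫ p)) :=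
    mono_of_mono_fac (pullback.lift_fst _ _ _)
  refine ⟨ShortComplex.exact_of_f_is_kernel _ (KernelFork.IsLimit.ofι' _ _ fun k hk => ?_)⟩
  have hk' : (k ≫ pullback.fst g p) ≫ g = 0 := by
    rw [Category.assoc, pullback.condition, reassoc_of% hk, zero_comp]
  refine ⟨hS.exact.lift _ hk', pullback.hom_ext ?_ ?_⟩
  · exact (Category.assoc _ _ _).trans
      ((congrArg _ (pullback.lift_fst _ _ _)).trans (hS.exact.lift_f _ hk'))
  · exact (Category.assoc _ _ _).trans
      ((congrArg _ (pullback.lift_snd _ _ _)).trans (comp_zero.trans hk.symm))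

/-- Lemma 2.9(ii): if `F` is a generating class of `C` and `t` preserves all short exact
sequences `0 ⟶ Y ⟶ B ⟶ q F₀ ⟶ 0` with `F₀ ∈ F`, then `Y` is `t`-coflat. -/
theorem statement4 {C : Type u} {D : Type u'} [Category.{v} C] [Category.{v'} D]
    [Abelian C] [Abelian D] (q : C ⥤ D) (t : D ⥤ C) (adj : q ⊣ t)
    (F : Set C) (hF : ∀ X : C, ∃ F₀ ∈ F, ∃ π : F₀ ⟶ X, Epi π) (Y : D)
    (h : ∀ F₀ ∈ F, ∀ ⦃B : D⦄ (f : Y ⟶ B) (g : B ⟶ q.obj F₀) (w : f ≫ g = 0),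
      (ShortComplex.mk f g w).ShortExact → MapsToShortExact t f g) :
    TCoflat t Y := by
  intro B E f g w hS
  have : t.IsRightAdjoint := adj.isRightAdjoint
  have : PreservesLimits t := adj.rightAdjoint_preservesLimits
  have : t.PreservesZeroMorphisms := t.preservesZeroMorphisms_of_isRightAdjoint
  have : Mono f := hS.mono_f
  have hw : t.map f ≫ t.map g = 0 := by rw [← t.map_comp, w, t.map_zero]
  obtain ⟨F₀, hF₀, π, hπ⟩ := hF (t.obj E)
  let p : q.obj F₀ ⟶ E := (adj.homEquiv F₀ E).symm π
  have hp : adj.unit.app F₀ ≫ t.map p = π :=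
    (adj.homEquiv_unit _ _ _).symm.trans (Equiv.apply_symm_apply _ _)
  obtain ⟨_, hP⟩ := h F₀ hF₀ _ _ _ (shortExact_pullback hS p)
  have : Epi (t.map (pullback.snd g p)) := hP.epi_g
  have : Epi (t.map g) := by
    refine epi_of_epi_fac (h := pullback.snd (t.map (pullback.snd g p)) (adj.unit.app F₀) ≫ π)
      (f := pullback.fst _ _ ≫ t.map (pullback.fst g p)) ?_
    rw [Category.assoc, ← t.map_comp, pullback.condition, t.map_comp, pullback.condition_assoc, hp]
  have : Mono (t.map f) := inferInstance
  exact ⟨hw, ⟨hS.exact.map_of_mono_of_preservesKernel t inferInstance inferInstance⟩⟩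
end

section
/- Let q : C ⥤ D be a functor between abelian categories with a right adjoint t : D ⥤ C, and let X be an object of C. Assume that t sends every short exact sequence 0 → Y → B → q(X) → 0 in D to a short exact sequence in C, and that X is q-flat. Then for every object Y of D there is an isomorphism of abelian groups Ext¹_D(q(X), Y) ≅ Ext¹_C(X, t(Y)), natural in Y. -/
open CategoryTheory Limits

universe w v u v' u'

section YonedaExt

open Pretriangulated DerivedCategory Abelian

variable {C : Type u} [Category.{v} C] [Abelian C]

/-- A short complex in `C` underlying a distinguished triangle of the derived category
is short exact. -/
lemma shortExact_of_distinguished [HasDerivedCategory.{w} C] (S : ShortComplex C)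
    (δ : (singleFunctor C 0).obj S.X₃ ⟶ ((singleFunctor C 0).obj S.X₁)⟦(1 : ℤ)⟧)
    (hT : Triangle.mk ((singleFunctor C 0).map S.f) ((singleFunctor C 0).map S.g) δ ∈
      distTriang (DerivedCategory C)) : S.ShortExact := by
  have zero_of_shift {Z W : C}
      (k : ((singleFunctor C 0).obj Z)⟦(1 : ℤ)⟧ ⟶ (singleFunctor C 0).obj W) : k = 0 := by
    have := TStructure.t.isLE_shift ((singleFunctor C 0).obj Z) 0 1 (-1)
    exact TStructure.t.zero k (-1) 0
  refine ShortComplex.ShortExact.mk' ?_ ?_ ?_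
  · rw [ShortComplex.exact_iff_exact_up_to_refinements]
    intro A x hx
    obtain ⟨y, hy⟩ : ∃ (y : (singleFunctor C 0).obj A ⟶ (singleFunctor C 0).obj S.X₁),
        (singleFunctor C 0).map x = y ≫ (singleFunctor C 0).map S.f :=
      Triangle.coyoneda_exact₂ _ hT ((singleFunctor C 0).map x)
        (((singleFunctor C 0).map_comp x S.g).symm.trans (by rw [hx, Functor.map_zero]; rfl))
    obtain ⟨y, rfl⟩ := (singleFunctor C 0).map_surjective y
    refine ⟨A, 𝟙 A, inferInstance, y, ?_⟩
    apply (singleFunctor C 0).map_injective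
    rw [Category.id_comp, hy, Functor.map_comp]
  · rw [Preadditive.mono_iff_cancel_zero]
    intro A x hx
    obtain ⟨y, hy⟩ : ∃ (y : ((singleFunctor C 0).obj A)⟦(1 : ℤ)⟧ ⟶ (singleFunctor C 0).obj S.X₃),
        ((singleFunctor C 0).map x)⟦(1 : ℤ)⟧' = y ≫ δ :=
      Triangle.coyoneda_exact₁ _ hT (((singleFunctor C 0).map x)⟦(1 : ℤ)⟧')
        (((singleFunctor C 0 ⋙ shiftFunctor _ (1 : ℤ)).map_comp x S.f).symm.trans
          (by rw [hx, Functor.map_zero]; rfl))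
    rw [zero_of_shift y, zero_comp] at hy
    apply (singleFunctor C 0).map_injective
    apply (shiftFunctor _ (1 : ℤ)).map_injective
    rw [hy, Functor.map_zero, Functor.map_zero]
  · rw [Preadditive.epi_iff_cancel_zero]
    intro A x hx
    obtain ⟨y, hy⟩ : ∃ (y : ((singleFunctor C 0).obj S.X₁)⟦(1 : ℤ)⟧ ⟶ (singleFunctor C 0).obj A),
        (singleFunctor C 0).map x = δ ≫ y :=
      Triangle.yoneda_exact₃ _ hT ((singleFunctor C 0).map x)
        (((singleFunctor C 0).map_comp S.g x).symm.trans (by rw [hx, Functor.map_zero]; rfl))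
    rw [zero_of_shift y, comp_zero] at hy
    apply (singleFunctor C 0).map_injective
    rw [hy, Functor.map_zero]

lemma singleδ_eq_of_distinguished [HasDerivedCategory.{w} C] {S : ShortComplex C}
    (hS : S.ShortExact)
    (δ : (singleFunctor C 0).obj S.X₃ ⟶ ((singleFunctor C 0).obj S.X₁)⟦(1 : ℤ)⟧)
    (hT : Triangle.mk ((singleFunctor C 0).map S.f) ((singleFunctor C 0).map S.g) δ ∈
      distTriang (DerivedCategory C)) : hS.singleδ = δ := by
  have := hS.epi_g
  obtain ⟨c, hc, hc'⟩ : ∃ (c : (singleFunctor C 0).obj S.X₃ ⟶ (singleFunctor C 0).obj S.X₃),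
      (singleFunctor C 0).map S.g ≫ c = 𝟙 _ ≫ (singleFunctor C 0).map S.g ∧
        hS.singleδ ≫ (𝟙 ((singleFunctor C 0).obj S.X₁))⟦(1 : ℤ)⟧' = c ≫ δ :=
    complete_distinguished_triangle_morphism _ _ hS.singleTriangle_distinguished hT (𝟙 _) (𝟙 _)
      ((Category.comp_id _).trans (Category.id_comp _).symm)
  obtain ⟨c, rfl⟩ := (singleFunctor C 0).map_surjective c
  obtain rfl : c = 𝟙 _ := by
    rw [← cancel_epi S.g]
    apply (singleFunctor C 0).map_injective
    rw [Functor.map_comp, hc, Category.id_comp, Category.comp_id]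
  simpa using hc'

/-- Every class in `Ext¹` is the class of an extension. -/
lemma exists_extClass_eq [HasExt.{w} C] {X Y : C} (α : Ext X Y 1) :
    ∃ (B : C) (f : Y ⟶ B) (g : B ⟶ X) (w : f ≫ g = 0)
      (hS : (ShortComplex.mk f g w).ShortExact), hS.extClass = α := by
  let := HasDerivedCategory.standard C
  obtain ⟨δ, hδ⟩ : ∃ δ : (singleFunctor C 0).obj X ⟶ ((singleFunctor C 0).obj Y)⟦(1 : ℤ)⟧,
    δ = α.hom := ⟨_, rfl⟩
  obtain ⟨E, f, g, hT⟩ := distinguished_cocone_triangle₂ δ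
  have : E.IsLE 0 := TStructure.t.isLE₂ _ hT 0
    (inferInstanceAs (IsLE ((singleFunctor C 0).obj Y) 0))
    (inferInstanceAs (IsLE ((singleFunctor C 0).obj X) 0))
  have : E.IsGE 0 := TStructure.t.isGE₂ _ hT 0
    (inferInstanceAs (IsGE ((singleFunctor C 0).obj Y) 0))
    (inferInstanceAs (IsGE ((singleFunctor C 0).obj X) 0))
  obtain ⟨B, ⟨e⟩⟩ := exists_iso_singleFunctor_obj_of_isGE_of_isLE E 0
  obtain ⟨f', hf'⟩ := (singleFunctor C 0).map_surjective (f ≫ e.hom)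
  obtain ⟨g', hg'⟩ := (singleFunctor C 0).map_surjective (e.inv ≫ g)
  have hT' : Triangle.mk ((singleFunctor C 0).map f') ((singleFunctor C 0).map g') δ ∈
      distTriang (DerivedCategory C) := by
    rw [hf', hg']
    refine isomorphic_distinguished _ hT _
      (Triangle.isoMk _ _ (Iso.refl _) e.symm (Iso.refl _) ?_ ?_ ?_)
    · change (f ≫ e.hom) ≫ e.inv = 𝟙 _ ≫ f
      simp
    · change (e.inv ≫ g) ≫ 𝟙 _ = e.inv ≫ g
      simp
    · change δ ≫ (𝟙 ((singleFunctor C 0).obj Y))⟦(1 : ℤ)⟧' = 𝟙 _ ≫ δ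
      simp
  have w : f' ≫ g' = 0 := by
    apply (singleFunctor C 0).map_injective
    rw [Functor.map_comp, Functor.map_zero]
    exact comp_distTriang_mor_zero₁₂ _ hT'
  have hS := shortExact_of_distinguished (ShortComplex.mk f' g' w) _ hT'
  refine ⟨B, f', g', w, hS, ?_⟩
  ext
  rw [ShortComplex.ShortExact.extClass_hom, ← hδ]
  exact singleδ_eq_of_distinguished hS _ hT'

/-- A compatibility between the classes of two extensions lifts to a morphism
between the extensions. -/
lemma exists_hom_of_extClass [HasExt.{w} C] {S S' : ShortComplex C}
    (hS : S.ShortExact) (hS' : S'.ShortExact) (a : S.X₁ ⟶ S'.X₁) (c : S.X₃ ⟶ S'.X₃)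
    (h : hS.extClass.comp (Ext.mk₀ a) (add_zero 1) =
      (Ext.mk₀ c).comp hS'.extClass (zero_add 1)) :
    ∃ φ : S ⟶ S', φ.τ₁ = a ∧ φ.τ₃ = c := by
  have := hS.epi_g
  obtain ⟨b, hb⟩ := Ext.contravariant_sequence_exact₁ hS S'.X₂ (Ext.mk₀ (a ≫ S'.f))
    (add_zero 1) (by
      rw [← Ext.mk₀_comp_mk₀, ← Ext.comp_assoc _ _ _ (add_zero 1) _ (by simp), h,
        Ext.comp_assoc _ _ _ _ (add_zero 1) (by simp), hS'.extClass_comp, Ext.comp_zero])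
  obtain ⟨b, rfl⟩ := (Ext.mk₀_bijective _ _).surjective b
  replace hb : S.f ≫ b = a ≫ S'.f :=
    (Ext.mk₀_bijective _ _).injective (by rw [← hb, Ext.mk₀_comp_mk₀])
  let d := hS.exact.desc (b ≫ S'.g) (by rw [reassoc_of% hb, S'.zero, comp_zero])
  have hd : S.g ≫ d = b ≫ S'.g := hS.exact.g_desc _ _
  let ψ : S ⟶ S' := { τ₁ := a, τ₂ := b, τ₃ := d, comm₁₂ := hb.symm, comm₂₃ := hd.symm }
  obtain ⟨l, hl⟩ := Ext.covariant_sequence_exact₃ _ hS' (Ext.mk₀ (c - d)) (zero_add 1) (by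
    rw [sub_eq_add_neg, Ext.mk₀_add, Ext.mk₀_neg, Ext.add_comp, Ext.neg_comp, ← h,
      hS.extClass_naturality hS' ψ, add_neg_cancel])
  obtain ⟨l, rfl⟩ := (Ext.mk₀_bijective _ _).surjective l
  replace hl : l ≫ S'.g = c - d :=
    (Ext.mk₀_bijective _ _).injective (by rw [← hl, Ext.mk₀_comp_mk₀])
  exact ⟨{ τ₁ := a, τ₂ := b + S.g ≫ l, τ₃ := c
           comm₁₂ := by simp [hb]
           comm₂₃ := by simp [hl, hd] }, rfl, rfl⟩

end YonedaExt

section Adjunction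

open Abelian

variable {C : Type u} {D : Type u'} [Category.{v} C] [Category.{v'} D] [Abelian C] [Abelian D]
  [HasExt.{w} C] [HasExt.{w} D]

/-- The class of the image under `t` of an extension of `Z`, pulled back along `X ⟶ t Z`,
depends only on the class of the extension, functorially in the kernel. -/
lemma comp_extClass_map_naturality (t : D ⥤ C) [t.PreservesZeroMorphisms] {X : C} {Z : D}
    (u : X ⟶ t.obj Z) {Y Y' B B' : D}
    {f : Y ⟶ B} {g : B ⟶ Z} {w : f ≫ g = 0} {f' : Y' ⟶ B'} {g' : B' ⟶ Z}
    {w' : f' ≫ g' = 0} (hS : (ShortComplex.mk f g w).ShortExact)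
    (hS' : (ShortComplex.mk f' g' w').ShortExact)
    {tw : t.map f ≫ t.map g = 0} {tw' : t.map f' ≫ t.map g' = 0}
    (ht : (ShortComplex.mk (t.map f) (t.map g) tw).ShortExact)
    (ht' : (ShortComplex.mk (t.map f') (t.map g') tw').ShortExact) (a : Y ⟶ Y')
    (h : hS.extClass.comp (Ext.mk₀ a) (add_zero 1) = hS'.extClass) :
    ((Ext.mk₀ u).comp ht.extClass (zero_add 1)).comp (Ext.mk₀ (t.map a)) (add_zero 1) =
      (Ext.mk₀ u).comp ht'.extClass (zero_add 1) := by
  obtain ⟨φ, rfl, h₃⟩ := exists_hom_of_extClass hS hS' a (𝟙 Z)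
    (h.trans (Ext.mk₀_id_comp _).symm)
  have key := ht.extClass_naturality ht' (t.mapShortComplex.map φ)
  have h₃' : (t.mapShortComplex.map φ).τ₃ = 𝟙 (t.obj Z) :=
    (congrArg t.map h₃).trans (t.map_id _)
  rw [h₃'] at key
  rw [Ext.comp_assoc _ _ _ _ (add_zero 1) (by simp)]
  exact congrArg (fun x ↦ (Ext.mk₀ u).comp x (zero_add 1)) (key.trans (Ext.mk₀_id_comp _))

end Adjunction

/-- Proposition 2.10(i), (b) ⇒ (a): if `t` preserves short exact sequences ending at `q X`
and `X` is `q`-flat, then `Ext¹ (q X) Y ≃ Ext¹ X (t Y)`, naturally in `Y`. -/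
theorem statement5 {C : Type u} {D : Type u'} [Category.{v} C] [Category.{v'} D]
    [Abelian C] [Abelian D] [HasExt.{w} C] [HasExt.{w} D]
    (q : C ⥤ D) (t : D ⥤ C) (adj : q ⊣ t) (X : C)
    (ht : ∀ ⦃Y B : D⦄ (f : Y ⟶ B) (g : B ⟶ q.obj X) (w : f ≫ g = 0),
      (ShortComplex.mk f g w).ShortExact → MapsToShortExact t f g)
    (hX : QFlat q X) :
    ∃ e : ∀ Y : D, Abelian.Ext (q.obj X) Y 1 ≃+ Abelian.Ext X (t.obj Y) 1,
      ∀ (Y Y' : D) (g : Y ⟶ Y') (α : Abelian.Ext (q.obj X) Y 1),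
        e Y' (α.comp (Abelian.Ext.mk₀ g) (add_zero 1)) =
          (e Y α).comp (Abelian.Ext.mk₀ (t.map g)) (add_zero 1) := by
  have := adj.rightAdjoint_preservesLimits
  have : t.Additive := t.additive_of_preserves_binary_products
  choose B i p w hS hα using fun (Y : D) (α : Abelian.Ext (q.obj X) Y 1) ↦ exists_extClass_eq α
  choose tw htS using fun (Y : D) (α : Abelian.Ext (q.obj X) Y 1) ↦
    ht (i Y α) (p Y α) (w Y α) (hS Y α)
  let F (Y : D) (α : Abelian.Ext (q.obj X) Y 1) : Abelian.Ext X (t.obj Y) 1 :=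
    (Abelian.Ext.mk₀ (adj.unit.app X)).comp (htS Y α).extClass (zero_add 1)
  have F_nat {Y Y' : D} (a : Y ⟶ Y') (α : Abelian.Ext (q.obj X) Y 1) :
      F Y' (α.comp (Abelian.Ext.mk₀ a) (add_zero 1)) =
        (F Y α).comp (Abelian.Ext.mk₀ (t.map a)) (add_zero 1) :=
    (comp_extClass_map_naturality t _ (hS _ _) (hS _ _) (htS _ _) (htS _ _) a
      (by rw [hα, hα])).symm
  have F_add {Y : D} (α β : Abelian.Ext (q.obj X) Y 1) : F Y (α + β) = F Y α + F Y β := by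
    let γ : Abelian.Ext (q.obj X) (Y ⊞ Y) 1 :=
      α.comp (Abelian.Ext.mk₀ biprod.inl) (add_zero 1) +
        β.comp (Abelian.Ext.mk₀ biprod.inr) (add_zero 1)
    have h₁ : γ.comp (Abelian.Ext.mk₀ biprod.fst) (add_zero 1) = α := by
      simp [γ]
    have h₂ : γ.comp (Abelian.Ext.mk₀ biprod.snd) (add_zero 1) = β := by
      simp [γ]
    calc F Y (α + β)
        = F Y (γ.comp (Abelian.Ext.mk₀ (biprod.fst + biprod.snd)) (add_zero 1)) := by
          rw [Abelian.Ext.mk₀_add, Abelian.Ext.comp_add, h₁, h₂]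
      _ = F Y (γ.comp (Abelian.Ext.mk₀ biprod.fst) (add_zero 1)) +
          F Y (γ.comp (Abelian.Ext.mk₀ biprod.snd) (add_zero 1)) := by
          rw [F_nat, F_nat, F_nat, t.map_add, Abelian.Ext.mk₀_add, Abelian.Ext.comp_add]
      _ = F Y α + F Y β := by rw [h₁, h₂]
  have F_inj (Y : D) : Function.Injective (AddMonoidHom.mk' (F Y) F_add) := by
    rw [injective_iff_map_eq_zero]
    intro α (h : F Y α = 0)
    obtain ⟨l, hl⟩ := Abelian.Ext.covariant_sequence_exact₃ _ (htS Y α) _ (zero_add 1) h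
    obtain ⟨l, hl⟩ : ∃ l : X ⟶ t.obj (B Y α), l ≫ t.map (p Y α) = adj.unit.app X := by
      obtain ⟨l, rfl⟩ := (Abelian.Ext.mk₀_bijective _ _).surjective l
      exact ⟨l, (Abelian.Ext.mk₀_bijective _ _).injective (by rw [← hl, Abelian.Ext.mk₀_comp_mk₀])⟩
    have hs : (adj.homEquiv X (B Y α)).symm l ≫ p Y α = 𝟙 (q.obj X) := by
      rw [← adj.homEquiv_naturality_right_symm, hl, Equiv.symm_apply_eq]
      exact (adj.homEquiv_id X).symm
    rw [← hα Y α, ← Abelian.Ext.mk₀_id_comp (hS Y α).extClass]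
    dsimp only
    rw [← hs, ← Abelian.Ext.mk₀_comp_mk₀,
      Abelian.Ext.comp_assoc _ _ _ _ (zero_add 1) (by simp)]
    exact (congrArg (fun x ↦ (Abelian.Ext.mk₀ _).comp x (zero_add 1))
      (hS Y α).comp_extClass).trans (Abelian.Ext.comp_zero _ _ _ _ _)
  have F_surj (Y : D) : Function.Surjective (F Y) := by
    intro γ
    obtain ⟨E, j, r, wE, hE, rfl⟩ := exists_extClass_eq γ
    obtain ⟨wq, hq⟩ := hX j r wE hE
    let α := hq.extClass.comp (Abelian.Ext.mk₀ (adj.counit.app Y)) (add_zero 1)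
    obtain ⟨φ, h₁, h₃⟩ := exists_hom_of_extClass hq (hS Y α) (adj.counit.app Y) (𝟙 _)
      ((hα Y α).symm.trans (Abelian.Ext.mk₀_id_comp _).symm)
    have c₁ : adj.counit.app Y ≫ i Y α = q.map j ≫ φ.τ₂ := h₁ ▸ φ.comm₁₂
    have c₂ : φ.τ₂ ≫ p Y α = q.map r := by
      have := φ.comm₂₃
      rw [h₃] at this
      exact this.trans (Category.comp_id _)
    let ψ : ShortComplex.mk j r wE ⟶
        ShortComplex.mk (t.map (i Y α)) (t.map (p Y α)) (tw Y α) :=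
      { τ₁ := 𝟙 _
        τ₂ := adj.homEquiv _ _ φ.τ₂
        τ₃ := adj.unit.app X
        comm₁₂ := by
          change 𝟙 _ ≫ t.map (i Y α) = j ≫ adj.homEquiv _ _ φ.τ₂
          rw [← adj.homEquiv_naturality_left, ← c₁, adj.homEquiv_naturality_right]
          congr 1
          rw [← adj.homEquiv_symm_id]
          exact (Equiv.apply_symm_apply _ _).symm
        comm₂₃ := by
          change adj.homEquiv _ _ φ.τ₂ ≫ t.map (p Y α) = r ≫ adj.unit.app X
          rw [← adj.homEquiv_naturality_right, c₂, adj.homEquiv_unit]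
          exact (adj.unit.naturality r).symm }
    exact ⟨α, ((hE.extClass_naturality (htS Y α) ψ).symm.trans (Abelian.Ext.comp_mk₀_id _))⟩
  exact ⟨fun Y ↦ AddEquiv.ofBijective (AddMonoidHom.mk' (F Y) F_add) ⟨F_inj Y, F_surj Y⟩,
    fun _ _ a α ↦ F_nat a α⟩
end

section
/- Let q : C ⥤ D be a functor between abelian categories with a right adjoint t : D ⥤ C. Let F be a class of objects of C that is closed under extensions, generating (every object of C admits an epimorphism from some object of F), and closed under kernels of epimorphisms (if 0 → F' → F₀ → F'' → 0 is a short exact sequence with F₀, F'' ∈ F, then F' ∈ F). Assume that for every F₀ ∈ F, t sends every short exact sequence 0 → Y → B → q(F₀) → 0 in D to a short exact sequence in C. If q sends every short exact sequence in C all three of whose terms lie in F to a short exact sequence in D, then for every F₀ ∈ F, every n ≥ 1 and every object Y of D there is an isomorphism of abelian groups Ext^n_D(q(F₀), Y) ≅ Ext^n_C(F₀, t(Y)), natural in Y. -/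
open CategoryTheory Limits

universe w v u v' u'

open HomologicalComplex in
lemma CochainComplex.epi_f_of_quasiIsoAt {C : Type u} [Category.{v} C] [Abelian C]
    {X : C} {K : CochainComplex C ℤ} {i : ℤ}
    (π : K ⟶ (single C (ComplexShape.up ℤ) i).obj X) [K.IsStrictlyLE i] [h : QuasiIsoAt π i] :
    Epi (π.f i) := by
  let e := K.iCyclesIso i (i + 1) (by simp)
    ((K.isZero_of_isStrictlyLE i (i + 1) (by simp)).eq_of_tgt _ _)
  have hπ : π.f i = (e.inv ≫ K.homologyπ i ≫ homologyMap π i ≫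
      (singleObjHomologySelfIso _ _ _).hom) ≫
        (singleObjXSelf (ComplexShape.up ℤ) i X).inv := by
    rw [← cancel_epi e.hom]
    simp only [Category.assoc]
    rw [Iso.hom_inv_id_assoc, homologyπ_naturality_assoc,
      homologyπ_singleObjHomologySelfIso_hom_assoc,
      ← singleObjCyclesSelfIso_inv_iCycles, Iso.hom_inv_id_assoc, cyclesMap_i]
    rfl
  rw [hπ]
  infer_instance

lemma HomologicalComplex.epi_of_epi_single_map_f {C : Type u} [Category.{v} C] [Abelian C]
    {ι : Type*} [DecidableEq ι] {c : ComplexShape ι} {i : ι} {X Y : C} {g : X ⟶ Y}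
    (h : Epi (((single C c i).map g).f i)) : Epi g := by
  have : g = (singleObjXSelf c i X).inv ≫ ((single C c i).map g).f i ≫
      (singleObjXSelf c i Y).hom := by
    rw [single_map_f_self]
    simp
  rw [this]
  infer_instance

lemma DerivedCategory.exists_epi_singleFunctor_map_comp_eq_zero
    {C : Type u} [Category.{v} C] [Abelian C] [HasDerivedCategory.{w} C]
    {X : C} {L : CochainComplex C ℤ} {i : ℤ}
    (φ : Q.obj ((CochainComplex.singleFunctor C i).obj X) ⟶ Q.obj L)
    (n : ℤ) (hn : n < i) [L.IsStrictlyLE n] :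
    ∃ (P : C) (g : P ⟶ X), Epi g ∧
      Q.map ((CochainComplex.singleFunctor C i).map g) ≫ φ = 0 := by
  obtain ⟨K, _, s, h, f, rfl⟩ := right_fac_of_isStrictlyLE φ i
  have hs : QuasiIso s := (isIso_Q_map_iff_quasiIso _ s).1 h
  let ι : (CochainComplex.singleFunctor C i).obj (K.X i) ⟶ K :=
    HomologicalComplex.mkHomFromSingle (𝟙 _) (by
      rintro _ rfl
      apply (K.isZero_of_isStrictlyLE i (i + 1) (by simp)).eq_of_tgt)
  obtain ⟨g, hg⟩ := (CochainComplex.singleFunctor C i).map_surjective (ι ≫ s)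
  refine ⟨K.X i, g, ?_, ?_⟩
  · have : Epi (s.f i) :=
      CochainComplex.epi_f_of_quasiIsoAt (h := hs.quasiIsoAt i) s
    refine HomologicalComplex.epi_of_epi_single_map_f (c := ComplexShape.up ℤ) (i := i) ?_
    have h₁ : ((HomologicalComplex.single C (ComplexShape.up ℤ) i).map g).f i = ι.f i ≫ s.f i :=
      HomologicalComplex.congr_hom hg i
    have h₂ : ι.f i = (HomologicalComplex.singleObjXSelf (ComplexShape.up ℤ) i _).hom :=
      (HomologicalComplex.mkHomFromSingle_f _ _).trans (Category.comp_id _)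
    rw [h₁, h₂]
    exact epi_comp' inferInstance this
  · have h₂ : ι ≫ f = 0 := by
      apply HomologicalComplex.from_single_hom_ext
      apply (L.isZero_of_isStrictlyLE n i hn).eq_of_tgt
    rw [hg, Q.map_comp, Category.assoc, IsIso.hom_inv_id_assoc, ← Q.map_comp, h₂, Q.map_zero]

open DerivedCategory in
lemma CategoryTheory.Abelian.Ext.exists_epi_mk₀_comp_eq_zero_s6
    {C : Type u} [Category.{v} C] [Abelian C] [HasExt.{w} C] {X Y : C} {n : ℕ}
    (α : Ext X Y (n + 1)) :
    ∃ (P : C) (g : P ⟶ X), Epi g ∧ (mk₀ g).comp α (zero_add _) = 0 := by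
  let := HasDerivedCategory.standard C
  obtain ⟨P, g, hg, h⟩ := exists_epi_singleFunctor_map_comp_eq_zero
    (L := (CochainComplex.singleFunctor C (-(n + 1))).obj Y) (i := 0)
    (α.hom ≫ ((singleFunctors C).shiftIso (n + 1) (-(n + 1)) 0
    (by lia)).hom.app _) (n := -(n + 1)) (by lia)
  refine ⟨P, g, hg, ?_⟩
  ext
  rw [comp_hom, mk₀_hom, ShiftedHom.mk₀_comp, zero_hom]
  simp only [← cancel_mono (((singleFunctors C).shiftIso (n + 1) (-(n + 1)) 0
    (by lia)).hom.app _), Limits.zero_comp]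
  rw [Category.assoc]
  exact h

namespace CategoryTheory

open Abelian

/-- A short exact sequence `0 ⟶ K ⟶ P ⟶ A ⟶ 0` all of whose terms belong to `F`. -/
structure Conflation {C : Type u} [Category.{v} C] [Abelian C] (F : Set C) (A : C) where
  /-- the left term -/
  K : C
  /-- the middle term -/
  P : C
  /-- the inclusion -/
  i : K ⟶ P
  /-- the projection -/
  p : P ⟶ A
  w : i ≫ p = 0
  shortExact : (ShortComplex.mk i p w).ShortExact
  mem_K : K ∈ F
  mem_P : P ∈ F
  mem : A ∈ F

/-- The functor `r` sends short exact sequences with terms in `F` to short exact sequences. -/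
def Functor.IsExactOn {C : Type u} {E : Type u'} [Category.{v} C] [Category.{v'} E]
    [Abelian C] [Abelian E] (r : C ⥤ E) (F : Set C) : Prop :=
  ∀ ⦃A : C⦄ (S : Conflation F A), MapsToShortExact r S.i S.p

/-- Positive degree classes in `Ext (r.obj A) Y (n + 1)` for `A ∈ F` are killed by the image
of an admissible epimorphism onto `A`. -/
def Functor.IsEffaceableOn {C : Type u} {E : Type u'} [Category.{v} C] [Category.{v'} E]
    [Abelian C] [Abelian E] [HasExt.{w} E] (r : C ⥤ E) (F : Set C) : Prop :=
  ∀ ⦃A : C⦄, A ∈ F → ∀ ⦃Y : E⦄ ⦃n : ℕ⦄ (α : Ext (r.obj A) Y (n + 1)),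
    ∃ S : Conflation F A, (Ext.mk₀ (r.map S.p)).comp α (zero_add _) = 0

/-- `F` has enough admissible epimorphisms: every epimorphism onto an object of `F` is
dominated by the projection of a conflation. -/
def HasEnoughConflations {C : Type u} [Category.{v} C] [Abelian C] (F : Set C) : Prop :=
  ∀ ⦃A X : C⦄ (g : X ⟶ A), A ∈ F → Epi g → ∃ (S : Conflation F A) (b : S.P ⟶ X), b ≫ g = S.p

lemma hasEnoughConflations {C : Type u} [Category.{v} C] [Abelian C] {F : Set C}
    (hFgen : ∀ X : C, ∃ F₀ ∈ F, ∃ π : F₀ ⟶ X, Epi π)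
    (hFker : ∀ ⦃A B E : C⦄ (f : A ⟶ B) (g : B ⟶ E) (w : f ≫ g = 0),
      (ShortComplex.mk f g w).ShortExact → B ∈ F → E ∈ F → A ∈ F) :
    HasEnoughConflations F := by
  intro A X g hA _
  obtain ⟨P, hP, π, _⟩ := hFgen X
  have hS : (ShortComplex.mk (kernel.ι (π ≫ g)) (π ≫ g) (kernel.condition _)).ShortExact :=
    { exact := ShortComplex.exact_kernel _ }
  exact ⟨⟨_, P, _, π ≫ g, _, hS, hFker _ _ _ hS hP hA, hP, hA⟩, π, rfl⟩

namespace Conflation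

section

variable {C : Type u} [Category.{v} C] [Abelian C] {F : Set C}

lemma exists_lift {A A' : C} (S : Conflation F A) (S' : Conflation F A') {f : A ⟶ A'}
    {b : S.P ⟶ S'.P} (h : b ≫ S'.p = S.p ≫ f) :
    ∃ a : S.K ⟶ S'.K, a ≫ S'.i = S.i ≫ b := by
  have := S'.shortExact.mono_f
  exact ⟨S'.shortExact.exact.lift (S.i ≫ b) (by simp [h, reassoc_of% S.w]),
    S'.shortExact.exact.lift_f _ _⟩

/-- Two conflations, over the source and over the target of `f`, are dominated by a common
conflation over the source. -/
lemma exists_refinement (hF : HasEnoughConflations F) {A A' : C} (S : Conflation F A)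
    (S' : Conflation F A') (f : A ⟶ A') :
    ∃ (T : Conflation F A) (b : T.P ⟶ S.P) (b' : T.P ⟶ S'.P),
      b ≫ S.p = T.p ∧ b' ≫ S'.p = T.p ≫ f := by
  have := S.shortExact.epi_g
  have := S'.shortExact.epi_g
  dsimp at *
  obtain ⟨T, c, hc⟩ := hF (pullback.fst (S.p ≫ f) S'.p ≫ S.p) S.mem (epi_comp _ _)
  refine ⟨T, c ≫ pullback.fst _ _, c ≫ pullback.snd _ _, by simp [← hc], ?_⟩
  simp [← hc, pullback.condition]

end

variable {C : Type u} {E : Type u'} [Category.{v} C] [Category.{v'} E]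
  [Abelian C] [Abelian E] [HasExt.{w} E] {F : Set C} {A A' : C}

/-- The class of the image of a conflation under a functor that is exact on `F`. -/
noncomputable def extClass (S : Conflation F A) {r : C ⥤ E} (hr : r.IsExactOn F) :
    Ext (r.obj A) (r.obj S.K) 1 :=
  (hr S).choose_spec.extClass

variable {r : C ⥤ E} (hr : r.IsExactOn F)

lemma extClass_naturality (S : Conflation F A) (S' : Conflation F A') {f : A ⟶ A'}
    {a : S.K ⟶ S'.K} {b : S.P ⟶ S'.P} (ha : a ≫ S'.i = S.i ≫ b) (hb : b ≫ S'.p = S.p ≫ f) :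
    (S.extClass hr).comp (Ext.mk₀ (r.map a)) (add_zero 1) =
      (Ext.mk₀ (r.map f)).comp (S'.extClass hr) (zero_add 1) :=
  ShortComplex.ShortExact.extClass_naturality (hr S).choose_spec (hr S').choose_spec
    { τ₁ := r.map a, τ₂ := r.map b, τ₃ := r.map f
      comm₁₂ := (r.map_comp _ _).symm.trans ((congrArg r.map ha).trans (r.map_comp _ _))
      comm₂₃ := (r.map_comp _ _).symm.trans ((congrArg r.map hb).trans (r.map_comp _ _)) }

/-- The connecting homomorphism attached to a conflation. -/
noncomputable def δ (S : Conflation F A) (Y : E) (n : ℕ) :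
    Ext (r.obj S.K) Y n →+ Ext (r.obj A) Y (n + 1) :=
  (S.extClass hr).precomp Y (add_comm 1 n)

lemma δ_apply (S : Conflation F A) {Y : E} {n : ℕ} (x : Ext (r.obj S.K) Y n) :
    S.δ hr Y n x = (S.extClass hr).comp x (add_comm 1 n) := rfl

lemma δ_precomp (S : Conflation F A) (S' : Conflation F A') {f : A ⟶ A'}
    {a : S.K ⟶ S'.K} {b : S.P ⟶ S'.P} (ha : a ≫ S'.i = S.i ≫ b) (hb : b ≫ S'.p = S.p ≫ f)
    {Y : E} {n : ℕ} (x : Ext (r.obj S'.K) Y n) :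
    S.δ hr Y n ((Ext.mk₀ (r.map a)).comp x (zero_add n)) =
      (Ext.mk₀ (r.map f)).comp (S'.δ hr Y n x) (zero_add _) := by
  rw [δ_apply, δ_apply, ← Ext.comp_assoc_of_second_deg_zero, extClass_naturality hr S S' ha hb]
  exact Ext.comp_assoc _ _ _ _ _ (by lia)

lemma δ_postcomp (S : Conflation F A) {Y Y' : E} (g : Y ⟶ Y') {n : ℕ}
    (x : Ext (r.obj S.K) Y n) :
    S.δ hr Y' n (x.comp (Ext.mk₀ g) (add_zero n)) =
      (S.δ hr Y n x).comp (Ext.mk₀ g) (add_zero _) := by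
  simp [δ_apply]

lemma δ_comp_i (S : Conflation F A) {Y : E} {n : ℕ} (y : Ext (r.obj S.P) Y n) :
    S.δ hr Y n ((Ext.mk₀ (r.map S.i)).comp y (zero_add n)) = 0 :=
  (hr S).choose_spec.extClass_comp_assoc y (h := add_comm 1 n)

lemma exists_of_δ_eq_zero (S : Conflation F A) {Y : E} {n : ℕ} {x : Ext (r.obj S.K) Y n}
    (hx : S.δ hr Y n x = 0) :
    ∃ y : Ext (r.obj S.P) Y n, (Ext.mk₀ (r.map S.i)).comp y (zero_add n) = x :=
  Ext.contravariant_sequence_exact₁ (hr S).choose_spec Y x (add_comm 1 n) hx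

lemma exists_δ_eq (S : Conflation F A) {Y : E} {n : ℕ} {α : Ext (r.obj A) Y (n + 1)}
    (hα : (Ext.mk₀ (r.map S.p)).comp α (zero_add _) = 0) :
    ∃ x : Ext (r.obj S.K) Y n, S.δ hr Y n x = α :=
  Ext.contravariant_sequence_exact₃ (hr S).choose_spec Y α hα (add_comm 1 n)

end Conflation

lemma Functor.isExactOn_id {C : Type u} [Category.{v} C] [Abelian C] (F : Set C) :
    (𝟭 C).IsExactOn F :=
  fun _ S ↦ ⟨S.w, S.shortExact⟩

lemma Functor.isEffaceableOn_id {C : Type u} [Category.{v} C] [Abelian C] [HasExt.{w} C]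
    {F : Set C} (hF : HasEnoughConflations F) : (𝟭 C).IsEffaceableOn F := by
  intro A hA Y n α
  obtain ⟨P, g, hg, h⟩ := α.exists_epi_mk₀_comp_eq_zero_s6
  obtain ⟨S, b, hb⟩ := hF g hA hg
  exact ⟨S, by rw [← hb, (𝟭 C).map_comp, ← Ext.mk₀_comp_mk₀_assoc]; erw [h]; simp⟩

/-- A left adjoint is effaceable on `F` as soon as the right adjoint preserves epimorphisms
onto the objects `q.obj A` for `A ∈ F`. -/
lemma Adjunction.isEffaceableOn {C : Type u} {D : Type u'} [Category.{v} C] [Category.{v'} D]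
    [Abelian C] [Abelian D] [HasExt.{w} D] {q : C ⥤ D} {t : D ⥤ C} (adj : q ⊣ t) {F : Set C}
    (hF : HasEnoughConflations F)
    (ht : ∀ A ∈ F, ∀ ⦃B : D⦄ (g : B ⟶ q.obj A), Epi g → Epi (t.map g)) :
    q.IsEffaceableOn F := by
  intro A hA Y n α
  obtain ⟨P, g, hg, h⟩ := α.exists_epi_mk₀_comp_eq_zero_s6
  have := ht A hA g hg
  obtain ⟨S, b, hb⟩ := hF (pullback.snd (t.map g) (adj.unit.app A)) hA inferInstance
  refine ⟨S, ?_⟩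
  have : q.map S.p = (adj.homEquiv _ _).symm (b ≫ pullback.fst _ _) ≫ g := by
    rw [← adj.homEquiv_naturality_right_symm, Category.assoc, pullback.condition,
      reassoc_of% hb, Adjunction.homEquiv_symm_apply]
    simp
  rw [this, ← Ext.mk₀_comp_mk₀_assoc, h, Ext.comp_zero]

lemma _root_.AddEquiv.exists_of_rel {G H : Type*} [AddCommGroup G] [AddCommGroup H]
    (R : G → H → Prop) (hadd : ∀ a b a' b', R a b → R a' b' → R (a + a') (b + b'))
    (hneg : ∀ a b, R a b → R (-a) (-b)) (left_total : ∀ a, ∃ b, R a b)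
    (right_total : ∀ b, ∃ a, R a b) (left_zero : ∀ b, R 0 b → b = 0)
    (right_zero : ∀ a, R a 0 → a = 0) :
    ∃ e : G ≃+ H, ∀ a b, R a b → e a = b := by
  have unique : ∀ a b b', R a b → R a b' → b = b' := fun a b b' h h' ↦ by
    have := left_zero _ (by simpa using hadd _ _ _ _ h (hneg _ _ h'))
    rwa [add_neg_eq_zero] at this
  choose f hf using left_total
  let φ : G →+ H := AddMonoidHom.mk' f fun a a' ↦
    unique _ _ _ (hf _) (hadd _ _ _ _ (hf a) (hf a'))
  have hφ : Function.Bijective φ := by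
    refine ⟨(injective_iff_map_eq_zero φ).2 fun a ha ↦ right_zero a ?_, fun b ↦ ?_⟩
    · have := hf a
      rwa [show f a = 0 from ha] at this
    · obtain ⟨a, ha⟩ := right_total b
      exact ⟨a, unique _ _ _ (hf a) ha⟩
  exact ⟨AddEquiv.ofBijective φ hφ, fun a b h ↦ unique _ _ _ (hf a) h⟩

section Comparison

universe v₁ u₁ v₂ u₂ v₃ u₃

variable {C : Type u} {J : Type u₃} {E₁ : Type u₁} {E₂ : Type u₂}
  [Category.{v} C] [Category.{v₃} J] [Category.{v₁} E₁] [Category.{v₂} E₂]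
  [Abelian C] [Abelian E₁] [Abelian E₂] [HasExt.{w} E₁] [HasExt.{w} E₂]

/-- Isomorphisms `Ext (r₁.obj A) (s₁.obj Y) n ≃+ Ext (r₂.obj A) (s₂.obj Y) n` for `A ∈ F`,
natural in both variables. -/
structure ExtComparison (F : Set C) (r₁ : C ⥤ E₁) (r₂ : C ⥤ E₂) (s₁ : J ⥤ E₁) (s₂ : J ⥤ E₂)
    (n : ℕ) where
  /-- the isomorphisms -/
  e {A : C} (hA : A ∈ F) (Y : J) :
    Ext (r₁.obj A) (s₁.obj Y) n ≃+ Ext (r₂.obj A) (s₂.obj Y) n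
  precomp {A A' : C} (hA : A ∈ F) (hA' : A' ∈ F) (f : A ⟶ A') (Y : J)
    (α : Ext (r₁.obj A') (s₁.obj Y) n) :
    e hA Y ((Ext.mk₀ (r₁.map f)).comp α (zero_add n)) =
      (Ext.mk₀ (r₂.map f)).comp (e hA' Y α) (zero_add n)
  postcomp {A : C} (hA : A ∈ F) {Y Y' : J} (g : Y ⟶ Y') (α : Ext (r₁.obj A) (s₁.obj Y) n) :
    e hA Y' (α.comp (Ext.mk₀ (s₁.map g)) (add_zero n)) =
      (e hA Y α).comp (Ext.mk₀ (s₂.map g)) (add_zero n)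

namespace ExtComparison

variable {F : Set C} {r₁ : C ⥤ E₁} {r₂ : C ⥤ E₂} {s₁ : J ⥤ E₁} {s₂ : J ⥤ E₂} {n : ℕ}

/-- The inverse isomorphisms. -/
noncomputable def symm (c : ExtComparison F r₁ r₂ s₁ s₂ n) : ExtComparison F r₂ r₁ s₂ s₁ n where
  e hA Y := (c.e hA Y).symm
  precomp hA hA' f Y α := (c.e hA Y).injective (by simp [c.precomp hA hA'])
  postcomp hA Y Y' g α := (c.e hA Y').injective (by simp [c.postcomp])

variable (c : ExtComparison F r₁ r₂ s₁ s₂ n) (h₁ : r₁.IsExactOn F) (h₂ : r₂.IsExactOn F)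

/-- The correspondence in degree `n + 1` obtained from isomorphisms in degree `n` by applying
the connecting homomorphisms of conflations. -/
def Rel {A : C} {Y : J} (α : Ext (r₁.obj A) (s₁.obj Y) (n + 1))
    (β : Ext (r₂.obj A) (s₂.obj Y) (n + 1)) : Prop :=
  ∃ (S : Conflation F A) (x : Ext (r₁.obj S.K) (s₁.obj Y) n),
    S.δ h₁ _ n x = α ∧ S.δ h₂ _ n (c.e S.mem_K Y x) = β

/-- A pair of related classes, pulled back along `f`, is related through any conflation that
maps to the given one. -/
lemma exists_δ_eq_comp {A A' : C} {Y : J} (T : Conflation F A) (S : Conflation F A')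
    {f : A ⟶ A'} {b : T.P ⟶ S.P} (hb : b ≫ S.p = T.p ≫ f)
    (x : Ext (r₁.obj S.K) (s₁.obj Y) n) :
    ∃ y : Ext (r₁.obj T.K) (s₁.obj Y) n,
      T.δ h₁ _ n y = (Ext.mk₀ (r₁.map f)).comp (S.δ h₁ _ n x) (zero_add _) ∧
      T.δ h₂ _ n (c.e T.mem_K Y y) =
        (Ext.mk₀ (r₂.map f)).comp (S.δ h₂ _ n (c.e S.mem_K Y x)) (zero_add _) := by
  obtain ⟨a, ha⟩ := T.exists_lift S hb
  exact ⟨(Ext.mk₀ (r₁.map a)).comp x (zero_add n), T.δ_precomp h₁ S ha hb x,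
    by rw [c.precomp T.mem_K S.mem_K, T.δ_precomp h₂ S ha hb]⟩

namespace Rel

variable {c h₁ h₂} {A A' : C} {Y Y' : J}
  {α α' : Ext (r₁.obj A) (s₁.obj Y) (n + 1)} {β β' : Ext (r₂.obj A) (s₂.obj Y) (n + 1)}

lemma symm (h : c.Rel h₁ h₂ α β) : c.symm.Rel h₂ h₁ β α := by
  obtain ⟨S, x, hα, hβ⟩ := h
  exact ⟨S, c.e S.mem_K Y x, hβ, by simpa [ExtComparison.symm] using hα⟩

lemma of_symm (h : c.symm.Rel h₂ h₁ β α) : c.Rel h₁ h₂ α β :=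
  h.symm

lemma neg (h : c.Rel h₁ h₂ α β) : c.Rel h₁ h₂ (-α) (-β) := by
  obtain ⟨S, x, rfl, rfl⟩ := h
  exact ⟨S, -x, by simp, by simp⟩

lemma eq_zero (h : c.Rel h₁ h₂ 0 β) : β = 0 := by
  obtain ⟨S, x, hα, rfl⟩ := h
  obtain ⟨y, rfl⟩ := S.exists_of_δ_eq_zero h₁ hα
  rw [c.precomp S.mem_K S.mem_P, S.δ_comp_i]

lemma postcomp (h : c.Rel h₁ h₂ α β) (g : Y ⟶ Y') :
    c.Rel h₁ h₂ (α.comp (Ext.mk₀ (s₁.map g)) (add_zero _))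
      (β.comp (Ext.mk₀ (s₂.map g)) (add_zero _)) := by
  obtain ⟨S, x, rfl, rfl⟩ := h
  exact ⟨S, x.comp (Ext.mk₀ (s₁.map g)) (add_zero n), S.δ_postcomp h₁ _ _,
    by rw [c.postcomp, S.δ_postcomp]⟩

lemma add (hF : HasEnoughConflations F) (h : c.Rel h₁ h₂ α β) (h' : c.Rel h₁ h₂ α' β') :
    c.Rel h₁ h₂ (α + α') (β + β') := by
  obtain ⟨S, x, rfl, rfl⟩ := h
  obtain ⟨S', x', rfl, rfl⟩ := h'
  obtain ⟨T, b, b', hb, hb'⟩ := S.exists_refinement hF S' (𝟙 A)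
  obtain ⟨y, hy₁, hy₂⟩ :=
    c.exists_δ_eq_comp h₁ h₂ T S (f := 𝟙 A) (b := b) (by simpa using hb) x
  obtain ⟨y', hy'₁, hy'₂⟩ := c.exists_δ_eq_comp h₁ h₂ T S' hb' x'
  simp only [Functor.map_id, Ext.mk₀_id_comp] at hy₁ hy₂ hy'₁ hy'₂
  exact ⟨T, y + y', by rw [map_add, hy₁, hy'₁], by rw [map_add, map_add, hy₂, hy'₂]⟩

lemma precomp (hF : HasEnoughConflations F) (h : c.Rel h₁ h₂ α β) (hA' : A' ∈ F)
    (f : A' ⟶ A) :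
    c.Rel h₁ h₂ ((Ext.mk₀ (r₁.map f)).comp α (zero_add _))
      ((Ext.mk₀ (r₂.map f)).comp β (zero_add _)) := by
  obtain ⟨S, x, rfl, rfl⟩ := h
  obtain ⟨S', -, -⟩ := hF (𝟙 A') hA' inferInstance
  obtain ⟨T, -, b, -, hb⟩ := S'.exists_refinement hF S f
  obtain ⟨y, hy⟩ := c.exists_δ_eq_comp h₁ h₂ T S hb x
  exact ⟨T, y, hy⟩

end Rel

lemma exists_rel (h₁' : r₁.IsEffaceableOn F) {A : C} (hA : A ∈ F) {Y : J}
    (α : Ext (r₁.obj A) (s₁.obj Y) (n + 1)) : ∃ β, c.Rel h₁ h₂ α β := by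
  obtain ⟨S, hS⟩ := h₁' hA α
  obtain ⟨x, hx⟩ := S.exists_δ_eq h₁ hS
  exact ⟨_, S, x, hx, rfl⟩

lemma nonempty_succ (c : ExtComparison F r₁ r₂ s₁ s₂ n) (hF : HasEnoughConflations F)
    (h₁ : r₁.IsExactOn F) (h₂ : r₂.IsExactOn F) (h₁' : r₁.IsEffaceableOn F)
    (h₂' : r₂.IsEffaceableOn F) : Nonempty (ExtComparison F r₁ r₂ s₁ s₂ (n + 1)) := by
  have key {A : C} (hA : A ∈ F) (Y : J) := AddEquiv.exists_of_rel
    (fun (α : Ext (r₁.obj A) (s₁.obj Y) (n + 1)) β ↦ c.Rel h₁ h₂ α β)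
    (fun _ _ _ _ h h' ↦ h.add hF h') (fun _ _ h ↦ h.neg)
    (fun α ↦ c.exists_rel h₁ h₂ h₁' hA α)
    (fun β ↦ (c.symm.exists_rel h₂ h₁ h₂' hA β).imp fun _ h ↦ h.of_symm)
    (fun _ h ↦ h.eq_zero) (fun _ h ↦ h.symm.eq_zero)
  choose e he using @key
  have rel {A : C} (hA : A ∈ F) {Y : J} (α : Ext (r₁.obj A) (s₁.obj Y) (n + 1)) :
      c.Rel h₁ h₂ α (e hA Y α) := by
    obtain ⟨β, hβ⟩ := c.exists_rel h₁ h₂ h₁' hA α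
    rwa [he hA Y _ _ hβ]
  exact ⟨{
    e := e
    precomp := fun hA hA' f Y α ↦ he hA Y _ _ ((rel hA' α).precomp hF hA f)
    postcomp := fun hA _ _ g α ↦ he hA _ _ _ ((rel hA α).postcomp g) }⟩

end ExtComparison

end Comparison

namespace Adjunction

variable {C : Type u} {D : Type u'} [Category.{v} C] [Category.{v'} D] [Abelian C] [Abelian D]
  [HasExt.{w} C] [HasExt.{w} D] {q : C ⥤ D} {t : D ⥤ C} (adj : q ⊣ t) [q.Additive]

/-- The isomorphism between extension groups in degree zero given by an adjunction. -/
noncomputable def extAddEquiv₀ (A : C) (Y : D) :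
    Ext (q.obj A) Y 0 ≃+ Ext A (t.obj Y) 0 :=
  Ext.addEquiv₀.trans ((adj.homAddEquiv A Y).trans Ext.addEquiv₀.symm)

lemma extAddEquiv₀_mk₀ {A : C} {Y : D} (f : q.obj A ⟶ Y) :
    adj.extAddEquiv₀ A Y (Ext.mk₀ f) = Ext.mk₀ (adj.homEquiv A Y f) :=
  congrArg (fun g ↦ Ext.mk₀ (adj.homEquiv A Y g)) (Ext.addEquiv₀.apply_symm_apply f)

/-- The comparison of extension groups in degree zero given by an adjunction. -/
noncomputable def extComparison (F : Set C) : ExtComparison F q (𝟭 C) (𝟭 D) t 0 where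
  e {A} _ Y := adj.extAddEquiv₀ A Y
  precomp {A A'} _ _ f Y α := by
    obtain ⟨φ, rfl⟩ := (Ext.mk₀_bijective _ _).surjective α
    dsimp at φ ⊢
    rw [Ext.mk₀_comp_mk₀, extAddEquiv₀_mk₀, extAddEquiv₀_mk₀, Ext.mk₀_comp_mk₀,
      adj.homEquiv_naturality_left]
  postcomp {A} _ Y Y' g α := by
    obtain ⟨φ, rfl⟩ := (Ext.mk₀_bijective _ _).surjective α
    dsimp at φ ⊢
    rw [Ext.mk₀_comp_mk₀, extAddEquiv₀_mk₀, extAddEquiv₀_mk₀, Ext.mk₀_comp_mk₀,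
      adj.homEquiv_naturality_right]

end Adjunction

end CategoryTheory

/-- Lemma 2.12(i), "only if" direction: let `F` be an extension-closed generating class of
`C` closed under kernels of epimorphisms, such that `t` preserves short exact sequences
ending at objects `q F₀` with `F₀ ∈ F`.  If `q` preserves short exact sequences all of whose
terms lie in `F`, then for every `F₀ ∈ F` and `n ≥ 1` there is an isomorphism
`Ext^n (q F₀) Y ≃ Ext^n F₀ (t Y)`, naturally in `Y`. -/
theorem statement6 {C : Type u} {D : Type u'} [Category.{v} C] [Category.{v'} D]
    [Abelian C] [Abelian D] [HasExt.{w} C] [HasExt.{w} D]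
    (q : C ⥤ D) (t : D ⥤ C) (adj : q ⊣ t) (F : Set C)
    (hFext : ∀ ⦃A B E : C⦄ (f : A ⟶ B) (g : B ⟶ E) (w : f ≫ g = 0),
      (ShortComplex.mk f g w).ShortExact → A ∈ F → E ∈ F → B ∈ F)
    (hFgen : ∀ X : C, ∃ F₀ ∈ F, ∃ π : F₀ ⟶ X, Epi π)
    (hFker : ∀ ⦃A B E : C⦄ (f : A ⟶ B) (g : B ⟶ E) (w : f ≫ g = 0),
      (ShortComplex.mk f g w).ShortExact → B ∈ F → E ∈ F → A ∈ F)
    (ht : ∀ F₀ ∈ F, ∀ ⦃Y B : D⦄ (f : Y ⟶ B) (g : B ⟶ q.obj F₀) (w : f ≫ g = 0),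
      (ShortComplex.mk f g w).ShortExact → MapsToShortExact t f g)
    (hq : ∀ ⦃A B E : C⦄ (f : A ⟶ B) (g : B ⟶ E) (w : f ≫ g = 0),
      (ShortComplex.mk f g w).ShortExact → A ∈ F → B ∈ F → E ∈ F → MapsToShortExact q f g) :
    ∀ F₀ ∈ F, ∀ n : ℕ, 1 ≤ n →
      ∃ e : ∀ Y : D, Abelian.Ext (q.obj F₀) Y n ≃+ Abelian.Ext F₀ (t.obj Y) n,
        ∀ (Y Y' : D) (g : Y ⟶ Y') (α : Abelian.Ext (q.obj F₀) Y n),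
          e Y' (α.comp (Abelian.Ext.mk₀ g) (add_zero n)) =
            (e Y α).comp (Abelian.Ext.mk₀ (t.map g)) (add_zero n) := by
  have hF := hasEnoughConflations hFgen hFker
  have : t.Additive := by
    have := adj.rightAdjoint_preservesLimits
    exact Functor.additive_of_preserves_binary_products t
  have : q.Additive := adj.left_adjoint_additive
  have hq₁ : q.IsExactOn F := fun _ S ↦ hq _ _ S.w S.shortExact S.mem_K S.mem_P S.mem
  have hq₂ : q.IsEffaceableOn F := adj.isEffaceableOn hF fun A hA B g _ ↦ by
    obtain ⟨_, h⟩ := ht A hA (kernel.ι g) g (kernel.condition g)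
      { exact := ShortComplex.exact_kernel g }
    exact h.epi_g
  have key (n : ℕ) : Nonempty (ExtComparison F q (𝟭 C) (𝟭 D) t n) := by
    induction n with
    | zero => exact ⟨adj.extComparison F⟩
    | succ n hn =>
      exact hn.some.nonempty_succ hF hq₁ (Functor.isExactOn_id F) hq₂
        (Functor.isEffaceableOn_id hF)
  intro F₀ hF₀ n _
  obtain ⟨c⟩ := key n
  exact ⟨fun Y ↦ c.e hF₀ Y, fun Y Y' g α ↦ c.postcomp hF₀ g α⟩
end

section
/- Let C be an abelian category with enough projectives, D an abelian category, and q : C ⥤ D a functor left adjoint to an exact functor t : D ⥤ C. Let X be an object of C and n ≥ 1, and assume that the k-th left derived functor of q vanishes at X, i.e. (L_k q)(X) ≅ 0, for every 1 ≤ k ≤ n. Then for every 1 ≤ k ≤ n and every object Y of D there is an isomorphism of abelian groups Ext^k_D(q(X), Y) ≅ Ext^k_C(X, t(Y)), natural in Y. -/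
open CategoryTheory Limits

universe w w' v u v' u'

section

open Abelian

variable {C : Type u} {D : Type u'} [Category.{v} C] [Category.{v'} D] [Abelian C] [Abelian D]

/-- If `B ⟶ K` is an epimorphism killing `A ⟶ B`, and `A ⟶ B ⟶ K ⟶ E` is exact at `B`, then
`K ⟶ E` is a monomorphism. -/
lemma mono_of_exact_of_epi_of_comp_eq_zero {A B K E : C} {f : A ⟶ B} {p : B ⟶ K} {m : K ⟶ E}
    (w : f ≫ p ≫ m = 0) (h : (ShortComplex.mk f (p ≫ m) w).Exact) (hp : f ≫ p = 0) [Epi p] :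
    Mono m := by
  refine Preadditive.mono_of_cancel_zero _ fun {T} x hx ↦ ?_
  obtain ⟨T', π, _, y, hy⟩ := surjective_up_to_refinements_of_epi p x
  have hy' : y ≫ p ≫ m = 0 := by rw [← reassoc_of% hy, hx, comp_zero]
  obtain ⟨T'', π', _, z, hz⟩ := h.exact_up_to_refinements y hy'
  dsimp at z hz
  rw [← cancel_epi π, ← cancel_epi π', hy, reassoc_of% hz, hp]
  simp

lemma IsExactFunctor.shortExact_map {t : D ⥤ C} [t.PreservesZeroMorphisms]
    (ht : IsExactFunctor t) (S : ShortComplex D) (hS : S.ShortExact) :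
    (S.map t).ShortExact :=
  (ht S.f S.g S.zero hS).choose_spec

/-- The short exact sequence `0 ⟶ kernel p ⟶ P ⟶ X ⟶ 0` given by an epimorphism `p`. -/
lemma shortExact_kernel {P X : C} (p : P ⟶ X) [Epi p] :
    (ShortComplex.mk (kernel.ι p) p (kernel.condition p)).ShortExact where
  exact := ShortComplex.exact_kernel p

variable [HasExt.{w} C] [HasExt.{w'} D] {q : C ⥤ D} {t : D ⥤ C}
  [t.Additive] [PreservesFiniteLimits t] [PreservesFiniteColimits t] (adj : q ⊣ t)

/-- For an adjunction `q ⊣ t` with `t` exact, the map `Ext (q X) Y k → Ext X (t Y) k` which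
applies `t` and precomposes with the unit. -/
noncomputable def CategoryTheory.Adjunction.extMap (X : C) (Y : D) (k : ℕ) :
    Ext.{w'} (q.obj X) Y k →+ Ext.{w} X (t.obj Y) k :=
  ((Ext.mk₀ (adj.unit.app X)).precomp (t.obj Y) (zero_add k)).comp
    (t.mapExtAddHom (q.obj X) Y k)

lemma CategoryTheory.Adjunction.extMap_apply {X : C} {Y : D} {k : ℕ} (α : Ext (q.obj X) Y k) :
    (adj.extMap X Y k α : Ext.{w} _ _ _) =
      (Ext.mk₀ (adj.unit.app X)).comp (α.mapExactFunctor t) (zero_add k) := rfl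

lemma CategoryTheory.Adjunction.extMap_comp {X : C} {Y Y' : D} {a b c : ℕ}
    (α : Ext (q.obj X) Y a) (β : Ext Y Y' b) (h : a + b = c) :
    (adj.extMap X Y' c (α.comp β h) : Ext.{w} _ _ _) =
      (adj.extMap X Y a α).comp (β.mapExactFunctor t) h := by
  rw [extMap_apply, extMap_apply, Ext.mapExactFunctor_comp, Ext.comp_assoc]
  lia

lemma CategoryTheory.Adjunction.extMap_mk₀_comp {X X' : C} {Y : D} {k : ℕ} (f : X ⟶ X')
    (α : Ext (q.obj X') Y k) :
    (adj.extMap X Y k ((Ext.mk₀ (q.map f)).comp α (zero_add k)) : Ext.{w} _ _ _) =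
      (Ext.mk₀ f).comp (adj.extMap X' Y k α) (zero_add k) := by
  simp only [extMap_apply, Ext.mapExactFunctor_comp, Ext.mapExactFunctor_mk₀,
    Ext.mk₀_comp_mk₀_assoc]
  rw [← adj.unit_naturality]

lemma CategoryTheory.Adjunction.extMap_extClass_comp [q.PreservesZeroMorphisms]
    {S : ShortComplex C} (hS : S.ShortExact)
    (hqS : (S.map q).ShortExact) {Y : D} {k k' : ℕ} (h : 1 + k = k')
    (α : Ext (q.obj S.X₁) Y k) :
    (adj.extMap S.X₃ Y k' (hqS.extClass.comp α h) : Ext.{w} _ _ _) =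
      hS.extClass.comp (adj.extMap S.X₁ Y k α) h := by
  let φ : S ⟶ (S.map q).map t :=
    { τ₁ := adj.unit.app _
      τ₂ := adj.unit.app _
      τ₃ := adj.unit.app _
      comm₁₂ := adj.unit_naturality S.f
      comm₂₃ := adj.unit_naturality S.g }
  let δ : Ext (q.obj S.X₃) (q.obj S.X₁) 1 := hqS.extClass
  let ε : Ext S.X₃ S.X₁ 1 := hS.extClass
  have hδ : ε.comp (Ext.mk₀ (adj.unit.app S.X₁)) (add_zero 1) =
      (Ext.mk₀ (adj.unit.app S.X₃)).comp (δ.mapExactFunctor t) (zero_add 1) :=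
    (ShortComplex.ShortExact.extClass_naturality hS (hqS.map_of_exact t) φ).trans
      (congr_arg (fun x ↦ (Ext.mk₀ (adj.unit.app S.X₃)).comp x (zero_add 1))
        (Ext.mapExactFunctor_extClass t hqS).symm)
  change adj.extMap S.X₃ Y k' (δ.comp α h) = ε.comp (adj.extMap S.X₁ Y k α) h
  rw [extMap_comp, extMap_apply, extMap_apply, ← hδ, Ext.comp_assoc_of_second_deg_zero]

lemma CategoryTheory.Adjunction.extMap_bijective_zero (X : C) (Y : D) :
    Function.Bijective (adj.extMap X Y 0 : Ext.{w'} _ _ _ → Ext.{w} _ _ _) := by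
  have : (adj.extMap X Y 0 : Ext.{w'} _ _ _ → Ext.{w} _ _ _) =
      Ext.homEquiv₀.symm ∘ adj.homEquiv X Y ∘ Ext.homEquiv₀ := by
    ext α
    obtain ⟨f, rfl⟩ := (Ext.mk₀_bijective _ _).2 α
    simp [extMap_apply, Ext.mapExactFunctor_mk₀, Ext.homEquiv₀, adj.homEquiv_unit]
  rw [this]
  exact Ext.homEquiv₀.symm.bijective.comp ((adj.homEquiv X Y).bijective.comp
    Ext.homEquiv₀.bijective)

lemma CategoryTheory.Adjunction.extMap_surjective_of_projective (P : C) [Projective P] (Y : D)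
    (k : ℕ) : Function.Surjective (adj.extMap P Y k : Ext.{w'} _ _ _ → Ext.{w} _ _ _) := by
  cases k with
  | zero => exact (adj.extMap_bijective_zero P Y).2
  | succ k => exact fun β ↦ ⟨0, by rw [map_zero, β.eq_zero_of_projective]⟩

/-- Dimension shifting along a short exact sequence with projective middle term which remains
exact after applying `q`. -/
lemma CategoryTheory.Adjunction.extMap_bijective_succ [q.PreservesZeroMorphisms]
    {S : ShortComplex C} (hS : S.ShortExact)
    (hqS : (S.map q).ShortExact) [Projective S.X₂] {Y : D} {k : ℕ}
    (h : Function.Bijective (adj.extMap S.X₁ Y k : Ext.{w'} _ _ _ → Ext.{w} _ _ _)) :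
    Function.Bijective (adj.extMap S.X₃ Y (k + 1) : Ext.{w'} _ _ _ → Ext.{w} _ _ _) := by
  have : Projective (S.map q).X₂ := adj.map_projective S.X₂ inferInstance
  constructor
  · rw [injective_iff_map_eq_zero]
    intro α hα
    obtain ⟨β, rfl⟩ := Ext.contravariant_sequence_exact₃ hqS Y α (Ext.eq_zero_of_projective _)
      (add_comm 1 k)
    obtain ⟨γ, hγ⟩ := Ext.contravariant_sequence_exact₁ hS _ _ _
      ((adj.extMap_extClass_comp hS hqS _ β).symm.trans hα)
    obtain ⟨γ, rfl⟩ := adj.extMap_surjective_of_projective S.X₂ Y k γ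
    rw [← adj.extMap_mk₀_comp] at hγ
    rw [← h.1 hγ]
    exact hqS.extClass_comp_assoc _
  · intro β
    obtain ⟨β, rfl⟩ := Ext.contravariant_sequence_exact₃ hS _ β (Ext.eq_zero_of_projective _)
      (add_comm 1 k)
    obtain ⟨α, rfl⟩ := h.2 β
    exact ⟨_, adj.extMap_extClass_comp hS hqS _ α⟩

/-- If `X` has a projective resolution which remains exact in degrees `1, …, k` after
applying `q`, then `Ext (q X) Y k → Ext X (t Y) k` is bijective. -/
lemma CategoryTheory.Adjunction.extMap_bijective [q.Additive] (Y : D) (k : ℕ) {X : C}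
    (P : ChainComplex C ℕ) [∀ i, Projective (P.X i)] (π : P.X 0 ⟶ X) [Epi π]
    (w : P.d 1 0 ≫ π = 0) (h₀ : (ShortComplex.mk _ _ w).Exact)
    (hP : ∀ i, (P.sc' (i + 2) (i + 1) i).Exact)
    (hq : ∀ i < k, ((P.sc' (i + 2) (i + 1) i).map q).Exact) :
    Function.Bijective (adj.extMap X Y k : Ext.{w'} _ _ _ → Ext.{w} _ _ _) := by
  induction k generalizing X P with
  | zero => exact adj.extMap_bijective_zero X Y
  | succ k ih =>
    have := adj.isLeftAdjoint
    have : PreservesColimitsOfSize.{0, 0} q := adj.leftAdjoint_preservesColimits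
    let π' : P.X 1 ⟶ kernel π := kernel.lift π (P.d 1 0) w
    have fac : π' ≫ kernel.ι π = P.d 1 0 := kernel.lift_ι _ _ _
    have : Epi π' := ShortComplex.Exact.epi_kernelLift h₀
    have w' : P.d 2 1 ≫ π' = 0 := by
      rw [← cancel_mono (kernel.ι π), Category.assoc, fac, P.d_comp_d, zero_comp]
    have h₁ : (ShortComplex.mk _ _ w').Exact := by
      rw [ShortComplex.exact_iff_exact_up_to_refinements]
      intro T (x : T ⟶ P.X 1) (hx : x ≫ π' = 0)
      have hx' : x ≫ P.d 1 0 = 0 := by rw [← fac, reassoc_of% hx, zero_comp]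
      exact (hP 0).exact_up_to_refinements x hx'
    have hS := shortExact_kernel π
    have : Mono (q.map (kernel.ι π)) := by
      have hE := hq 0 (by lia)
      refine mono_of_exact_of_epi_of_comp_eq_zero (f := q.map (P.d 2 1)) (p := q.map π') ?_ ?_ ?_
      · rw [← q.map_comp, fac, ← q.map_comp, P.d_comp_d, q.map_zero]
      · convert! hE using 1
        simp only [← q.map_comp, fac]
        rfl
      · rw [← q.map_comp, w', q.map_zero]
    have hqS : ((ShortComplex.mk _ _ (kernel.condition π)).map q).ShortExact :=
      { exact := hS.exact.map_of_epi_of_preservesCokernel q inferInstance inferInstance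
        mono_f := this
        epi_g := inferInstanceAs (Epi (q.map π)) }
    have : Projective (ShortComplex.mk _ _ (kernel.condition π)).X₂ :=
      inferInstanceAs (Projective (P.X 0))
    refine adj.extMap_bijective_succ hS hqS ?_
    have (i : ℕ) : Projective ((ChainComplex.truncate.obj P).X i) :=
      inferInstanceAs (Projective (P.X (i + 1)))
    let π'' : (ChainComplex.truncate.obj P).X 0 ⟶ kernel π := π'
    have : Epi π'' := inferInstanceAs (Epi π')
    exact ih (ChainComplex.truncate.obj P) π'' w' h₁ (fun i ↦ hP (i + 1))
      (fun i hi ↦ hq (i + 1) (by lia))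

end

/-- Proposition 2.15(i) (one implication), with `F` the class of projectives: if `C` has
enough projectives, `t` is exact, `q ⊣ t`, and `(L_k q)(X) = 0` for `1 ≤ k ≤ n`, then
`Ext^k (q X) Y ≃ Ext^k X (t Y)` for `1 ≤ k ≤ n`, naturally in `Y`. -/
theorem statement7 {C : Type u} {D : Type u'} [Category.{v} C] [Category.{v'} D]
    [Abelian C] [Abelian D] [EnoughProjectives C] [HasExt.{w} C] [HasExt.{w'} D]
    (q : C ⥤ D) [q.Additive] (t : D ⥤ C) (adj : q ⊣ t)
    (ht : IsExactFunctor t) (X : C) (n : ℕ) (hn : 1 ≤ n)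
    (hvanish : ∀ k : ℕ, 1 ≤ k → k ≤ n → IsZero ((q.leftDerived k).obj X)) :
    ∀ k : ℕ, 1 ≤ k → k ≤ n →
      ∃ e : ∀ Y : D, Abelian.Ext (q.obj X) Y k ≃+ Abelian.Ext X (t.obj Y) k,
        ∀ (Y Y' : D) (g : Y ⟶ Y') (α : Abelian.Ext (q.obj X) Y k),
          e Y' (α.comp (Abelian.Ext.mk₀ g) (add_zero k)) =
            (e Y α).comp (Abelian.Ext.mk₀ (t.map g)) (add_zero k) := by
  intro k _ hk
  have := adj.right_adjoint_additive
  obtain ⟨_, _⟩ := (t.exact_tfae.out 0 3).1 ht.shortExact_map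
  let P := projectiveResolution X
  let π : P.complex.X 0 ⟶ X := P.π.f 0
  have : Epi π := inferInstanceAs (Epi (P.π.f 0))
  have hq (i : ℕ) (hi : i < k) : ((P.complex.sc' (i + 2) (i + 1) i).map q).Exact := by
    have := (hvanish (i + 1) (by lia) (by lia)).of_iso (P.isoLeftDerivedObj q (i + 1)).symm
    exact (HomologicalComplex.exactAt_iff' _ (i + 2) (i + 1) i (by simp) (by simp)).1
      ((HomologicalComplex.exactAt_iff_isZero_homology _ _).2 this)
  refine ⟨fun Y ↦ AddEquiv.ofBijective (adj.extMap X Y k)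
    (adj.extMap_bijective Y k P.complex π P.complex_d_comp_π_f_zero P.exact₀
      P.exact_succ hq), fun Y Y' g α ↦ ?_⟩
  simp [adj.extMap_comp, Abelian.Ext.mapExactFunctor_mk₀]
end

section
/- Let f : R → S be a homomorphism of rings and let N be a left R-module such that Ext¹_R(S_R, N) = 0, where S_R denotes S regarded as a left R-module by restriction of scalars along f. Then for every left S-module M there is an isomorphism of abelian groups Ext¹_R(M_R, N) ≅ Ext¹_S(M, Hom_R(S, N)), natural in M, where M_R denotes M regarded as a left R-module by restriction of scalars along f, and Hom_R(S, N) is the coextension of scalars of N along f (the left S-module of R-linear maps S → N, with S acting by (s · φ)(s') = φ(s' s)). -/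
open CategoryTheory Limits

universe u

namespace CategoryTheory

universe w w' v v' u₁ u₂

section ExtCoproduct

variable {C : Type u₁} [Category.{v} C] [Abelian C] [HasExt.{w} C]

/-- If every `Ext¹ (X j) Y` vanishes, then so does `Ext¹` from the coproduct of the `X j`
to `Y`, provided that there are enough injectives. -/
lemma Abelian.Ext.eq_zero_of_isColimit_cofan [EnoughInjectives C] {J : Type*} {X : J → C}
    {c : Cofan X} (hc : IsColimit c) {Y : C} (h : ∀ (j : J) (x : Abelian.Ext (X j) Y 1), x = 0)
    (x : Abelian.Ext c.pt Y 1) : x = 0 := by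
  let T : ShortComplex C := ShortComplex.mk (Injective.ι Y) (cokernel.π (Injective.ι Y)) (by simp)
  have hT : T.ShortExact :=
    { exact := ShortComplex.exact_cokernel _
      mono_f := inferInstanceAs (Mono (Injective.ι Y))
      epi_g := inferInstanceAs (Epi (cokernel.π _)) }
  have : Injective T.X₂ := inferInstanceAs (Injective (Injective.under Y))
  obtain ⟨y, rfl⟩ := Abelian.Ext.covariant_sequence_exact₁ _ hT x
    (Abelian.Ext.eq_zero_of_injective _) (zero_add 1)
  obtain ⟨q, rfl⟩ := (Abelian.Ext.mk₀_bijective _ _).2 y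
  have hq (j : J) : ∃ p : X j ⟶ T.X₂, p ≫ T.g = c.inj j ≫ q := by
    obtain ⟨z, hz⟩ := Abelian.Ext.covariant_sequence_exact₃ _ hT
      (Abelian.Ext.mk₀ (c.inj j ≫ q)) (zero_add 1) (h j _)
    obtain ⟨p, rfl⟩ := (Abelian.Ext.mk₀_bijective _ _).2 z
    exact ⟨p, (Abelian.Ext.mk₀_bijective _ _).1 (by simpa using hz)⟩
  choose p hp using hq
  have hpq : Cofan.IsColimit.desc hc p ≫ T.g = q :=
    Cofan.IsColimit.hom_ext hc _ _ fun j ↦ by simp [hp]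
  rw [← hpq, ← Abelian.Ext.mk₀_comp_mk₀, Abelian.Ext.comp_assoc_of_second_deg_zero,
    hT.comp_extClass, Abelian.Ext.comp_zero]

end ExtCoproduct

namespace Adjunction

variable {C : Type u₁} [Category.{v} C] [Abelian C] [HasExt.{w} C]
  {D : Type u₂} [Category.{v'} D] [Abelian D] [HasExt.{w'} D]
  {F : C ⥤ D} {G : D ⥤ C} (adj : F ⊣ G)
  [F.Additive] [PreservesFiniteLimits F] [PreservesFiniteColimits F]

/-- The comparison morphism `Ext M (G N) n → Ext (F M) N n` attached to an adjunction `F ⊣ G`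
with `F` exact: apply `F`, then compose with the counit. -/
noncomputable def extAddHom (M : C) (N : D) (n : ℕ) :
    Abelian.Ext M (G.obj N) n →+ Abelian.Ext (F.obj M) N n :=
  ((Abelian.Ext.mk₀ (adj.counit.app N)).postcomp _ (add_zero n)).comp (F.mapExtAddHom M _ n)

lemma extAddHom_apply {M : C} {N : D} {n : ℕ} (x : Abelian.Ext M (G.obj N) n) :
    adj.extAddHom M N n x =
      (x.mapExactFunctor F).comp (Abelian.Ext.mk₀ (adj.counit.app N)) (add_zero n) :=
  rfl

lemma extAddHom_mk₀_comp {M M' : C} {N : D} {n : ℕ} (g : M ⟶ M')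
    (x : Abelian.Ext M' (G.obj N) n) :
    adj.extAddHom M N n ((Abelian.Ext.mk₀ g).comp x (zero_add n)) =
      (Abelian.Ext.mk₀ (F.map g)).comp (adj.extAddHom M' N n x) (zero_add n) := by
  simp only [extAddHom_apply, Abelian.Ext.mapExactFunctor_comp, Abelian.Ext.mapExactFunctor_mk₀,
    Abelian.Ext.comp_assoc_of_third_deg_zero]

lemma extAddHom_extClass_comp_mk₀_homEquiv {T : ShortComplex C} (hT : T.ShortExact) {N : D}
    (k : F.obj T.X₁ ⟶ N) :
    adj.extAddHom T.X₃ N 1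
        (hT.extClass.comp (Abelian.Ext.mk₀ (adj.homEquiv _ _ k)) (add_zero 1)) =
      (hT.map_of_exact F).extClass.comp (Z := N) (Abelian.Ext.mk₀ k) (add_zero 1) := by
  have hk : F.map (adj.homEquiv _ _ k) ≫ adj.counit.app N = k := by simp [adj.homEquiv_unit]
  rw [extAddHom_apply, Abelian.Ext.mapExactFunctor_comp, Abelian.Ext.mapExactFunctor_mk₀,
    Abelian.Ext.comp_assoc_of_third_deg_zero, Abelian.Ext.mk₀_comp_mk₀, hk,
    Abelian.Ext.mapExactFunctor_extClass]
  rfl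

/-- The comparison morphism on `Ext¹` is bijective at `M` as soon as `M` is a quotient of a
projective object `P` with `Ext¹ (F P) N = 0`. -/
lemma extAddHom_bijective_of_projective {P M : C} [Projective P] (p : P ⟶ M) [Epi p] {N : D}
    (hP : ∀ x : Abelian.Ext (F.obj P) N 1, x = 0) :
    Function.Bijective (adj.extAddHom M N 1) := by
  let T : ShortComplex C := ShortComplex.mk (kernel.ι p) p (by simp)
  have hT : T.ShortExact :=
    { exact := ShortComplex.exact_kernel _
      mono_f := inferInstanceAs (Mono (kernel.ι p))
      epi_g := inferInstanceAs (Epi p) }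
  have : Projective T.X₂ := inferInstanceAs (Projective P)
  constructor
  · rw [injective_iff_map_eq_zero]
    intro x hx
    obtain ⟨y, rfl⟩ := Abelian.Ext.contravariant_sequence_exact₃ hT _ x
      (Abelian.Ext.eq_zero_of_projective _) (add_zero 1)
    obtain ⟨h, rfl⟩ := (Abelian.Ext.mk₀_bijective _ _).2 y
    obtain ⟨l, rfl⟩ := (adj.homEquiv _ _).surjective h
    obtain ⟨z, hz⟩ := Abelian.Ext.contravariant_sequence_exact₁ (hT.map_of_exact F) _ _ _
      ((adj.extAddHom_extClass_comp_mk₀_homEquiv hT l).symm.trans hx)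
    obtain ⟨k, rfl⟩ := (Abelian.Ext.mk₀_bijective _ _).2 z
    rw [Abelian.Ext.mk₀_comp_mk₀] at hz
    change F.obj T.X₂ ⟶ N at k
    have hk : F.map T.f ≫ k = l := (Abelian.Ext.mk₀_bijective _ _).1 hz
    rw [← hk, adj.homEquiv_naturality_left, ← Abelian.Ext.mk₀_comp_mk₀, hT.extClass_comp_assoc]
  · intro y
    obtain ⟨z, rfl⟩ := Abelian.Ext.contravariant_sequence_exact₃ (hT.map_of_exact F) _ y
      (hP _) (add_zero 1)
    obtain ⟨k, rfl⟩ := (Abelian.Ext.mk₀_bijective _ _).2 z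
    exact ⟨_, adj.extAddHom_extClass_comp_mk₀_homEquiv hT k⟩

end Adjunction

end CategoryTheory

namespace ModuleCat

variable {R S : Type u} [Ring R] [Ring S] (f : R →+* S)

lemma exact_map_restrictScalars (T : ShortComplex (ModuleCat.{u} S)) (hT : T.Exact) :
    (T.map (restrictScalars.{u} f)).Exact := by
  rw [ShortComplex.ShortExact.moduleCat_exact_iff_function_exact] at hT ⊢
  exact hT

lemma preservesFiniteLimits_restrictScalars :
    PreservesFiniteLimits (restrictScalars.{u} f) := by
  have := ((restrictScalars.{u} f).exact_tfae.out 1 3).mp (exact_map_restrictScalars f)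
  exact this.1

lemma preservesFiniteColimits_restrictScalars :
    PreservesFiniteColimits (restrictScalars.{u} f) := by
  have := ((restrictScalars.{u} f).exact_tfae.out 1 3).mp (exact_map_restrictScalars f)
  exact this.2

/-- The canonical morphism from the free module on the elements of `M` to `M` is an
epimorphism. -/
lemma epi_sigmaDesc_toSpanSingleton (M : ModuleCat.{u} S) :
    Epi (Sigma.desc fun m : M ↦ ModuleCat.ofHom (LinearMap.toSpanSingleton S M m)) := by
  rw [ModuleCat.epi_iff_surjective]
  intro m
  refine ⟨Sigma.ι (fun _ : M ↦ ModuleCat.of S S) m (1 : S), ?_⟩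
  rw [← ModuleCat.comp_apply, Sigma.ι_desc]
  simp

end ModuleCat

/-- Example 2.16(ii): let `f : R →+* S` be a ring homomorphism and `N` a left `R`-module
with `Ext¹_R (S_R) N = 0`, where `S_R` is `S` viewed as a left `R`-module by restriction
of scalars.  Then `Ext¹_R M_R N ≃ Ext¹_S M (Hom_R(S, N))` naturally in the `S`-module `M`,
where `Hom_R(S, N)` is the coextension of scalars of `N` along `f`. -/
theorem statement9 {R S : Type u} [Ring R] [Ring S] (f : R →+* S)
    [HasExt.{u} (ModuleCat.{u} R)] [HasExt.{u} (ModuleCat.{u} S)]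
    (N : ModuleCat.{u} R)
    (hN : ∀ x : Abelian.Ext
        ((ModuleCat.restrictScalars.{u, u, u} f).obj (ModuleCat.of S S)) N 1, x = 0) :
    ∃ e : ∀ M : ModuleCat.{u} S,
        Abelian.Ext ((ModuleCat.restrictScalars.{u, u, u} f).obj M) N 1 ≃+
          Abelian.Ext M ((ModuleCat.coextendScalars.{u, u, u} f).obj N) 1,
      ∀ (M M' : ModuleCat.{u} S) (g : M ⟶ M')
        (α : Abelian.Ext ((ModuleCat.restrictScalars.{u, u, u} f).obj M') N 1),
        e M ((Abelian.Ext.mk₀ ((ModuleCat.restrictScalars.{u, u, u} f).map g)).comp α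
            (zero_add 1)) =
          (Abelian.Ext.mk₀ g).comp (e M' α) (zero_add 1) := by
  have := ModuleCat.preservesFiniteLimits_restrictScalars f
  have := ModuleCat.preservesFiniteColimits_restrictScalars f
  have hbij (M : ModuleCat.{u} S) :
      Function.Bijective ((ModuleCat.restrictCoextendScalarsAdj.{u} f).extAddHom M N 1) := by
    have := M.epi_sigmaDesc_toSpanSingleton
    refine Adjunction.extAddHom_bijective_of_projective _
      (Sigma.desc fun m : M ↦ ModuleCat.ofHom (LinearMap.toSpanSingleton S M m)) ?_
    exact Abelian.Ext.eq_zero_of_isColimit_cofan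
      (isColimitCofanMkObjOfIsColimit (ModuleCat.restrictScalars f) _ _
        (coproductIsCoproduct fun _ : M ↦ ModuleCat.of S S)) fun _ ↦ hN
  refine ⟨fun M ↦ (AddEquiv.ofBijective _ (hbij M)).symm, fun M M' g α ↦ ?_⟩
  rw [AddEquiv.symm_apply_eq, AddEquiv.ofBijective_apply, Adjunction.extAddHom_mk₀_comp]
  congr 1
  exact ((AddEquiv.ofBijective _ (hbij M')).apply_symm_apply α).symm
end

section
/- Let {(q_i, t_i)}_{i ∈ I} be a family of adjunctions with q_i : C ⥤ D left adjoint to t_i : D ⥤ C, where C and D are abelian categories, and let (F, G) be a cotorsion pair in C. Assume that for every i ∈ I every object of F is q_i-flat, and that for every i ∈ I and every F₀ ∈ F, t_i sends every short exact sequence 0 → Y → B → q_i(F₀) → 0 in D to a short exact sequence in C. Then for every object Y of D: (for all i ∈ I and all F₀ ∈ F, Ext¹_D(q_i(F₀), Y) = 0) if and only if (for all i ∈ I, t_i(Y) ∈ G). -/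
open CategoryTheory Limits

universe w v u v' u' i'

/-- `(F, G)` is a cotorsion pair: each class is the `Ext¹`-orthogonal of the other. -/
def IsCotorsionPair {A : Type u} [Category.{v} A] [Abelian A] [HasExt.{w} A]
    (F G : Set A) : Prop :=
  (∀ Y : A, Y ∈ G ↔ ∀ F₀ ∈ F, ∀ x : Abelian.Ext F₀ Y 1, x = 0) ∧
  (∀ X : A, X ∈ F ↔ ∀ G₀ ∈ G, ∀ x : Abelian.Ext X G₀ 1, x = 0)

open Abelian Pretriangulated

universe w₁

section Extensions

variable {A : Type u} [Category.{v} A] [Abelian A]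

/-- There are no nonzero morphisms of negative degree between objects of an abelian
category in its derived category. -/
lemma singleFunctor_negative_hom_eq_zero [HasDerivedCategory.{w₁} A] ⦃X Y : A⦄ ⦃n : ℤ⦄
    (f : (DerivedCategory.singleFunctor A 0).obj X ⟶
      ((DerivedCategory.singleFunctor A 0).obj Y)⟦n⟧) (hn : n < 0) : f = 0 :=
  DerivedCategory.TStructure.t.zero_of_isLE_of_isGE f 0 (-n) (by lia) inferInstance
    (DerivedCategory.TStructure.t.isGE_shift _ 0 n (-n) (by lia))

/-- A distinguished triangle on a degree one morphism `h : X ⟶ Y⟦1⟧` between objects of an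
abelian category comes from a short exact sequence. -/
lemma exists_shortExact_distTriang [HasDerivedCategory.{w₁} A] {X Y : A}
    (h : (DerivedCategory.singleFunctor A 0).obj X ⟶
      ((DerivedCategory.singleFunctor A 0).obj Y)⟦(1 : ℤ)⟧) :
    ∃ (B : A) (f : Y ⟶ B) (g : B ⟶ X) (zero : f ≫ g = 0),
      (ShortComplex.mk f g zero).ShortExact ∧
      Triangle.mk ((DerivedCategory.singleFunctor A 0).map f)
        ((DerivedCategory.singleFunctor A 0).map g) h ∈ distTriang (DerivedCategory A) := by
  obtain ⟨Z, a, b, hT⟩ := distinguished_cocone_triangle₂ h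
  have : Z.IsLE 0 := DerivedCategory.TStructure.t.isLE₂ _ hT 0
    (inferInstanceAs (((DerivedCategory.singleFunctor A 0).obj Y).IsLE 0))
    (inferInstanceAs (((DerivedCategory.singleFunctor A 0).obj X).IsLE 0))
  have : Z.IsGE 0 := DerivedCategory.TStructure.t.isGE₂ _ hT 0
    (inferInstanceAs (((DerivedCategory.singleFunctor A 0).obj Y).IsGE 0))
    (inferInstanceAs (((DerivedCategory.singleFunctor A 0).obj X).IsGE 0))
  obtain ⟨B, ⟨e⟩⟩ := Z.exists_iso_singleFunctor_obj_of_isGE_of_isLE 0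
  obtain ⟨f, hf⟩ := (DerivedCategory.singleFunctor A 0).map_surjective (a ≫ e.hom)
  obtain ⟨g, hg⟩ := (DerivedCategory.singleFunctor A 0).map_surjective (e.inv ≫ b)
  have hT' : Triangle.mk ((DerivedCategory.singleFunctor A 0).map f)
      ((DerivedCategory.singleFunctor A 0).map g) h ∈ distTriang (DerivedCategory A) :=
    isomorphic_distinguished _ hT _
      (Triangle.isoMk _ _ (Iso.refl _) e.symm (Iso.refl _)
        (by change (DerivedCategory.singleFunctor A 0).map f ≫ e.inv = 𝟙 _ ≫ a; simp [hf])
        (by change (DerivedCategory.singleFunctor A 0).map g ≫ 𝟙 _ = e.inv ≫ b; simp [hg])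
        (by change h ≫ (𝟙 _)⟦(1 : ℤ)⟧' = 𝟙 _ ≫ h; simp))
  have hf_lim := Triangulated.AbelianSubcategory.isLimitKernelForkOfDistTriang
    singleFunctor_negative_hom_eq_zero f g h hT'
  have hg_colim := Triangulated.AbelianSubcategory.isColimitCokernelCoforkOfDistTriang
    singleFunctor_negative_hom_eq_zero f g h hT'
  have zero : f ≫ g = 0 := (DerivedCategory.singleFunctor A 0).map_injective
    (by rw [Functor.map_comp, Functor.map_zero]; exact comp_distTriang_mor_zero₁₂ _ hT')
  exact ⟨B, f, g, zero,
    { exact := ShortComplex.exact_of_f_is_kernel _ hf_lim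
      mono_f := mono_of_isLimit_fork hf_lim
      epi_g := epi_of_isColimit_cofork hg_colim }, hT'⟩

/-- Every class in `Ext¹` is killed by both maps of some short exact sequence. -/
lemma CategoryTheory.Abelian.Ext.exists_shortExact [HasExt.{w} A] {X Y : A} (x : Ext X Y 1) :
    ∃ (B : A) (f : Y ⟶ B) (g : B ⟶ X) (zero : f ≫ g = 0),
      (ShortComplex.mk f g zero).ShortExact ∧
      (Ext.mk₀ g).comp x (zero_add 1) = 0 ∧ x.comp (Ext.mk₀ f) (add_zero 1) = 0 := by
  let := HasDerivedCategory.standard A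
  obtain ⟨B, f, g, zero, hS, hT⟩ := exists_shortExact_distTriang x.hom
  refine ⟨B, f, g, zero, hS, ?_, ?_⟩
  · ext
    simp only [Ext.comp_hom, Ext.mk₀_hom, Ext.zero_hom, ShiftedHom.mk₀_comp]
    exact comp_distTriang_mor_zero₂₃ _ hT
  · ext
    simp only [Ext.comp_hom, Ext.mk₀_hom, Ext.zero_hom, ShiftedHom.comp_mk₀]
    exact comp_distTriang_mor_zero₃₁ _ hT

end Extensions

section Adjunction

variable {C : Type u} {D : Type u'} [Category.{v} C] [Category.{v'} D] [Abelian C] [Abelian D]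
  [HasExt.{w} C] [HasExt.{w₁} D] {q : C ⥤ D} {t : D ⥤ C} {X : C} {Y : D}

/-- If `X` is `q`-flat, vanishing of `Ext¹ (q X) Y` implies vanishing of `Ext¹ X (t Y)`. -/
lemma ext_rightAdjoint_eq_zero (adj : q ⊣ t) (hX : QFlat q X)
    (h : ∀ x : Ext (q.obj X) Y 1, x = 0) (x : Ext X (t.obj Y) 1) : x = 0 := by
  obtain ⟨B, f, g, zero, hS, -, hx⟩ := x.exists_shortExact
  obtain ⟨w, hqS⟩ := hX f g zero hS
  obtain ⟨y, hy⟩ := Ext.contravariant_sequence_exact₁ hqS Y (Ext.mk₀ (adj.counit.app Y))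
    (add_zero 1) (h _)
  obtain ⟨r, rfl⟩ := (Ext.mk₀_bijective _ _).2 y
  have hr : q.map f ≫ r = adj.counit.app Y :=
    (Ext.mk₀_bijective _ _).1 (by simpa using hy)
  have hfr : f ≫ adj.homEquiv _ _ r = 𝟙 _ := by
    rw [← adj.homEquiv_naturality_left, hr, ← adj.homEquiv_symm_id, Equiv.apply_symm_apply]
  rw [← x.comp_mk₀_id, ← hfr, ← Ext.mk₀_comp_mk₀,
    ← Ext.comp_assoc_of_third_deg_zero, hx, Ext.zero_comp]

/-- If `t` preserves short exact sequences ending at `q X`, vanishing of `Ext¹ X (t Y)`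
implies vanishing of `Ext¹ (q X) Y`. -/
lemma ext_leftAdjoint_eq_zero (adj : q ⊣ t)
    (ht : ∀ ⦃B : D⦄ (f : Y ⟶ B) (g : B ⟶ q.obj X) (w : f ≫ g = 0),
      (ShortComplex.mk f g w).ShortExact → MapsToShortExact t f g)
    (h : ∀ x : Ext X (t.obj Y) 1, x = 0) (x : Ext (q.obj X) Y 1) : x = 0 := by
  obtain ⟨B, f, g, zero, hS, hx, -⟩ := x.exists_shortExact
  obtain ⟨w, htS⟩ := ht f g zero hS
  obtain ⟨y, hy⟩ := Ext.covariant_sequence_exact₃ X htS (Ext.mk₀ (adj.unit.app X))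
    (zero_add 1) (h _)
  obtain ⟨s, rfl⟩ := (Ext.mk₀_bijective _ _).2 y
  have hs : s ≫ t.map g = adj.unit.app X :=
    (Ext.mk₀_bijective _ _).1 (by simpa using hy)
  have hsg : (adj.homEquiv _ _).symm s ≫ g = 𝟙 _ := by
    rw [← adj.homEquiv_naturality_right_symm, hs, ← adj.homEquiv_id, Equiv.symm_apply_apply]
  rw [← x.mk₀_id_comp, ← hsg, ← Ext.mk₀_comp_mk₀_assoc, hx, Ext.comp_zero]

end Adjunction

/-- Theorem 3.1(i)(a): given a family of adjunctions `q i ⊣ t i` and a cotorsion pair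
`(F, G)` in `C` such that every object of `F` is `q i`-flat and each `t i` preserves
short exact sequences ending at objects `q i F₀` with `F₀ ∈ F`, an object `Y` of `D`
satisfies `Ext¹ (q i F₀) Y = 0` for all `i` and `F₀ ∈ F` iff `t i Y ∈ G` for all `i`. -/
theorem statement10 {I : Type i'} {C : Type u} {D : Type u'}
    [Category.{v} C] [Category.{v'} D] [Abelian C] [Abelian D]
    [HasExt.{w} C] [HasExt.{w} D]
    (q : I → (C ⥤ D)) (t : I → (D ⥤ C)) (adj : ∀ i, q i ⊣ t i)
    (F G : Set C) (hFG : IsCotorsionPair F G)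
    (hflat : ∀ i, ∀ F₀ ∈ F, QFlat (q i) F₀)
    (ht : ∀ i, ∀ F₀ ∈ F, ∀ ⦃Y B : D⦄ (f : Y ⟶ B) (g : B ⟶ (q i).obj F₀) (w : f ≫ g = 0),
      (ShortComplex.mk f g w).ShortExact → MapsToShortExact (t i) f g)
    (Y : D) :
    (∀ i, ∀ F₀ ∈ F, ∀ x : Abelian.Ext ((q i).obj F₀) Y 1, x = 0) ↔
      (∀ i, (t i).obj Y ∈ G) := by
  simp only [hFG.1]
  exact ⟨fun h i F₀ hF₀ => ext_rightAdjoint_eq_zero (adj i) (hflat i F₀ hF₀) (h i F₀ hF₀),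
    fun h i F₀ hF₀ => ext_leftAdjoint_eq_zero (adj i) (fun _ f g w => ht i F₀ hF₀ f g w)
      (h i F₀ hF₀)⟩
end

section
/- Let {(q_i, t_i)}_{i ∈ I} be a family of adjunctions with q_i : C ⥤ D left adjoint to t_i : D ⥤ C, where C and D are abelian categories, and let (F, G) be a cotorsion pair in C. Assume that for every i ∈ I every object of F is q_i-flat, and that F is generating in C (every object of C admits an epimorphism from some object of F). Then for every object Y of D: (for all i ∈ I and all F₀ ∈ F, Ext¹_D(q_i(F₀), Y) = 0) if and only if (for all i ∈ I, t_i(Y) ∈ G and Y is t_i-coflat). -/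
open CategoryTheory Limits

universe w v u v' u' i'

section ExtOne

open Abelian DerivedCategory Pretriangulated

variable {A : Type u} [Category.{v} A] [Abelian A]

/-- In a distinguished triangle of the derived category whose vertices come from objects of the
abelian category, the first morphism comes from a monomorphism. -/
lemma mono_of_distinguished_singleFunctor [HasDerivedCategory.{w} A] {P Z X : A} (f : P ⟶ Z)
    {g : (singleFunctor A 0).obj Z ⟶ (singleFunctor A 0).obj X}
    {h : (singleFunctor A 0).obj X ⟶ ((singleFunctor A 0).obj P)⟦(1 : ℤ)⟧}
    (hT : Triangle.mk ((singleFunctor A 0).map f) g h ∈ distTriang (DerivedCategory A)) :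
    Mono f := by
  refine Preadditive.mono_of_cancel_zero _ fun {W} a ha ↦ (singleFunctor A 0).map_injective ?_
  have ha' : (singleFunctor A 0).map a ≫ (singleFunctor A 0).map f = 0 := by
    rw [← Functor.map_comp, ha, Functor.map_zero]
  obtain ⟨b, hb⟩ := Triangle.coyoneda_exact₂ _ (inv_rot_of_distTriang _ hT)
    ((singleFunctor A 0).map a) ha'
  have : (Triangle.mk ((singleFunctor A 0).map f) g h).invRotate.obj₁.IsGE 1 :=
    TStructure.t.isGE_shift ((singleFunctor A 0).obj X) 0 (-1) 1 (by lia)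
  have hb₀ : b = 0 := TStructure.t.zero b 0 1 (by lia)
  rw [hb, hb₀, Functor.map_zero]
  exact zero_comp

/-- In a distinguished triangle of the derived category whose vertices come from objects of the
abelian category, the second morphism comes from an epimorphism. -/
lemma epi_of_distinguished_singleFunctor [HasDerivedCategory.{w} A] {P Z X : A} (g : Z ⟶ X)
    {f : (singleFunctor A 0).obj P ⟶ (singleFunctor A 0).obj Z}
    {h : (singleFunctor A 0).obj X ⟶ ((singleFunctor A 0).obj P)⟦(1 : ℤ)⟧}
    (hT : Triangle.mk f ((singleFunctor A 0).map g) h ∈ distTriang (DerivedCategory A)) :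
    Epi g := by
  refine Preadditive.epi_of_cancel_zero _ fun {W} a ha ↦ (singleFunctor A 0).map_injective ?_
  have ha' : (singleFunctor A 0).map g ≫ (singleFunctor A 0).map a = 0 := by
    rw [← Functor.map_comp, ha, Functor.map_zero]
  obtain ⟨b, hb⟩ := Triangle.yoneda_exact₃ _ hT ((singleFunctor A 0).map a) ha'
  have : ((Triangle.mk f ((singleFunctor A 0).map g) h).obj₁⟦(1 : ℤ)⟧).IsLE (-1) :=
    TStructure.t.isLE_shift ((singleFunctor A 0).obj P) 0 1 (-1) (by lia)
  have hb₀ : b = 0 := TStructure.t.zero b (-1) 0 (by lia)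
  rw [hb, hb₀, Functor.map_zero]
  exact comp_zero

variable [HasExt.{w} A]

/-- Every class in `Ext¹` is killed by some monomorphism out of the second argument and by some
epimorphism onto the first one. -/
lemma exists_mono_epi_comp_eq_zero {X P : A} (x : Ext X P 1) :
    ∃ (Z : A) (f : P ⟶ Z) (g : Z ⟶ X), Mono f ∧ Epi g ∧
      x.comp (Ext.mk₀ f) (add_zero 1) = 0 ∧ (Ext.mk₀ g).comp x (zero_add 1) = 0 := by
  let := HasDerivedCategory.standard A
  let h : (singleFunctor A 0).obj X ⟶ ((singleFunctor A 0).obj P)⟦(1 : ℤ)⟧ := x.hom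
  obtain ⟨M, f, g, hT⟩ := distinguished_cocone_triangle₂ h
  have hGE : M.IsGE 0 := TStructure.t.isGE₂ _ hT 0
    (inferInstanceAs (((singleFunctor A 0).obj P).IsGE 0))
    (inferInstanceAs (((singleFunctor A 0).obj X).IsGE 0))
  have hLE : M.IsLE 0 := TStructure.t.isLE₂ _ hT 0
    (inferInstanceAs (((singleFunctor A 0).obj P).IsLE 0))
    (inferInstanceAs (((singleFunctor A 0).obj X).IsLE 0))
  obtain ⟨Z, ⟨e⟩⟩ := M.exists_iso_singleFunctor_obj_of_isGE_of_isLE 0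
  obtain ⟨f', hf'⟩ := (singleFunctor A 0).map_surjective (f ≫ e.hom)
  obtain ⟨g', hg'⟩ := (singleFunctor A 0).map_surjective (e.inv ≫ g)
  have h₁ : (singleFunctor A 0).map f' ≫ e.inv = 𝟙 ((singleFunctor A 0).obj P) ≫ f := by
    simp [hf']
  have h₂ : (singleFunctor A 0).map g' ≫ 𝟙 ((singleFunctor A 0).obj X) = e.inv ≫ g := by
    simp [hg']
  have h₃ : h ≫ (𝟙 ((singleFunctor A 0).obj P))⟦(1 : ℤ)⟧' =
      𝟙 ((singleFunctor A 0).obj X) ≫ h := by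
    simp
  have hTZ : Triangle.mk ((singleFunctor A 0).map f') ((singleFunctor A 0).map g') h ∈
      distTriang (DerivedCategory A) :=
    isomorphic_distinguished _ hT _ (Triangle.isoMk _ _ (Iso.refl _) e.symm (Iso.refl _) h₁ h₂ h₃)
  refine ⟨Z, f', g', mono_of_distinguished_singleFunctor f' hTZ,
    epi_of_distinguished_singleFunctor g' hTZ, ?_, ?_⟩
  · ext
    rw [Ext.comp_hom, Ext.mk₀_hom, ShiftedHom.comp_mk₀, Ext.zero_hom]
    exact comp_distTriang_mor_zero₃₁ _ hTZ
  · ext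
    rw [Ext.comp_hom, Ext.mk₀_hom, ShiftedHom.mk₀_comp, Ext.zero_hom]
    exact comp_distTriang_mor_zero₂₃ _ hTZ

/-- If `Ext¹(S.X₃, P)` vanishes, morphisms `S.X₁ ⟶ P` extend along `S.f`. -/
lemma CategoryTheory.ShortComplex.ShortExact.exists_extension {S : ShortComplex A}
    (hS : S.ShortExact) {P : A} (hP : ∀ x : Ext S.X₃ P 1, x = 0) (a : S.X₁ ⟶ P) :
    ∃ b : S.X₂ ⟶ P, S.f ≫ b = a := by
  obtain ⟨y, hy⟩ := Ext.contravariant_sequence_exact₁ hS P (Ext.mk₀ a) (add_zero 1) (hP _)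
  obtain ⟨b, rfl⟩ := (Ext.mk₀_bijective _ _).2 y
  exact ⟨b, (Ext.mk₀_bijective _ _).1 (by rw [← hy, Ext.mk₀_comp_mk₀])⟩

/-- If `Ext¹(P, S.X₁)` vanishes, morphisms `P ⟶ S.X₃` lift along `S.g`. -/
lemma CategoryTheory.ShortComplex.ShortExact.exists_lift {S : ShortComplex A}
    (hS : S.ShortExact) {P : A} (hP : ∀ x : Ext P S.X₁ 1, x = 0) (a : P ⟶ S.X₃) :
    ∃ b : P ⟶ S.X₂, b ≫ S.g = a := by
  obtain ⟨y, hy⟩ := Ext.covariant_sequence_exact₃ P hS (Ext.mk₀ a) (zero_add 1) (hP _)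
  obtain ⟨b, rfl⟩ := (Ext.mk₀_bijective _ _).2 y
  exact ⟨b, (Ext.mk₀_bijective _ _).1 (by rw [← hy, Ext.mk₀_comp_mk₀])⟩

/-- `Ext¹(X, P)` vanishes as soon as every morphism from `X` lifts along the epimorphism of every
short exact sequence starting at `P`. -/
lemma ext_one_eq_zero_of_exists_lift {X P : A}
    (hX : ∀ ⦃B E : A⦄ (f : P ⟶ B) (g : B ⟶ E) (w : f ≫ g = 0),
      (ShortComplex.mk f g w).ShortExact → ∀ a : X ⟶ E, ∃ b : X ⟶ B, b ≫ g = a)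
    (x : Ext X P 1) : x = 0 := by
  obtain ⟨Z, f, -, _, -, hf, -⟩ := exists_mono_epi_comp_eq_zero x
  have hS : (ShortComplex.mk f (cokernel.π f) (cokernel.condition f)).ShortExact :=
    { exact := ShortComplex.exact_cokernel f }
  obtain ⟨y, hy⟩ := Ext.covariant_sequence_exact₁ X hS x hf (zero_add 1)
  obtain ⟨a, rfl⟩ := (Ext.mk₀_bijective _ _).2 y
  obtain ⟨b, rfl⟩ := hX f (cokernel.π f) (cokernel.condition f) hS a
  rw [← hy, ← Ext.mk₀_comp_mk₀, Ext.comp_assoc_of_second_deg_zero]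
  exact (congrArg (fun z ↦ (Ext.mk₀ b).comp z (zero_add 1)) hS.comp_extClass).trans
    (Ext.comp_zero ..)

/-- `Ext¹(X, P)` vanishes as soon as every morphism to `P` extends along the monomorphism of every
short exact sequence ending at `X`. -/
lemma ext_one_eq_zero_of_exists_extension {X P : A}
    (hP : ∀ ⦃K B : A⦄ (f : K ⟶ B) (g : B ⟶ X) (w : f ≫ g = 0),
      (ShortComplex.mk f g w).ShortExact → ∀ a : K ⟶ P, ∃ b : B ⟶ P, f ≫ b = a)
    (x : Ext X P 1) : x = 0 := by
  obtain ⟨Z, -, g, -, _, -, hg⟩ := exists_mono_epi_comp_eq_zero x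
  have hS : (ShortComplex.mk (kernel.ι g) g (kernel.condition g)).ShortExact :=
    { exact := ShortComplex.exact_kernel g }
  obtain ⟨y, hy⟩ := Ext.contravariant_sequence_exact₃ hS P x hg (add_zero 1)
  obtain ⟨a, rfl⟩ := (Ext.mk₀_bijective _ _).2 y
  obtain ⟨b, rfl⟩ := hP (kernel.ι g) g (kernel.condition g) hS a
  rw [← hy, ← Ext.mk₀_comp_mk₀]
  exact hS.extClass_comp_assoc _

end ExtOne

section Adjunction

open Abelian

variable {C : Type u} {D : Type u'} [Category.{v} C] [Category.{v'} D] [Abelian C] [Abelian D]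
  {q : C ⥤ D} {t : D ⥤ C}

/-- A right adjoint maps a short exact sequence to a short exact sequence as soon as it preserves
the epimorphism. -/
lemma CategoryTheory.Adjunction.mapsToShortExact_right (adj : q ⊣ t) {S : ShortComplex D}
    (hS : S.ShortExact) (hg : Epi (t.map S.g)) : MapsToShortExact t S.f S.g := by
  have := adj.isRightAdjoint
  have := Adjunction.rightAdjoint_preservesLimits.{0, 0} adj
  have := t.preservesZeroMorphisms_of_isRightAdjoint
  have := hS.mono_f
  exact ⟨(S.map t).zero, { exact := hS.exact.map_of_mono_of_preservesKernel t ‹_› inferInstance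
                           mono_f := inferInstanceAs (Mono (t.map S.f))
                           epi_g := hg }⟩

/-- If `Ext¹(q F₀, Y)` vanishes for all `F₀` in a generating class, then `Y` is `t`-coflat. -/
lemma CategoryTheory.Adjunction.tCoflat_of_ext_one_eq_zero [HasExt.{w} D] (adj : q ⊣ t) {F : Set C}
    (hgen : ∀ X : C, ∃ F₀ ∈ F, ∃ π : F₀ ⟶ X, Epi π) {Y : D}
    (hY : ∀ F₀ ∈ F, ∀ x : Ext (q.obj F₀) Y 1, x = 0) : TCoflat t Y := by
  intro B E f g w hS
  refine adj.mapsToShortExact_right hS ?_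
  obtain ⟨F₀, hF₀, π, _⟩ := hgen (t.obj E)
  obtain ⟨b, hb⟩ := hS.exists_lift (hY F₀ hF₀) ((adj.homEquiv _ _).symm π)
  refine epi_of_epi_fac (f := adj.homEquiv _ _ b) (h := π) ?_
  rw [← adj.homEquiv_naturality_right]
  exact (congrArg _ hb).trans (Equiv.apply_symm_apply ..)

/-- If `X` is `q`-flat and `Ext¹(q X, Y)` vanishes, then `Ext¹(X, t Y)` vanishes. -/
lemma CategoryTheory.Adjunction.ext_one_right_eq_zero [HasExt.{w} C] [HasExt.{w} D]
    (adj : q ⊣ t) {X : C} {Y : D} (hX : QFlat q X) (hY : ∀ x : Ext (q.obj X) Y 1, x = 0)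
    (x : Ext X (t.obj Y) 1) : x = 0 := by
  refine ext_one_eq_zero_of_exists_extension (fun K B f g w hS a ↦ ?_) x
  obtain ⟨w', hS'⟩ := hX f g w hS
  obtain ⟨b, hb⟩ := hS'.exists_extension hY ((adj.homEquiv _ _).symm a)
  refine ⟨adj.homEquiv _ _ b, ?_⟩
  rw [← adj.homEquiv_naturality_left]
  exact (congrArg _ hb).trans (Equiv.apply_symm_apply ..)

/-- If `Y` is `t`-coflat and `Ext¹(X, t Y)` vanishes, then `Ext¹(q X, Y)` vanishes. -/
lemma CategoryTheory.Adjunction.ext_one_left_eq_zero [HasExt.{w} C] [HasExt.{w} D]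
    (adj : q ⊣ t) {X : C} {Y : D} (hY : TCoflat t Y) (hX : ∀ x : Ext X (t.obj Y) 1, x = 0)
    (x : Ext (q.obj X) Y 1) : x = 0 := by
  refine ext_one_eq_zero_of_exists_lift (fun B E f g w hS a ↦ ?_) x
  obtain ⟨w', hS'⟩ := hY f g w hS
  obtain ⟨b, hb⟩ := hS'.exists_lift hX (adj.homEquiv _ _ a)
  refine ⟨(adj.homEquiv _ _).symm b, ?_⟩
  rw [← adj.homEquiv_naturality_right_symm]
  exact (congrArg _ hb).trans (Equiv.symm_apply_apply ..)

end Adjunction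

/-- Theorem 3.1(i)(b): given a family of adjunctions `q i ⊣ t i` and a cotorsion pair
`(F, G)` in `C` such that every object of `F` is `q i`-flat and `F` is generating, an
object `Y` of `D` satisfies `Ext¹ (q i F₀) Y = 0` for all `i` and `F₀ ∈ F` iff for all
`i`, `t i Y ∈ G` and `Y` is `t i`-coflat. -/
theorem statement11 {I : Type i'} {C : Type u} {D : Type u'}
    [Category.{v} C] [Category.{v'} D] [Abelian C] [Abelian D]
    [HasExt.{w} C] [HasExt.{w} D]
    (q : I → (C ⥤ D)) (t : I → (D ⥤ C)) (adj : ∀ i, q i ⊣ t i)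
    (F G : Set C) (hFG : IsCotorsionPair F G)
    (hflat : ∀ i, ∀ F₀ ∈ F, QFlat (q i) F₀)
    (hgen : ∀ X : C, ∃ F₀ ∈ F, ∃ π : F₀ ⟶ X, Epi π)
    (Y : D) :
    (∀ i, ∀ F₀ ∈ F, ∀ x : Abelian.Ext ((q i).obj F₀) Y 1, x = 0) ↔
      (∀ i, (t i).obj Y ∈ G ∧ TCoflat (t i) Y) := by
  constructor
  · exact fun h i ↦ ⟨(hFG.1 _).2 fun F₀ hF₀ ↦
      (adj i).ext_one_right_eq_zero (hflat i F₀ hF₀) (h i F₀ hF₀),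
      (adj i).tCoflat_of_ext_one_eq_zero hgen (h i)⟩
  · exact fun h i F₀ hF₀ ↦
      (adj i).ext_one_left_eq_zero (h i).2 ((hFG.1 _).1 (h i).1 F₀ hF₀)
end

section
/- Let {(q_i, t_i)}_{i ∈ I} be a family of adjunctions with q_i : C ⥤ D left adjoint to t_i : D ⥤ C, where C and D are abelian categories, and let (F', G') be a cotorsion pair in D. Assume that for every i ∈ I every object of G' is t_i-coflat, and that G' is cogenerating in D (every object of D admits a monomorphism into some object of G'). Then for every object X of C: (for all i ∈ I and all G₀ ∈ G', Ext¹_C(X, t_i(G₀)) = 0) if and only if (for all i ∈ I, q_i(X) ∈ F' and X is q_i-flat). -/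
open CategoryTheory Limits

universe w v u v' u' i'

namespace HomologicalComplex

/-- A quasi-isomorphism to an object placed in a single degree is, up to precomposition, induced by
an epimorphism. -/
lemma exists_epi_single_map_eq_comp {C : Type u} [Category.{v} C] [Abelian C]
    {ι : Type*} [DecidableEq ι] {c : ComplexShape ι} {i : ι} {K : HomologicalComplex C c} {X : C}
    (s : K ⟶ (single C c i).obj X) [QuasiIso s] :
    ∃ (P : C) (p : P ⟶ X) (_ : Epi p) (j : (single C c i).obj P ⟶ K),
      j ≫ s = (single C c i).map p := by
  let p : K.cycles i ⟶ X := cyclesMap s i ≫ (singleObjCyclesSelfIso c i X).hom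
  have hp : p = K.homologyπ i ≫ homologyMap s i ≫ (singleObjHomologySelfIso c i X).hom := by
    rw [homologyπ_naturality_assoc, homologyπ_singleObjHomologySelfIso_hom]
  have hepi : Epi p := by
    rw [hp]
    infer_instance
  refine ⟨K.cycles i, p, hepi, mkHomFromSingle (K.iCycles i) (by simp), ?_⟩
  apply from_single_hom_ext
  simp [p, single_map_f_self, singleObjCyclesSelfIso_hom]

end HomologicalComplex

namespace CategoryTheory

open Abelian _root_.DerivedCategory

/-- Every class in `Ext¹` is effaced by an epimorphism onto the source. -/
lemma Abelian.Ext.exists_epi_mk₀_comp_eq_zero_s12 {C : Type u} [Category.{v} C] [Abelian C]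
    [HasExt.{w} C] {X Y : C} (x : Ext X Y 1) :
    ∃ (P : C) (p : P ⟶ X) (_ : Epi p), (Ext.mk₀ p).comp x (zero_add 1) = 0 := by
  let := HasDerivedCategory.standard C
  let SX := (CochainComplex.singleFunctor C 0).obj X
  let SY := (CochainComplex.singleFunctor C 0).obj Y
  let e : Q.obj (SY⟦(1 : ℤ)⟧) ≅ (Q.obj SY)⟦(1 : ℤ)⟧ := (Q.commShiftIso (1 : ℤ)).app SY
  let φ : Q.obj SX ⟶ (Q.obj SY)⟦(1 : ℤ)⟧ := x.hom
  obtain ⟨K, s, hs, g, hg⟩ := right_fac (φ ≫ e.inv)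
  have hsq : QuasiIso s := (isIso_Q_map_iff_quasiIso C s).1 hs
  obtain ⟨P, p, hp, j, hjs⟩ : ∃ (P : C) (p : P ⟶ X) (_ : Epi p)
      (j : (CochainComplex.singleFunctor C 0).obj P ⟶ K),
      j ≫ s = (CochainComplex.singleFunctor C 0).map p :=
    @HomologicalComplex.exists_epi_single_map_eq_comp _ _ _ _ _ _ _ _ X s hsq
  refine ⟨P, p, hp, ?_⟩
  have hjg : j ≫ g = 0 := by
    apply HomologicalComplex.from_single_hom_ext
    apply IsZero.eq_of_tgt
    exact HomologicalComplex.isZero_single_obj_X (ComplexShape.up ℤ) 0 Y (0 + 1) (by simp)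
  have key : Q.map ((CochainComplex.singleFunctor C 0).map p) ≫ φ = 0 := by
    rw [← cancel_mono e.inv, Category.assoc, hg, ← hjs]
    erw [Q.map_comp]
    rw [Category.assoc, IsIso.hom_inv_id_assoc, ← Q.map_comp, hjg, Q.map_zero, Limits.zero_comp]
  ext
  rw [Ext.comp_hom, Ext.mk₀_hom, ShiftedHom.mk₀_comp, Ext.zero_hom]
  exact key

/-- The pushout of a short exact sequence along a morphism out of its left term. -/
lemma ShortComplex.ShortExact.shortExact_pushout {C : Type u} [Category.{v} C] [Abelian C]
    {S : ShortComplex C} (hS : S.ShortExact) {Y : C} (u : S.X₁ ⟶ Y) :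
    (ShortComplex.mk (pushout.inr S.f u) (pushout.desc S.g 0 (by simp))
      (pushout.inr_desc _ _ _)).ShortExact := by
  have := hS.mono_f
  have := hS.epi_g
  have hinl : pushout.inl S.f u ≫ pushout.desc S.g (0 : Y ⟶ S.X₃) (by simp) = S.g :=
    pushout.inl_desc _ _ _
  have hepi : Epi (pushout.desc S.g (0 : Y ⟶ S.X₃) (by simp : S.f ≫ S.g = u ≫ 0)) :=
    epi_of_epi_fac hinl
  refine ShortComplex.ShortExact.mk' (ShortComplex.exact_of_g_is_cokernel _ ?_)
    inferInstance hepi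
  have hcond {T : C} (k : pushout S.f u ⟶ T) (hk : pushout.inr S.f u ≫ k = 0) :
      S.f ≫ pushout.inl S.f u ≫ k = 0 := by
    rw [pushout.condition_assoc, hk, comp_zero]
  refine CokernelCofork.IsColimit.ofπ _ _
    (fun k hk => hS.gIsCokernel.desc (CokernelCofork.ofπ (pushout.inl S.f u ≫ k) (hcond k hk)))
    (fun k hk => ?_) (fun k hk m hm => ?_)
  · apply pushout.hom_ext
    · exact ((reassoc_of% hinl) _).trans (hS.gIsCokernel.fac _ WalkingParallelPair.one)
    · exact (pushout.inr_desc_assoc _ _ _ _).trans (zero_comp.trans hk.symm)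
  · apply (cancel_epi S.g).1
    refine Eq.trans ?_ (hS.gIsCokernel.fac
      (CokernelCofork.ofπ (pushout.inl S.f u ≫ k) (hcond k hk)) WalkingParallelPair.one).symm
    exact ((reassoc_of% hinl) m).symm.trans (congrArg (pushout.inl S.f u ≫ ·) hm)

/-- Every class in `Ext¹` is the class of a short exact sequence. -/
lemma Abelian.Ext.exists_extClass_eq {C : Type u} [Category.{v} C] [Abelian C]
    [HasExt.{w} C] {X Y : C} (x : Ext X Y 1) :
    ∃ (E : C) (f : Y ⟶ E) (g : E ⟶ X) (zero : f ≫ g = 0)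
      (h : (ShortComplex.mk f g zero).ShortExact), h.extClass = x := by
  obtain ⟨P, p, _, hp⟩ := x.exists_epi_mk₀_comp_eq_zero_s12
  have hS : (ShortComplex.mk (kernel.ι p) p (kernel.condition p)).ShortExact :=
    .mk' (ShortComplex.exact_of_f_is_kernel _ (kernelIsKernel p)) inferInstance inferInstance
  obtain ⟨u₀, hu₀⟩ := Ext.contravariant_sequence_exact₃ hS Y x hp (add_zero 1)
  obtain ⟨u, rfl⟩ := (Ext.mk₀_bijective _ _).2 u₀
  refine ⟨_, _, _, _, hS.shortExact_pushout u, ?_⟩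
  rw [← hu₀]
  have := ShortComplex.ShortExact.extClass_naturality hS (hS.shortExact_pushout u)
    { τ₁ := u
      τ₂ := pushout.inl _ _
      τ₃ := 𝟙 _
      comm₁₂ := pushout.condition.symm
      comm₂₃ := (pushout.inl_desc _ _ _).trans (Category.comp_id _).symm }
  rw [this]
  exact (Ext.mk₀_id_comp _).symm

namespace ShortComplex.ShortExact

variable {C : Type u} [Category.{v} C] [Abelian C] [HasExt.{w} C]
  {S : ShortComplex C} (hS : S.ShortExact)

include hS

lemma exists_f_comp_eq {Y : C} (h : ∀ x : Ext S.X₃ Y 1, x = 0) (u : S.X₁ ⟶ Y) :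
    ∃ k : S.X₂ ⟶ Y, S.f ≫ k = u := by
  obtain ⟨k₀, hk₀⟩ := Ext.contravariant_sequence_exact₁ hS Y (Ext.mk₀ u) (add_zero 1) (h _)
  obtain ⟨k, rfl⟩ := (Ext.mk₀_bijective _ _).2 k₀
  exact ⟨k, (Ext.mk₀_bijective _ _).1 (by rw [← hk₀, Ext.mk₀_comp_mk₀])⟩

lemma exists_comp_g_eq {X : C} (h : ∀ x : Ext X S.X₁ 1, x = 0) (v : X ⟶ S.X₃) :
    ∃ k : X ⟶ S.X₂, k ≫ S.g = v := by
  obtain ⟨k₀, hk₀⟩ := Ext.covariant_sequence_exact₃ X hS (Ext.mk₀ v) (zero_add 1) (h _)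
  obtain ⟨k, rfl⟩ := (Ext.mk₀_bijective _ _).2 k₀
  exact ⟨k, (Ext.mk₀_bijective _ _).1 (by rw [← hk₀, Ext.mk₀_comp_mk₀])⟩

lemma extClass_eq_zero_of_retraction (r : S.X₂ ⟶ S.X₁) (hr : S.f ≫ r = 𝟙 _) :
    hS.extClass = 0 := by
  rw [← hS.extClass.comp_mk₀_id, ← hr, ← Ext.mk₀_comp_mk₀, extClass_comp_assoc]

lemma extClass_eq_zero_of_section (s : S.X₃ ⟶ S.X₂) (hs : s ≫ S.g = 𝟙 _) :
    hS.extClass = 0 := by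
  rw [← hS.extClass.mk₀_id_comp, ← hs, ← Ext.mk₀_comp_mk₀_assoc, comp_extClass, Ext.comp_zero]

end ShortComplex.ShortExact

end CategoryTheory

/-- A left adjoint preserves a short exact sequence as soon as it preserves its monomorphism. -/
lemma mapsToShortExact_of_adjunction {C : Type u} {D : Type u'} [Category.{v} C]
    [Category.{v'} D] [Abelian C] [Abelian D] {q : C ⥤ D} {t : D ⥤ C} (adj : q ⊣ t)
    {A B X : C} {f : A ⟶ B} {g : B ⟶ X} {w : f ≫ g = 0}
    (h : (ShortComplex.mk f g w).ShortExact) (hf : Mono (q.map f)) :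
    MapsToShortExact q f g := by
  have := adj.isLeftAdjoint
  have : PreservesColimitsOfSize.{0, 0} q := adj.leftAdjoint_preservesColimits
  have : Epi g := h.epi_g
  refine ⟨by rw [← q.map_comp, w, q.map_zero], .mk' ?_ hf (q.map_epi g)⟩
  exact h.exact.map_of_epi_of_preservesCokernel q h.epi_g inferInstance

/-- Theorem 3.1(ii)(b): given a family of adjunctions `q i ⊣ t i` and a cotorsion pair
`(F', G')` in `D` such that every object of `G'` is `t i`-coflat and `G'` is cogenerating,
an object `X` of `C` satisfies `Ext¹ X (t i G₀) = 0` for all `i` and `G₀ ∈ G'` iff for all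
`i`, `q i X ∈ F'` and `X` is `q i`-flat. -/
theorem statement12 {I : Type i'} {C : Type u} {D : Type u'}
    [Category.{v} C] [Category.{v'} D] [Abelian C] [Abelian D]
    [HasExt.{w} C] [HasExt.{w} D]
    (q : I → (C ⥤ D)) (t : I → (D ⥤ C)) (adj : ∀ i, q i ⊣ t i)
    (F' G' : Set D) (hFG : IsCotorsionPair F' G')
    (hcoflat : ∀ i, ∀ G₀ ∈ G', TCoflat (t i) G₀)
    (hcogen : ∀ Y : D, ∃ G₀ ∈ G', ∃ ι : Y ⟶ G₀, Mono ι)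
    (X : C) :
    (∀ i, ∀ G₀ ∈ G', ∀ x : Abelian.Ext X ((t i).obj G₀) 1, x = 0) ↔
      (∀ i, (q i).obj X ∈ F' ∧ QFlat (q i) X) := by
  constructor
  · intro h i
    constructor
    · rw [hFG.2]
      intro G₀ hG₀ x
      obtain ⟨E, f, g, zero, hS, rfl⟩ := x.exists_extClass_eq
      obtain ⟨_, hT⟩ := hcoflat i G₀ hG₀ f g zero hS
      obtain ⟨k, hk⟩ := hT.exists_comp_g_eq (h i G₀ hG₀) ((adj i).unit.app X)
      refine hS.extClass_eq_zero_of_section (((adj i).homEquiv _ _).symm k) ?_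
      apply ((adj i).homEquiv _ _).injective
      rw [(adj i).homEquiv_naturality_right, Equiv.apply_symm_apply, (adj i).homEquiv_id]
      exact hk
    · intro A B f g zero hS
      refine mapsToShortExact_of_adjunction (adj i) hS ?_
      obtain ⟨G₀, hG₀, ι, _⟩ := hcogen ((q i).obj A)
      obtain ⟨k, hk⟩ := hS.exists_f_comp_eq (h i G₀ hG₀) ((adj i).homEquiv _ _ ι)
      have fac : (q i).map f ≫ ((adj i).homEquiv _ _).symm k = ι := by
        rw [← (adj i).homEquiv_naturality_left_symm, Equiv.symm_apply_eq]
        exact hk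
      exact mono_of_mono_fac fac
  · intro h i G₀ hG₀ x
    obtain ⟨B, f, g, zero, hS, rfl⟩ := x.exists_extClass_eq
    obtain ⟨_, hT⟩ := (h i).2 f g zero hS
    obtain ⟨k, hk⟩ := hT.exists_f_comp_eq ((hFG.2 _).1 (h i).1 G₀ hG₀) ((adj i).counit.app G₀)
    refine hS.extClass_eq_zero_of_retraction ((adj i).homEquiv _ _ k) ?_
    apply ((adj i).homEquiv _ _).symm.injective
    rw [(adj i).homEquiv_naturality_left_symm, Equiv.symm_apply_apply, (adj i).homEquiv_symm_id]
    exact hk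
end

section
/- Let A be an abelian category, X a chain complex in Ch(A) and i ∈ ℤ. Then the following are equivalent: (a) for every short exact sequence 0 → X → Y → W → 0 in Ch(A), the induced sequence of i-cycles 0 → Z_i(X) → Z_i(Y) → Z_i(W) → 0 is a short exact sequence in A; (b) the canonical sequence 0 → Z_i(X) → X_i → Z_{i−1}(X) → 0 (whose first map is the inclusion of the i-cycles and whose second map is the corestriction of d_i to the (i−1)-cycles) is a short exact sequence in A, i.e. the canonical map X_i → Z_{i−1}(X) is an epimorphism. -/
open CategoryTheory Limits HomologicalComplex

universe v u

namespace HomologicalComplex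

variable {C ι : Type*} [Category* C] [Abelian C] {c : ComplexShape ι}

lemma shortExact_iCycles_toCycles (K : HomologicalComplex C c) {i j : ι} (hij : c.Rel i j)
    (w : K.iCycles i ≫ K.toCycles i j = 0) [Epi (K.toCycles i j)] :
    (ShortComplex.mk (K.iCycles i) (K.toCycles i j) w).ShortExact where
  exact := by
    rw [ShortComplex.exact_iff_exact_up_to_refinements]
    intro T x hx
    dsimp only at x hx ⊢
    have hxd : x ≫ K.d i j = 0 := by rw [← K.toCycles_i, reassoc_of% hx, zero_comp]
    exact ⟨T, 𝟙 T, inferInstance, K.liftCycles' x j hij hxd, by simp⟩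

lemma epi_cyclesMap_of_epi_toCycles {S : ShortComplex (HomologicalComplex C c)}
    (hS : S.ShortExact) {i j : ι} (hij : c.Rel i j) [Epi (S.X₁.toCycles i j)] :
    Epi (cyclesMap S.g i) := by
  have := hS.mono_f
  have := hS.epi_g
  rw [epi_iff_surjective_up_to_refinements]
  intro T z
  obtain ⟨T₁, π₁, _, y, hy⟩ :=
    surjective_up_to_refinements_of_epi (S.g.f i) (z ≫ S.X₃.iCycles i)
  have hdy : (y ≫ S.X₂.d i j) ≫ S.g.f j = 0 := by
    rw [Category.assoc, ← S.g.comm, ← reassoc_of% hy]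
    simp
  obtain ⟨T₂, π₂, _, x', hx'⟩ :=
    (cycles_left_exact S hS.exact j).exact_up_to_refinements
      (S.X₂.liftCycles (y ≫ S.X₂.d i j) _ rfl (by simp)) (by
        rw [← cancel_mono (S.X₃.iCycles j)]
        simpa using hdy)
  obtain ⟨T₃, π₃, _, x, hx⟩ := surjective_up_to_refinements_of_epi (S.X₁.toCycles i j) x'
  have hdx : π₃ ≫ π₂ ≫ y ≫ S.X₂.d i j = x ≫ S.f.f i ≫ S.X₂.d i j := by
    have h₁ := hx' =≫ S.X₂.iCycles j
    have h₂ := hx =≫ S.X₁.iCycles j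
    simp only [Category.assoc, liftCycles_i, cyclesMap_i, toCycles_i] at h₁ h₂
    rw [h₁, reassoc_of% h₂, S.f.comm]
  refine ⟨T₃, π₃ ≫ π₂ ≫ π₁, inferInstance,
    S.X₂.liftCycles' (π₃ ≫ π₂ ≫ y - x ≫ S.f.f i) j hij (by simp [hdx]), ?_⟩
  have hfg : S.f.f i ≫ S.g.f i = 0 := by rw [← comp_f, S.zero, zero_f]
  rw [← cancel_mono (S.X₃.iCycles i)]
  simp [hy, hfg]

lemma mono_homotopyCofiber_inr [DecidableRel c.Rel] {F G : HomologicalComplex C c}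
    (φ : F ⟶ G) : Mono (homotopyCofiber.inr φ) := by
  have (i : ι) : Mono ((homotopyCofiber.inr φ).f i) :=
    mono_of_mono_fac (homotopyCofiber.inrX_sndX φ i)
  exact mono_of_mono_f _ this

/-- The cokernel of `K ⟶ homotopyCofiber (𝟙 K)` is a shift of `K`, and a cycle of this shift
lifts to a cycle of the contractible complex `homotopyCofiber (𝟙 K)` only if it is a boundary. -/
lemma epi_toCycles_of_epi_cyclesMap [DecidableRel c.Rel] (K : HomologicalComplex C c)
    {W : HomologicalComplex C c} {g : homotopyCofiber (𝟙 K) ⟶ W}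
    {w : homotopyCofiber.inr (𝟙 K) ≫ g = 0} (hS : (ShortComplex.mk _ g w).ShortExact)
    {i j k : ι} (hij : c.Rel i j) (hjk : c.Rel j k) [Epi (cyclesMap g i)] :
    Epi (K.toCycles i j) := by
  have := mono_homotopyCofiber_inr (𝟙 K)
  let s : K.cycles j ⟶ (homotopyCofiber (𝟙 K)).X i :=
    K.iCycles j ≫ homotopyCofiber.inlX (𝟙 K) j i hij
  have hs : s ≫ (homotopyCofiber (𝟙 K)).d i j =
      K.iCycles j ≫ (homotopyCofiber.inr (𝟙 K)).f j := by
    simp [s, homotopyCofiber.inlX_d _ i j k hij hjk]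
  have hw (l : ι) : (homotopyCofiber.inr (𝟙 K)).f l ≫ g.f l = 0 := by
    rw [← comp_f, w, zero_f]
  rw [epi_iff_surjective_up_to_refinements]
  intro T z
  obtain ⟨T₁, π₁, _, y, hy⟩ := surjective_up_to_refinements_of_epi (cyclesMap g i)
    (z ≫ W.liftCycles' (s ≫ g.f i) j hij (by
      rw [Category.assoc, g.comm, reassoc_of% hs, hw, comp_zero]))
  replace hy := hy =≫ W.iCycles i
  simp only [Category.assoc, liftCycles_i, cyclesMap_i] at hy
  have hker : (π₁ ≫ z ≫ s - y ≫ (homotopyCofiber (𝟙 K)).iCycles i) ≫ g.f i = 0 := by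
    simp only [Preadditive.sub_comp, Category.assoc, hy, sub_self]
  obtain ⟨T₂, π₂, _, (x : T₂ ⟶ K.X i), hx⟩ :=
    (hS.exact.map (eval C c i)).exact_up_to_refinements _ hker
  replace hx : π₂ ≫ (π₁ ≫ z ≫ s - y ≫ (homotopyCofiber (𝟙 K)).iCycles i) =
    x ≫ (homotopyCofiber.inr (𝟙 K)).f i := hx
  refine ⟨T₂, π₂ ≫ π₁, inferInstance, x, ?_⟩
  have hdx := hx =≫ (homotopyCofiber (𝟙 K)).d i j
  simp only [Category.assoc, Preadditive.sub_comp, iCycles_d, comp_zero, sub_zero, hs,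
    Hom.comm] at hdx
  rw [← cancel_mono (K.iCycles j), ← cancel_mono ((homotopyCofiber.inr (𝟙 K)).f j)]
  simpa only [Category.assoc, toCycles_i] using hdx

end HomologicalComplex

/-- Example 3.5 (characterization of `k_i`-coflat complexes): for a chain complex `X` over
an abelian category `A` and `i : ℤ`, the `i`-cycles functor sends every short exact
sequence starting at `X` to a short exact sequence if and only if the canonical sequence
`0 ⟶ Z_i(X) ⟶ X_i ⟶ Z_{i-1}(X) ⟶ 0` is short exact. -/
theorem statement14 {A : Type u} [Category.{v} A] [Abelian A]
    (X : ChainComplex A ℤ) (i : ℤ) :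
    (∀ ⦃Y W : ChainComplex A ℤ⦄ (f : X ⟶ Y) (g : Y ⟶ W) (w : f ≫ g = 0),
      (ShortComplex.mk f g w).ShortExact →
      ∃ w' : cyclesMap f i ≫ cyclesMap g i = 0,
        (ShortComplex.mk (cyclesMap f i) (cyclesMap g i) w').ShortExact) ↔
    (∃ w : X.iCycles i ≫ X.toCycles i (i - 1) = 0,
      (ShortComplex.mk (X.iCycles i) (X.toCycles i (i - 1)) w).ShortExact) := by
  have hrel (n : ℤ) : (ComplexShape.down ℤ).Rel n (n - 1) := by simp
  constructor
  · intro h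
    have := mono_homotopyCofiber_inr (𝟙 X)
    have hS : (ShortComplex.mk (homotopyCofiber.inr (𝟙 X)) (cokernel.π _)
        (cokernel.condition _)).ShortExact :=
      { exact := ShortComplex.exact_cokernel _ }
    obtain ⟨_, hZ⟩ := h _ _ _ hS
    have := hZ.epi_g
    have := epi_toCycles_of_epi_cyclesMap X hS (hrel i) (hrel (i - 1))
    have w : X.iCycles i ≫ X.toCycles i (i - 1) = 0 := by
      simp [← cancel_mono (X.iCycles (i - 1))]
    exact ⟨w, shortExact_iCycles_toCycles X (hrel i) w⟩
  · rintro ⟨_, hX⟩ Y W f g w hS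
    have := hX.epi_g
    have : Mono f := hS.mono_f
    have w' : cyclesMap f i ≫ cyclesMap g i = 0 := by rw [← cyclesMap_comp, w, cyclesMap_zero]
    exact ⟨w',
      { exact := cycles_left_exact (ShortComplex.mk f g w) hS.exact i
        mono_f := inferInstanceAs (Mono (cyclesMap f i))
        epi_g := epi_cyclesMap_of_epi_toCycles hS (hrel i) }⟩
end

section
/- Let A be an abelian category, X a chain complex in Ch(A) and i ∈ ℤ. Then the following are equivalent: (a) for every short exact sequence 0 → W → Y → X → 0 in Ch(A), the induced sequence 0 → c_i(W) → c_i(Y) → c_i(X) → 0, where c_i denotes the functor sending a complex to the cokernel of its differential into degree i, is a short exact sequence in A; (b) the canonical sequence 0 → c_{i+1}(X) → X_i → c_i(X) → 0 (whose first map is induced by d_{i+1} : X_{i+1} → X_i on the quotient c_{i+1}(X) = coker(d_{i+2}), and whose second map is the canonical quotient map) is a short exact sequence in A. -/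
open CategoryTheory Limits HomologicalComplex

universe v u

namespace HomologicalComplex

variable {A ι : Type*} [Category* A] {c : ComplexShape ι}

/-- A morphism of complexes that is injective on opcycles is injective on homology. -/
lemma mono_homologyMap_of_mono_opcyclesMap [HasZeroMorphisms A] {K L : HomologicalComplex A c}
    (f : K ⟶ L) (i : ι) [K.HasHomology i] [L.HasHomology i] [Mono (opcyclesMap f i)] :
    Mono (homologyMap f i) := by
  have : Mono (homologyMap f i ≫ L.homologyι i) := by
    rw [homologyι_naturality]
    infer_instance
  exact mono_of_mono _ (L.homologyι i)

lemma opcyclesMap_fromOpcycles [HasZeroMorphisms A] {K L : HomologicalComplex A c} (f : K ⟶ L)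
    (i j : ι) [K.HasHomology i] [L.HasHomology i] :
    opcyclesMap f i ≫ L.fromOpcycles i j = K.fromOpcycles i j ≫ f.f j := by
  rw [← cancel_epi (K.pOpcycles i), p_opcyclesMap_assoc, p_fromOpcycles, p_fromOpcycles_assoc,
    f.comm]

/-- A morphism of complexes that is injective on homology in degree `i` and on the objects in
the next degree is injective on opcycles in degree `i`. -/
lemma mono_opcyclesMap_of_mono_homologyMap [Preadditive A] {K L : HomologicalComplex A c}
    (f : K ⟶ L) (i j : ι) (hij : c.next i = j) [K.HasHomology i] [L.HasHomology i]
    [Mono (f.f j)] [Mono (homologyMap f i)] : Mono (opcyclesMap f i) := by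
  refine Preadditive.mono_of_cancel_zero _ fun {T} x hx => ?_
  have hx' : x ≫ K.fromOpcycles i j = 0 := by
    rw [← cancel_mono (f.f j), Category.assoc, ← opcyclesMap_fromOpcycles, reassoc_of% hx,
      zero_comp, zero_comp]
  obtain ⟨y, hy⟩ := KernelFork.IsLimit.lift' (K.homologyIsKernel i j hij) x hx'
  dsimp at y hy
  have hy' : y = 0 := by
    rw [← cancel_mono (homologyMap f i), ← cancel_mono (L.homologyι i), Category.assoc,
      homologyι_naturality, reassoc_of% hy, hx, zero_comp, zero_comp]
  rw [← hy, hy', zero_comp]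

lemma mono_fromOpcycles_iff_isZero_homology [Preadditive A] (K : HomologicalComplex A c)
    (i j : ι) (hij : c.next i = j) [K.HasHomology i] :
    Mono (K.fromOpcycles i j) ↔ IsZero (K.homology i) := by
  refine ⟨fun _ => ?_, fun h => Preadditive.mono_of_isZero_kernel' _
    (K.homologyIsKernel i j hij) h⟩
  have h : K.homologyι i = 0 := by
    rw [← cancel_mono (K.fromOpcycles i j), homologyι_comp_fromOpcycles, zero_comp]
  rw [IsZero.iff_id_eq_zero, ← cancel_mono (K.homologyι i), h, comp_zero, comp_zero]

lemma fromOpcycles_pOpcycles [HasZeroMorphisms A] (K : HomologicalComplex A c) (i j : ι)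
    [K.HasHomology i] [K.HasHomology j] : K.fromOpcycles i j ≫ K.pOpcycles j = 0 := by
  rw [← cancel_epi (K.pOpcycles i), p_fromOpcycles_assoc, d_pOpcycles, comp_zero]

lemma exact_fromOpcycles_pOpcycles [Abelian A] (K : HomologicalComplex A c) (i j : ι)
    (hij : c.prev j = i) :
    (ShortComplex.mk _ _ (K.fromOpcycles_pOpcycles i j)).Exact := by
  let φ : ShortComplex.mk (K.d i j) (K.pOpcycles j) (by simp) ⟶
      ShortComplex.mk _ _ (K.fromOpcycles_pOpcycles i j) :=
    { τ₁ := K.pOpcycles i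
      τ₂ := 𝟙 _
      τ₃ := 𝟙 _ }
  have : Epi φ.τ₁ := inferInstanceAs (Epi (K.pOpcycles i))
  have : IsIso φ.τ₂ := inferInstanceAs (IsIso (𝟙 _))
  have : Mono φ.τ₃ := inferInstanceAs (Mono (𝟙 _))
  rw [← ShortComplex.exact_iff_of_epi_of_isIso_of_mono φ]
  exact ShortComplex.exact_of_g_is_cokernel _ (K.opcyclesIsCokernel i j hij)

end HomologicalComplex

namespace ChainComplex

variable {A : Type*} [Category* A] [Preadditive A] [HasBinaryBiproducts A]

/-- The complex with `X_n ⊞ X_{n+1}` in degree `n` and differential `(a, b) ↦ (d a, a - d b)`,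
which is the mapping cone of the identity of `X` shifted by one degree. -/
noncomputable def coneIdShift (X : ChainComplex A ℤ) : ChainComplex A ℤ :=
  ChainComplex.of (fun n => X.X n ⊞ X.X (n + 1))
    (fun n => biprod.lift (biprod.fst ≫ X.d (n + 1) n)
      (biprod.fst - biprod.snd ≫ X.d (n + 1 + 1) (n + 1)))
    (fun n => by ext <;> simp)

/-- The projection `coneIdShift X ⟶ X`, defined as a null-homotopic map. -/
noncomputable def coneIdShiftπ (X : ChainComplex A ℤ) : coneIdShift X ⟶ X :=
  Homotopy.nullHomotopicMap' fun i _ hij =>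
    (biprod.snd : X.X i ⊞ X.X (i + 1) ⟶ _) ≫ eqToHom (congrArg X.X hij)

lemma coneIdShiftπ_f (X : ChainComplex A ℤ) (n : ℤ) :
    (coneIdShiftπ X).f n = (biprod.fst : X.X n ⊞ X.X (n + 1) ⟶ _) := by
  obtain ⟨m, rfl⟩ : ∃ m, n = m + 1 := ⟨n - 1, by simp⟩
  have h := Homotopy.nullHomotopicMap'_f (c := ComplexShape.down ℤ) (k₂ := m + 1 + 1)
    (k₁ := m + 1) (k₀ := m) rfl rfl (C := coneIdShift X) (D := X) fun i _ hij =>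
    (biprod.snd : X.X i ⊞ X.X (i + 1) ⟶ _) ≫ eqToHom (congrArg X.X hij)
  have hd : (coneIdShift X).d (m + 1) m = biprod.lift (biprod.fst ≫ X.d (m + 1) m)
      (biprod.fst - biprod.snd ≫ X.d (m + 1 + 1) (m + 1)) := by
    simp [coneIdShift, ChainComplex.of_d]
  have hfst : biprod.lift (biprod.fst ≫ X.d (m + 1) m)
      (biprod.fst - biprod.snd ≫ X.d (m + 1 + 1) (m + 1)) ≫ biprod.snd ≫ 𝟙 (X.X (m + 1)) +
      (biprod.snd ≫ 𝟙 (X.X (m + 1 + 1))) ≫ X.d (m + 1 + 1) (m + 1) = biprod.fst := by simp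
  refine h.trans (Eq.trans ?_ hfst)
  rw [hd]
  rfl

instance epi_coneIdShiftπ_f (X : ChainComplex A ℤ) (n : ℤ) : Epi ((coneIdShiftπ X).f n) := by
  rw [coneIdShiftπ_f]
  exact inferInstanceAs (Epi (biprod.fst : X.X n ⊞ X.X (n + 1) ⟶ _))

lemma homologyMap_coneIdShiftπ (X : ChainComplex A ℤ) (n : ℤ) [X.HasHomology n]
    [(coneIdShift X).HasHomology n] : homologyMap (coneIdShiftπ X) n = 0 :=
  ((Homotopy.nullHomotopy' _).homologyMap_eq n).trans (homologyMap_zero _ _ n)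

end ChainComplex

/-- Example 3.5 (characterization of `c_i`-flat complexes): for a chain complex `X` over
an abelian category `A` and `i : ℤ`, the functor `c_i = coker(d into degree i)` sends every
short exact sequence ending at `X` to a short exact sequence if and only if the canonical
sequence `0 ⟶ c_{i+1}(X) ⟶ X_i ⟶ c_i(X) ⟶ 0` is short exact. -/
theorem statement15 {A : Type u} [Category.{v} A] [Abelian A]
    (X : ChainComplex A ℤ) (i : ℤ) :
    (∀ ⦃W Y : ChainComplex A ℤ⦄ (f : W ⟶ Y) (g : Y ⟶ X) (w : f ≫ g = 0),
      (ShortComplex.mk f g w).ShortExact →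
      ∃ w' : opcyclesMap f i ≫ opcyclesMap g i = 0,
        (ShortComplex.mk (opcyclesMap f i) (opcyclesMap g i) w').ShortExact) ↔
    (∃ w : X.fromOpcycles (i + 1) i ≫ X.pOpcycles i = 0,
      (ShortComplex.mk (X.fromOpcycles (i + 1) i) (X.pOpcycles i) w).ShortExact) := by
  have hrel : (ComplexShape.down ℤ).Rel (i + 1) i := rfl
  have hiff := X.mono_fromOpcycles_iff_isZero_homology (i + 1) i
    ((ComplexShape.down ℤ).next_eq' hrel)
  constructor
  · intro h
    have : Epi (ChainComplex.coneIdShiftπ X) := epi_of_epi_f _ fun n => inferInstance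
    have hS : (ShortComplex.mk _ _ (kernel.condition (ChainComplex.coneIdShiftπ X))).ShortExact :=
      { exact := ShortComplex.exact_of_f_is_kernel _ (kernelIsKernel _) }
    obtain ⟨_, hi⟩ := h _ _ _ hS
    have : Mono (opcyclesMap (kernel.ι (ChainComplex.coneIdShiftπ X)) i) := hi.mono_f
    have := mono_homologyMap_of_mono_opcyclesMap (kernel.ι (ChainComplex.coneIdShiftπ X)) i
    have hδ : hS.δ (i + 1) i hrel = 0 :=
      zero_of_comp_mono (homologyMap (kernel.ι (ChainComplex.coneIdShiftπ X)) i)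
        (hS.δ_comp (i + 1) i hrel)
    have : Mono (hS.δ (i + 1) i hrel) :=
      (hS.homology_exact₃ (i + 1) i hrel).mono_g (ChainComplex.homologyMap_coneIdShiftπ X (i + 1))
    have := hiff.2 (IsZero.of_mono_eq_zero _ hδ)
    exact ⟨X.fromOpcycles_pOpcycles _ _,
      { exact := X.exact_fromOpcycles_pOpcycles _ _ ((ComplexShape.down ℤ).prev_eq' hrel) }⟩
  · rintro ⟨_, hX⟩ W Y f g w hS
    have hzero := hiff.1 hX.mono_f
    have : Mono f := hS.mono_f
    have : Epi g := hS.epi_g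
    have : Mono (homologyMap f i) :=
      (hS.homology_exact₁ (i + 1) i hrel).mono_g (hzero.eq_of_src _ _)
    have := mono_opcyclesMap_of_mono_homologyMap f i _ rfl
    exact ⟨_, { exact := opcycles_right_exact _ hS.exact i }⟩
end

section
/- Let R be a ring and (F, G) a cotorsion pair in the category of left R-modules. For a chain complex X in Ch(R), the following are equivalent: (a) for every i ∈ ℤ and every F₀ ∈ F, Ext¹_{Ch(R)}(S^i(F₀), X) = 0; (b) X is exact (its homology vanishes in every degree) and for every i ∈ ℤ the i-cycles Z_i(X) = ker(d_i : X_i → X_{i−1}) belong to G. -/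
open CategoryTheory Limits

universe w v u

namespace CategoryTheory.ShortComplex.ShortExact

variable {C : Type u} [Category.{v} C] [Abelian C]

/-- If the middle term of a short exact sequence is projective, then `Ext¹ S.X₃ Y` vanishes
if and only if every morphism `S.X₁ ⟶ Y` extends along `S.f`. -/
lemma forall_ext_one_eq_zero_iff [HasExt.{w} C] {S : ShortComplex C} (hS : S.ShortExact)
    [Projective S.X₂] (Y : C) :
    (∀ x : Abelian.Ext S.X₃ Y 1, x = 0) ↔
      ∀ a : S.X₁ ⟶ Y, ∃ b : S.X₂ ⟶ Y, S.f ≫ b = a := by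
  constructor
  · intro h a
    obtain ⟨b, hb⟩ := Abelian.Ext.contravariant_sequence_exact₁ hS Y (Abelian.Ext.mk₀ a)
      (add_zero 1) (h _)
    obtain ⟨b, rfl⟩ := (Abelian.Ext.mk₀_bijective S.X₂ Y).2 b
    rw [Abelian.Ext.mk₀_comp_mk₀] at hb
    exact ⟨b, (Abelian.Ext.mk₀_bijective _ _).1 hb⟩
  · intro h x
    obtain ⟨a, rfl⟩ := Abelian.Ext.contravariant_sequence_exact₃ hS Y x
      (Abelian.Ext.eq_zero_of_projective _) (add_zero 1)
    obtain ⟨a, rfl⟩ := (Abelian.Ext.mk₀_bijective S.X₁ Y).2 a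
    obtain ⟨b, rfl⟩ := h a
    rw [← Abelian.Ext.mk₀_comp_mk₀, hS.extClass_comp_assoc]

end CategoryTheory.ShortComplex.ShortExact

namespace HomologicalComplex

variable {C : Type u} [Category.{v} C] [Abelian C] {ι : Type*}
  {c : ComplexShape ι} {i j : ι}

/-- The disc on a projective object is projective. -/
lemma projective_double_id (hij : c.Rel i j) (h : i ≠ j) (P : C) [Projective P] :
    Projective (double (𝟙 P) hij) where
  factors {E X} φ e _ := by
    have : Epi (e.f i) := inferInstanceAs (Epi ((eval C c i).map e))
    let ψ : P ⟶ X.X i := (doubleXIso₀ (𝟙 P) hij).inv ≫ φ.f i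
    let χ : P ⟶ E.X i := Projective.factorThru ψ (e.f i)
    have hχ : χ ≫ e.f i = (doubleXIso₀ (𝟙 P) hij).inv ≫ φ.f i :=
      Projective.factorThru_comp ψ (e.f i)
    refine ⟨mkHomFromDouble hij h χ (χ ≫ E.d i j) (by simp) (by simp), ?_⟩
    ext
    · simp [hχ]
    · rw [comp_f, mkHomFromDouble_f₁, Category.assoc, Category.assoc, ← e.comm,
        ← Category.assoc χ, hχ]
      simp [double_d _ _ h]

/-- The inclusion of `f : X₀ ⟶ X₁`, viewed as a two-term complex, into the disc on `X₁`. -/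
noncomputable def doubleToDisc {X₀ X₁ : C} (f : X₀ ⟶ X₁) (hij : c.Rel i j) (h : i ≠ j) :
    double f hij ⟶ double (𝟙 X₁) hij :=
  mkHomFromDouble hij h (f ≫ (doubleXIso₀ (𝟙 X₁) hij).inv)
    (doubleXIso₁ (𝟙 X₁) hij h).inv (by simp [double_d _ _ h])
    (fun k _ ↦ by rw [double_d_eq_zero₀ _ _ _ _ h.symm, comp_zero])

variable [DecidableEq ι] in
/-- The morphism from the disc on `X₀` to the sphere on `X₁` induced by `g : X₀ ⟶ X₁`. -/
noncomputable def discToSingle {X₀ X₁ : C} (g : X₀ ⟶ X₁) (hij : c.Rel i j) (h : i ≠ j) :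
    double (𝟙 X₀) hij ⟶ (single C c i).obj X₁ :=
  mkHomToSingle ((doubleXIso₀ (𝟙 X₀) hij).hom ≫ g)
    (fun k _ ↦ by rw [double_d_eq_zero₁ _ _ _ _ h, zero_comp])

lemma doubleToDisc_f₀ {X₀ X₁ : C} (f : X₀ ⟶ X₁) (hij : c.Rel i j) (h : i ≠ j) :
    (doubleToDisc f hij h).f i =
      (doubleXIso₀ f hij).hom ≫ f ≫ (doubleXIso₀ (𝟙 X₁) hij).inv :=
  mkHomFromDouble_f₀ ..

lemma doubleToDisc_f₁ {X₀ X₁ : C} (f : X₀ ⟶ X₁) (hij : c.Rel i j) (h : i ≠ j) :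
    (doubleToDisc f hij h).f j = (doubleXIso₁ f hij h).hom ≫ (doubleXIso₁ (𝟙 X₁) hij h).inv :=
  mkHomFromDouble_f₁ ..

variable [DecidableEq ι]

lemma discToSingle_f {X₀ X₁ : C} (g : X₀ ⟶ X₁) (hij : c.Rel i j) (h : i ≠ j) :
    (discToSingle g hij h).f i =
      (doubleXIso₀ (𝟙 X₀) hij).hom ≫ g ≫ (singleObjXSelf c i X₁).inv := by
  simp [discToSingle]

/-- For `0 ⟶ X₁ ⟶ X₂ ⟶ X₃ ⟶ 0`, the sequence `(X₁ ⟶ X₂) ⟶ (X₂ ⟶ X₂) ⟶ X₃[i]` where `X₃` is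
placed in degree `i` and the other two complexes in degrees `i` and `j`. -/
noncomputable abbrev discShortComplex (S : ShortComplex C) (hij : c.Rel i j) (h : i ≠ j) :
    ShortComplex (HomologicalComplex C c) :=
  ShortComplex.mk (doubleToDisc S.f hij h) (discToSingle S.g hij h) (by
    apply to_single_hom_ext
    simp [doubleToDisc_f₀, discToSingle_f])

lemma discShortComplex_shortExact {S : ShortComplex C} (hS : S.ShortExact)
    (hij : c.Rel i j) (h : i ≠ j) : (discShortComplex S hij h).ShortExact := by
  refine shortExact_of_degreewise_shortExact _ fun k ↦ ?_
  by_cases hi : k = i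
  · subst hi
    refine ShortComplex.shortExact_of_iso (ShortComplex.isoMk (doubleXIso₀ S.f hij).symm
      (doubleXIso₀ (𝟙 S.X₂) hij).symm (singleObjXSelf c k S.X₃).symm ?_ ?_) hS
    · change _ ≫ (doubleToDisc S.f hij h).f k = _
      simp [doubleToDisc_f₀]
      rfl
    · change _ ≫ (discToSingle S.g hij h).f k = _
      simp [discToSingle_f]
      rfl
  · have hz : IsZero ((discShortComplex S hij h).map (eval C c k)).X₃ :=
      isZero_single_obj_X c i S.X₃ k hi
    have hf : IsIso ((discShortComplex S hij h).map (eval C c k)).f := by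
      by_cases hj : k = j
      · subst hj
        change IsIso ((doubleToDisc S.f hij h).f k)
        rw [doubleToDisc_f₁]
        infer_instance
      · exact (isZero_double_X S.f hij k hi hj).isIso (isZero_double_X (𝟙 S.X₂) hij k hi hj) _
    exact (ShortComplex.Splitting.ofIsIsoOfIsZero _ hf hz).shortExact

/-- `Ext¹` from a sphere, computed with a projective presentation `0 ⟶ X₁ ⟶ X₂ ⟶ X₃ ⟶ 0`. -/
lemma forall_ext_single_one_eq_zero_iff [HasExt.{w} (HomologicalComplex C c)]
    {S : ShortComplex C} (hS : S.ShortExact) [Projective S.X₂]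
    (hij : c.Rel i j) (h : i ≠ j) (X : HomologicalComplex C c) :
    (∀ x : Abelian.Ext ((single C c i).obj S.X₃) X 1, x = 0) ↔
      ∀ (a : S.X₁ ⟶ X.X i) (b : S.X₂ ⟶ X.X j), a ≫ X.d i j = S.f ≫ b →
        (∀ k, c.Rel j k → b ≫ X.d j k = 0) →
          ∃ e : S.X₂ ⟶ X.X i, S.f ≫ e = a ∧ e ≫ X.d i j = b := by
  have : Projective (discShortComplex S hij h).X₂ := projective_double_id hij h S.X₂
  refine ((discShortComplex_shortExact hS hij h).forall_ext_one_eq_zero_iff X).trans ⟨?_, ?_⟩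
  · intro H a b hab hb
    obtain ⟨φ, hφ⟩ := H (mkHomFromDouble hij h a b hab hb)
    dsimp at φ hφ
    have h₀ := congr_hom hφ i
    have h₁ := congr_hom hφ j
    simp only [comp_f, mkHomFromDouble_f₀, mkHomFromDouble_f₁, Category.assoc,
      doubleToDisc_f₀, doubleToDisc_f₁, cancel_epi] at h₀ h₁
    refine ⟨(doubleXIso₀ (𝟙 S.X₂) hij).inv ≫ φ.f i, h₀, ?_⟩
    rw [Category.assoc, φ.comm, double_d _ _ h]
    simpa using h₁
  · intro H (φ : double S.f hij ⟶ X)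
    obtain ⟨e, h₀, h₁⟩ := H ((doubleXIso₀ S.f hij).inv ≫ φ.f i)
      ((doubleXIso₁ S.f hij h).inv ≫ φ.f j) (by simp [double_d _ _ h])
      (fun k _ ↦ by simp [double_d_eq_zero₀ _ hij j k h.symm])
    refine ⟨mkHomFromDouble hij h e (e ≫ X.d i j) (by simp) (by simp), ?_⟩
    dsimp
    ext
    · simp [doubleToDisc_f₀, h₀]
    · simp [doubleToDisc_f₁, h₁]

end HomologicalComplex

/-- The presentation of an object as a quotient of a projective object. -/
lemma exists_projective_presentation {C : Type u} [Category.{v} C] [Abelian C]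
    [EnoughProjectives C] (A : C) :
    ∃ (K P : C) (k : K ⟶ P) (p : P ⟶ A) (w : k ≫ p = 0),
      Projective P ∧ (ShortComplex.mk k p w).ShortExact :=
  ⟨_, _, kernel.ι (Projective.π A), Projective.π A, kernel.condition _, inferInstance,
    { exact := ShortComplex.exact_kernel _ }⟩

namespace ChainComplex

variable {C : Type u} [Category.{v} C] [Abelian C]

lemma exactAt_iff_exact_sub_one (X : ChainComplex C ℤ) (i : ℤ) :
    X.ExactAt (i - 1) ↔ (X.sc' i (i - 1) (i - 1 - 1)).Exact :=
  X.exactAt_iff' _ _ _ (by simp) (by simp)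

variable [EnoughProjectives C] [HasExt.{w} (HomologicalComplex C (ComplexShape.down ℤ))]
  [HasExt.{w} C]

theorem forall_ext_single_one_eq_zero_iff_of_isCotorsionPair
    {F G : Set C} (hFG : IsCotorsionPair F G) (X : ChainComplex C ℤ) :
    (∀ i : ℤ, ∀ F₀ ∈ F, ∀ x : Abelian.Ext
        ((HomologicalComplex.single C (ComplexShape.down ℤ) i).obj F₀) X 1, x = 0) ↔
      ((∀ i : ℤ, IsZero (X.homology i)) ∧ ∀ i : ℤ, kernel (X.d i (i - 1)) ∈ G) := by
  have hrel (i : ℤ) : (ComplexShape.down ℤ).Rel i (i - 1) := by simp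
  have hne (i : ℤ) : i ≠ i - 1 := by lia
  have hnext (i k : ℤ) (h : (ComplexShape.down ℤ).Rel (i - 1) k) : k = i - 1 - 1 := by
    simp only [ComplexShape.down_Rel] at h; lia
  simp only [← HomologicalComplex.exactAt_iff_isZero_homology]
  constructor
  · intro H
    constructor
    · intro i
      obtain ⟨i, rfl⟩ : ∃ j, i = j - 1 := ⟨i + 1, by lia⟩
      rw [exactAt_iff_exact_sub_one, ShortComplex.exact_iff_exact_up_to_refinements]
      intro A (x : A ⟶ X.X (i - 1)) (hx : x ≫ X.d (i - 1) (i - 1 - 1) = 0)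
      have hP : Projective.over A ∈ F := (hFG.2 _).2 fun _ _ y ↦ y.eq_zero_of_projective
      have hS : (ShortComplex.mk (0 : (⊥_ C) ⟶ _) (𝟙 (Projective.over A)) (by simp)).ShortExact :=
        (ShortComplex.Splitting.ofIsZeroOfIsIso _ initialIsInitial.isZero
          inferInstance).shortExact
      obtain ⟨e, -, he⟩ := (HomologicalComplex.forall_ext_single_one_eq_zero_iff hS (hrel i)
        (hne i) X).1 (H i _ hP) 0 (Projective.π A ≫ x) (by simp) (fun k hk ↦ by
          obtain rfl := hnext i k hk
          rw [Category.assoc, hx, comp_zero])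
      exact ⟨_, Projective.π A, inferInstance, e, he.symm⟩
    · intro i
      refine (hFG.1 _).2 fun F₀ hF₀ ↦ ?_
      obtain ⟨K, P, k, p, w, _, hS⟩ := exists_projective_presentation F₀
      refine (hS.forall_ext_one_eq_zero_iff _).2 fun a ↦ ?_
      obtain ⟨e, he, he'⟩ := (HomologicalComplex.forall_ext_single_one_eq_zero_iff hS (hrel i)
        (hne i) X).1 (H i _ hF₀) (a ≫ kernel.ι _) 0 (by simp) (by simp)
      exact ⟨kernel.lift _ e he', by simpa [← cancel_mono (kernel.ι (X.d i (i - 1)))] using he⟩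
  · rintro ⟨hX, hG⟩ i F₀ hF₀
    obtain ⟨K, P, k, p, w, _, hS⟩ := exists_projective_presentation F₀
    refine (HomologicalComplex.forall_ext_single_one_eq_zero_iff hS (hrel i) (hne i) X).2
      fun a b hab hb ↦ ?_
    dsimp at a b hab
    have hex := (exactAt_iff_exact_sub_one X i).1 (hX (i - 1))
    obtain ⟨e₀, he₀⟩ : ∃ e₀ : P ⟶ X.X i, e₀ ≫ X.d i (i - 1) = b :=
      ⟨hex.liftFromProjective b (hb _ (by simp)), hex.liftFromProjective_comp _ _⟩
    obtain ⟨e₁, he₁⟩ := (hS.forall_ext_one_eq_zero_iff _).1 ((hFG.1 _).1 (hG i) F₀ hF₀)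
      (kernel.lift (X.d i (i - 1)) (a - k ≫ e₀) (by simp [he₀, hab]))
    have he₁' := congr_arg (· ≫ kernel.ι _) he₁
    dsimp at he₁'
    rw [Category.assoc, kernel.lift_ι] at he₁'
    exact ⟨e₀ + e₁ ≫ kernel.ι _, by simp [he₁'], by simp [he₀]⟩

end ChainComplex

/-- Theorem 5.19(i) for chain complexes: for a cotorsion pair `(F, G)` of `R`-modules and
a chain complex `X`, one has `Ext¹ (S^i F₀) X = 0` for all `i : ℤ` and `F₀ ∈ F` if and
only if `X` is exact and all its cycle objects `Z_i(X) = ker (d_i)` belong to `G`. -/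
theorem statement16 {R : Type u} [Ring R]
    [HasExt.{w} (HomologicalComplex (ModuleCat.{u} R) (ComplexShape.down ℤ))]
    [HasExt.{w} (ModuleCat.{u} R)]
    (F G : Set (ModuleCat.{u} R)) (hFG : IsCotorsionPair F G)
    (X : ChainComplex (ModuleCat.{u} R) ℤ) :
    (∀ i : ℤ, ∀ F₀ ∈ F,
        ∀ x : Abelian.Ext
          ((HomologicalComplex.single (ModuleCat.{u} R) (ComplexShape.down ℤ) i).obj F₀)
          X 1, x = 0) ↔
      ((∀ i : ℤ, IsZero (X.homology i)) ∧ ∀ i : ℤ, kernel (X.d i (i - 1)) ∈ G) :=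
  ChainComplex.forall_ext_single_one_eq_zero_iff_of_isCotorsionPair hFG X
end

section
/- Let R be a ring and (F, G) a cotorsion pair in the category of left R-modules. For a chain complex X in Ch(R), the following are equivalent: (a) for every i ∈ ℤ and every G₀ ∈ G, Ext¹_{Ch(R)}(X, S^i(G₀)) = 0; (b) X is exact (its homology vanishes in every degree) and for every i ∈ ℤ the cokernel c_i(X) = coker(d_{i+1} : X_{i+1} → X_i) belongs to F. -/
open CategoryTheory Limits

universe w v u

namespace HomologicalComplex

section

variable {C : Type u} [Category.{v} C] [HasZeroMorphisms C] [HasZeroObject C]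
  {ι : Type*} {c : ComplexShape ι} {X₀ X₁ : C} {f : X₀ ⟶ X₁} {i₀ i₁ : ι}

open scoped Classical in
/-- Constructor for morphisms to a homological complex `double f hi₀₁`. -/
noncomputable def mkHomToDouble (hi₀₁ : c.Rel i₀ i₁) (h : i₀ ≠ i₁) {K : HomologicalComplex C c}
    (φ₀ : K.X i₀ ⟶ X₀) (φ₁ : K.X i₁ ⟶ X₁) (comm : φ₀ ≫ f = K.d i₀ i₁ ≫ φ₁)
    (hφ : ∀ k, K.d k i₀ ≫ φ₀ = 0) : K ⟶ double f hi₀₁ where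
  f k :=
    if hk₀ : k = i₀ then
      eqToHom (by rw [hk₀]) ≫ φ₀ ≫ (doubleXIso₀ f hi₀₁).inv ≫ eqToHom (by rw [hk₀])
    else if hk₁ : k = i₁ then
      eqToHom (by rw [hk₁]) ≫ φ₁ ≫ (doubleXIso₁ f hi₀₁ h).inv ≫ eqToHom (by rw [hk₁])
    else 0
  comm' k₀ k₁ hk := by
    by_cases h₁ : k₁ = i₁
    · subst h₁
      obtain rfl := c.prev_eq hk hi₀₁
      simp [dif_neg h.symm, double_d f hi₀₁ h, reassoc_of% comm]
    · rw [double_d_eq_zero₁ _ _ _ _ h₁, comp_zero, dif_neg h₁]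
      by_cases h₀ : k₁ = i₀
      · subst h₀
        simp [reassoc_of% hφ]
      · simp [dif_neg h₀]

variable (hi₀₁ : c.Rel i₀ i₁) (h : i₀ ≠ i₁) {K : HomologicalComplex C c}
    (φ₀ : K.X i₀ ⟶ X₀) (φ₁ : K.X i₁ ⟶ X₁) (comm : φ₀ ≫ f = K.d i₀ i₁ ≫ φ₁)
    (hφ : ∀ k, K.d k i₀ ≫ φ₀ = 0)

@[simp]
lemma mkHomToDouble_f₀ :
    (mkHomToDouble hi₀₁ h φ₀ φ₁ comm hφ).f i₀ = φ₀ ≫ (doubleXIso₀ f hi₀₁).inv := by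
  simp [mkHomToDouble]

@[simp]
lemma mkHomToDouble_f₁ :
    (mkHomToDouble hi₀₁ h φ₀ φ₁ comm hφ).f i₁ = φ₁ ≫ (doubleXIso₁ f hi₀₁ h).inv := by
  simp [mkHomToDouble, dif_neg h.symm]

end

section

variable {C : Type u} [Category.{v} C] [Abelian C]
  {ι : Type*} {c : ComplexShape ι} {i₀ i₁ : ι}

lemma injective_double_id (hi₀₁ : c.Rel i₀ i₁) (h : i₀ ≠ i₁) (J : C) [Injective J] :
    Injective (double (𝟙 J) hi₀₁) where
  factors {K L} g m _ := by
    let a : L.X i₁ ⟶ J := Injective.factorThru (g.f i₁ ≫ (doubleXIso₁ (𝟙 J) hi₀₁ h).hom) (m.f i₁)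
    have ha : m.f i₁ ≫ a = g.f i₁ ≫ (doubleXIso₁ (𝟙 J) hi₀₁ h).hom := Injective.comp_factorThru _ _
    refine ⟨mkHomToDouble hi₀₁ h (L.d i₀ i₁ ≫ a) a (by simp) (by simp), ?_⟩
    apply to_double_hom_ext
    · have := g.comm i₀ i₁
      simp only [double_d _ hi₀₁ h, Category.id_comp] at this
      rw [comp_f, mkHomToDouble_f₀, Category.assoc, Hom.comm_assoc, reassoc_of% ha,
        ← reassoc_of% this]
      simp
    · simp [reassoc_of% ha]

variable [DecidableEq ι]

/-- The complex `0 ⟶ S.X₁[i₁] ⟶ double (𝟙 S.X₂) ⟶ double S.g ⟶ 0` attached to a short complex. -/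
noncomputable abbrev singleDoubleShortComplex (S : ShortComplex C) (hi₀₁ : c.Rel i₀ i₁)
    (h : i₀ ≠ i₁) :
    ShortComplex (HomologicalComplex C c) where
  X₁ := (single C c i₁).obj S.X₁
  X₂ := double (𝟙 S.X₂) hi₀₁
  X₃ := double S.g hi₀₁
  f := mkHomFromSingle (S.f ≫ (doubleXIso₁ (𝟙 S.X₂) hi₀₁ h).inv)
    (fun _ _ ↦ by simp [double_d_eq_zero₀ _ _ _ _ h.symm])
  g := mkHomToDouble hi₀₁ h (doubleXIso₀ _ hi₀₁).hom ((doubleXIso₁ _ hi₀₁ h).hom ≫ S.g)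
    (by simp [double_d _ hi₀₁ h]) (fun k ↦ by simp [double_d_eq_zero₁ _ _ _ _ h])
  zero := by
    apply from_single_hom_ext
    simp

lemma shortExact_singleDoubleShortComplex {S : ShortComplex C} (hS : S.ShortExact)
    (hi₀₁ : c.Rel i₀ i₁) (h : i₀ ≠ i₁) :
    (singleDoubleShortComplex S hi₀₁ h).ShortExact := by
  apply shortExact_of_degreewise_shortExact
  intro k
  by_cases h₁ : k = i₁
  · subst h₁
    refine ShortComplex.shortExact_of_iso (S₁ := S) ?_ hS
    refine ShortComplex.isoMk (singleObjXSelf c k S.X₁).symm (doubleXIso₁ (𝟙 S.X₂) hi₀₁ h).symm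
      (doubleXIso₁ S.g hi₀₁ h).symm ?_ ?_
    · rw [ShortComplex.map_f, eval_map, mkHomFromSingle_f]
      exact Iso.inv_hom_id_assoc _ _
    · rw [ShortComplex.map_g, eval_map, mkHomToDouble_f₁, Category.assoc]
      exact Iso.inv_hom_id_assoc _ _
  have hz : IsZero (((single C c i₁).obj S.X₁).X k) := isZero_single_obj_X _ _ _ _ h₁
  have : IsIso ((singleDoubleShortComplex S hi₀₁ h).g.f k) := by
    by_cases h₀ : k = i₀
    · subst h₀
      rw [mkHomToDouble_f₀]
      infer_instance
    · exact (isZero_double_X _ hi₀₁ k h₀ h₁).isIso (isZero_double_X _ hi₀₁ k h₀ h₁) _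
  have hf : ((singleDoubleShortComplex S hi₀₁ h).map (eval C c k)).f = 0 := hz.eq_of_src _ _
  have : IsIso ((singleDoubleShortComplex S hi₀₁ h).map (eval C c k)).g := this
  refine { exact := (ShortComplex.exact_iff_mono _ hf).2 inferInstance
           mono_f := ⟨fun _ _ _ ↦ hz.eq_of_tgt _ _⟩
           epi_g := inferInstance }

end

end HomologicalComplex

section

variable {C : Type u} [Category.{v} C] [Abelian C]

lemma CategoryTheory.ShortComplex.ShortExact.ext_one_eq_zero_iff [HasExt.{w} C]
    {S : ShortComplex C} (hS : S.ShortExact) [Injective S.X₂] (X : C) :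
    (∀ x : Abelian.Ext X S.X₁ 1, x = 0) ↔ ∀ g : X ⟶ S.X₃, ∃ l : X ⟶ S.X₂, l ≫ S.g = g := by
  constructor
  · intro hx g
    obtain ⟨y, hy⟩ := Abelian.Ext.covariant_sequence_exact₃ X hS (Abelian.Ext.mk₀ g)
      (zero_add 1) (hx _)
    obtain ⟨l, rfl⟩ := Abelian.Ext.homEquiv₀.symm.surjective y
    refine ⟨l, Abelian.Ext.homEquiv₀.symm.injective ?_⟩
    simpa [Abelian.Ext.homEquiv₀] using hy
  · intro hl x
    obtain ⟨y, rfl⟩ := Abelian.Ext.covariant_sequence_exact₁ X hS x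
      (Abelian.Ext.eq_zero_of_injective _) (zero_add 1)
    obtain ⟨g, rfl⟩ := Abelian.Ext.homEquiv₀.symm.surjective y
    obtain ⟨l, rfl⟩ := hl g
    change (Abelian.Ext.mk₀ (l ≫ S.g)).comp _ _ = 0
    rw [← Abelian.Ext.mk₀_comp_mk₀, Abelian.Ext.comp_assoc_of_second_deg_zero,
      ShortComplex.ShortExact.comp_extClass, Abelian.Ext.comp_zero]

lemma CategoryTheory.ShortComplex.exact_of_forall_injective [EnoughInjectives C]
    (S : ShortComplex C)
    (hS : ∀ (J : C) [Injective J] (f : S.X₂ ⟶ J), S.f ≫ f = 0 → ∃ h : S.X₃ ⟶ J, S.g ≫ h = f) :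
    S.Exact := by
  rw [S.exact_iff_kernel_ι_comp_cokernel_π_zero]
  obtain ⟨h, hh⟩ := hS _ (cokernel.π S.f ≫ Injective.ι (cokernel S.f)) (by simp)
  rw [← cancel_mono (Injective.ι (cokernel S.f)), Category.assoc, ← hh]
  simp

variable {ι : Type*} [DecidableEq ι] {c : ComplexShape ι} [HasExt.{w} (HomologicalComplex C c)]
  {i₀ i₁ : ι}

namespace HomologicalComplex

lemma ext_single_eq_zero_iff (X : HomologicalComplex C c)
    {S : ShortComplex C} (hS : S.ShortExact) [Injective S.X₂] (hi₀₁ : c.Rel i₀ i₁) (h : i₀ ≠ i₁) :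
    (∀ x : Abelian.Ext X ((single C c i₁).obj S.X₁) 1, x = 0) ↔
      ∀ (f : X.X i₀ ⟶ S.X₂) (g : X.X i₁ ⟶ S.X₃), f ≫ S.g = X.d i₀ i₁ ≫ g →
        (∀ k, X.d k i₀ ≫ f = 0) → ∃ l : X.X i₁ ⟶ S.X₂, X.d i₀ i₁ ≫ l = f ∧ l ≫ S.g = g := by
  have : Injective (singleDoubleShortComplex S hi₀₁ h).X₂ := injective_double_id hi₀₁ h _
  refine ((shortExact_singleDoubleShortComplex hS hi₀₁ h).ext_one_eq_zero_iff X).trans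
    ⟨fun H f g comm hf ↦ ?_, fun H φ ↦ ?_⟩
  · obtain ⟨l, hl⟩ := H (mkHomToDouble hi₀₁ h f g comm hf)
    have h₀ := congr_hom hl i₀
    have h₁ := congr_hom hl i₁
    simp only [comp_f, mkHomToDouble_f₀, mkHomToDouble_f₁, ← Category.assoc, cancel_mono] at h₀ h₁
    refine ⟨l.f i₁ ≫ (doubleXIso₁ _ hi₀₁ h).hom, ?_, h₁⟩
    rw [← h₀, ← Hom.comm_assoc, double_d _ hi₀₁ h]
    simp
  · have hφ := φ.comm i₀ i₁
    rw [double_d _ hi₀₁ h] at hφ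
    obtain ⟨l, h₀, h₁⟩ := H (φ.f i₀ ≫ (doubleXIso₀ _ hi₀₁).hom)
      (φ.f i₁ ≫ (doubleXIso₁ _ hi₀₁ h).hom) (by simp [← reassoc_of% hφ])
      (fun k ↦ by rw [← Hom.comm_assoc, double_d_eq_zero₁ _ _ _ _ h]; simp)
    refine ⟨mkHomToDouble (f := 𝟙 S.X₂) hi₀₁ h (X.d i₀ i₁ ≫ l) l (by simp) (by simp), ?_⟩
    apply to_double_hom_ext (hi₀₁ := hi₀₁)
    · simp [h₀]
    · simp [reassoc_of% h₁]

end HomologicalComplex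

/-- The standard short exact sequence embedding `Y` into an injective object. -/
noncomputable abbrev injectiveShortComplex [EnoughInjectives C] (Y : C) : ShortComplex C :=
  ShortComplex.mk (Injective.ι Y) (cokernel.π (Injective.ι Y)) (by simp)

lemma shortExact_injectiveShortComplex [EnoughInjectives C] (Y : C) :
    (injectiveShortComplex Y).ShortExact where
  exact := ShortComplex.exact_cokernel _

end

section

variable {C : Type u} [Category.{v} C] [Abelian C] [HasExt.{w} C]

theorem IsCotorsionPair.injective_mem {F G : Set C} (hFG : IsCotorsionPair F G) (J : C)
    [Injective J] : J ∈ G :=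
  (hFG.1 J).2 fun _ _ x ↦ x.eq_zero_of_injective

/-- A chain complex `X` is left `Ext¹`-orthogonal to the spheres on objects of `G` if and only if
it is exact and the cokernels of its differentials belong to `F`. -/
theorem IsCotorsionPair.chainComplex_ext_single_iff [EnoughInjectives C]
    [HasExt.{w} (HomologicalComplex C (ComplexShape.down ℤ))] {F G : Set C} (hFG : IsCotorsionPair F G)
    (X : ChainComplex C ℤ) :
    (∀ i : ℤ, ∀ G₀ ∈ G, ∀ x : Abelian.Ext X
        ((HomologicalComplex.single C (ComplexShape.down ℤ) i).obj G₀) 1, x = 0) ↔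
      ((∀ i : ℤ, IsZero (X.homology i)) ∧ ∀ i : ℤ, cokernel (X.d (i + 1) i) ∈ F) := by
  have lift_iff (i j : ℤ) (hij : j + 1 = i) (Y : C) := X.ext_single_eq_zero_iff
    (shortExact_injectiveShortComplex Y) (i₀ := i) (i₁ := j) hij (by lia)
  constructor
  · intro H
    refine ⟨fun i ↦ ?_, fun i ↦ (hFG.2 _).2 fun G₀ hG₀ ↦ ?_⟩
    · rw [← X.exactAt_iff_isZero_homology, X.exactAt_iff' (i + 1) i (i - 1) (by simp) (by simp)]
      apply ShortComplex.exact_of_forall_injective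
      intro J _ f hf
      change X.X i ⟶ J at f
      change X.d (i + 1) i ≫ f = 0 at hf
      change ∃ h : X.X (i - 1) ⟶ J, X.d i (i - 1) ≫ h = f
      have hf' (k : ℤ) : X.d k i ≫ f = 0 := by
        by_cases hk : k = i + 1
        · subst hk
          exact hf
        · rw [X.shape _ _ (fun h ↦ hk h.symm), zero_comp]
      obtain ⟨l, hl, -⟩ := (lift_iff i (i - 1) (by lia) J).1 (H _ J (hFG.injective_mem J))
        (f ≫ Injective.ι J) 0 (by rw [Category.assoc, cokernel.condition, comp_zero, comp_zero])
        (fun k ↦ by rw [reassoc_of% hf', zero_comp])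
      refine ⟨l ≫ Injective.factorThru (𝟙 J) (Injective.ι J), ?_⟩
      rw [reassoc_of% hl, Injective.comp_factorThru, Category.comp_id]
    · rw [(shortExact_injectiveShortComplex G₀).ext_one_eq_zero_iff]
      intro g
      obtain ⟨l, hl, hl'⟩ := (lift_iff (i + 1) i rfl G₀).1 (H i G₀ hG₀) 0
        (cokernel.π _ ≫ g) (by simp) (by simp)
      refine ⟨cokernel.desc _ l hl, ?_⟩
      rw [← cancel_epi (cokernel.π _), cokernel.π_desc_assoc, hl']
  · rintro ⟨hX, hF⟩ i G₀ hG₀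
    rw [lift_iff (i + 1) i rfl]
    intro f g comm hf
    have hex : (X.sc' (i + 1 + 1) (i + 1) i).Exact := by
      rw [← X.exactAt_iff' _ _ _ (by simp) (by simp), X.exactAt_iff_isZero_homology]
      exact hX _
    let e : X.X i ⟶ (injectiveShortComplex G₀).X₂ := hex.descToInjective f (hf _)
    have he : X.d (i + 1) i ≫ e = f := hex.comp_descToInjective f (hf _)
    obtain ⟨l, hl⟩ := ((shortExact_injectiveShortComplex G₀).ext_one_eq_zero_iff _).1
      ((hFG.2 _).1 (hF i) G₀ hG₀)
      (cokernel.desc _ (g - e ≫ (injectiveShortComplex G₀).g) (by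
        rw [Preadditive.comp_sub, reassoc_of% he, comm, sub_self]))
    refine ⟨e + cokernel.π _ ≫ l, by simp [he], ?_⟩
    rw [Preadditive.add_comp, Category.assoc, hl, cokernel.π_desc, add_sub_cancel]

end

/-- Theorem 5.19(ii) for chain complexes: for a cotorsion pair `(F, G)` of `R`-modules and
a chain complex `X`, one has `Ext¹ X (S^i G₀) = 0` for all `i : ℤ` and `G₀ ∈ G` if and
only if `X` is exact and all the objects `c_i(X) = coker (d_{i+1})` belong to `F`. -/
theorem statement17 {R : Type u} [Ring R]
    [HasExt.{w} (HomologicalComplex (ModuleCat.{u} R) (ComplexShape.down ℤ))]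
    [HasExt.{w} (ModuleCat.{u} R)]
    (F G : Set (ModuleCat.{u} R)) (hFG : IsCotorsionPair F G)
    (X : ChainComplex (ModuleCat.{u} R) ℤ) :
    (∀ i : ℤ, ∀ G₀ ∈ G,
        ∀ x : Abelian.Ext X
          ((HomologicalComplex.single (ModuleCat.{u} R) (ComplexShape.down ℤ) i).obj G₀)
          1, x = 0) ↔
      ((∀ i : ℤ, IsZero (X.homology i)) ∧ ∀ i : ℤ, cokernel (X.d (i + 1) i) ∈ F) := by
  exact hFG.chainComplex_ext_single_iff X
end
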